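/- Let R ⊆ ℂ be a finitely generated subring which is a domain, let t be the transcendence degree of the fraction field Frac(R) over ℚ, and let F be the algebraic closure of ℚ inside Frac(R) (a number field). Then there exists a constant C such that for every prime number p > C that splits completely in F, the number of ring homomorphisms R → 𝔽_p satisfies | #Hom(R, 𝔽_p) − [F : ℚ]·p^t | < C·p^{t−1/2}. -/

import Mathlib

/-- A prime number `p` splits completely in a number field `F` if the number of ring
homomorphisms from the ring of integers of `F` (the integral closure of `ℤ` in `F`)
to `𝔽_p` equals the degree `[F : ℚ]`. -/
def SplitsCompletely (F : Type*) [Field F] [Algebra ℚ F] (p : ℕ) : Prop :=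
  Nat.card ((integralClosure ℤ F) →+* ZMod p) = Module.finrank ℚ F

section LangWeil

open Polynomial

/-- The span of the monomials `x ^ i * y ^ j` with `i < n` and `j < deg f` in `S[x, y] / (f)`. -/
noncomputable def boxSpan {S : Type*} [CommRing S] (f : S[X][X]) (n : ℕ) :
    Submodule S (AdjoinRoot f) :=
  Submodule.span S {z | ∃ i j, i < n ∧ j < f.natDegree ∧
    z = AdjoinRoot.of f X ^ i * AdjoinRoot.root f ^ j}

section BoxSpan

variable {S : Type*} [CommRing S] {f : S[X][X]}

theorem monomial_mem_boxSpan {n i j : ℕ} (hi : i < n) (hj : j < f.natDegree) :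
    AdjoinRoot.of f X ^ i * AdjoinRoot.root f ^ j ∈ boxSpan f n :=
  Submodule.subset_span ⟨i, j, hi, hj, rfl⟩

theorem boxSpan_mono {m n : ℕ} (h : m ≤ n) : boxSpan f m ≤ boxSpan f n := by
  apply Submodule.span_mono
  rintro _ ⟨i, j, hi, hj, rfl⟩
  exact ⟨i, j, hi.trans_le h, hj, rfl⟩

theorem finrank_boxSpan_le [Nontrivial S] (f : S[X][X]) (n : ℕ) :
    Module.finrank S (boxSpan f n) ≤ n * f.natDegree := by
  classical
  have : {z | ∃ i j, i < n ∧ j < f.natDegree ∧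
      z = AdjoinRoot.of f X ^ i * AdjoinRoot.root f ^ j} =
      ((Finset.range n ×ˢ Finset.range f.natDegree).image
        fun ij ↦ AdjoinRoot.of f X ^ ij.1 * AdjoinRoot.root f ^ ij.2 :
        Finset (AdjoinRoot f)) := by
    ext z
    simp only [Set.mem_ofPred_eq, Finset.coe_image, Set.mem_image, Finset.mem_coe,
      Finset.mem_product, Finset.mem_range, Prod.exists]
    constructor
    · rintro ⟨i, j, hi, hj, rfl⟩; exact ⟨i, j, ⟨hi, hj⟩, rfl⟩
    · rintro ⟨i, j, ⟨hi, hj⟩, rfl⟩; exact ⟨i, j, hi, hj, rfl⟩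
  unfold boxSpan
  rw [this]
  refine (finrank_span_finset_le_card _).trans (Finset.card_image_le.trans ?_)
  simp

instance finite_boxSpan (f : S[X][X]) (n : ℕ) : Module.Finite S (boxSpan f n) := by
  have : {z | ∃ i j, i < n ∧ j < f.natDegree ∧
      z = AdjoinRoot.of f X ^ i * AdjoinRoot.root f ^ j} =
      (fun ij : ℕ × ℕ ↦ AdjoinRoot.of f X ^ ij.1 * AdjoinRoot.root f ^ ij.2) ''
        (Finset.range n ×ˢ Finset.range f.natDegree : Finset (ℕ × ℕ)) := by
    ext z
    simp only [Set.mem_ofPred_eq, Set.mem_image, Finset.mem_coe,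
      Finset.mem_product, Finset.mem_range, Prod.exists]
    constructor
    · rintro ⟨i, j, hi, hj, rfl⟩; exact ⟨i, j, ⟨hi, hj⟩, rfl⟩
    · rintro ⟨i, j, ⟨hi, hj⟩, rfl⟩; exact ⟨i, j, hi, hj, rfl⟩
  unfold boxSpan
  rw [this]
  exact Module.Finite.span_of_finite S (Set.Finite.image _ (Finset.finite_toSet _))

theorem X_pow_mul_mem_boxSpan {n : ℕ} (a : ℕ) {z : AdjoinRoot f} (hz : z ∈ boxSpan f n) :
    AdjoinRoot.of f X ^ a * z ∈ boxSpan f (n + a) := by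
  have : boxSpan f n ≤ (boxSpan f (n + a)).comap
      (LinearMap.mulLeft S (AdjoinRoot.of f X ^ a)) := by
    apply Submodule.span_le.2
    rintro _ ⟨i, j, hi, hj, rfl⟩
    simp only [SetLike.mem_coe, Submodule.mem_comap, LinearMap.mulLeft_apply]
    rw [← mul_assoc, ← pow_add]
    exact monomial_mem_boxSpan (by omega) hj
  exact this hz

theorem of_eq_sum (g : S[X]) : AdjoinRoot.of f g =
    ∑ i ∈ Finset.range (g.natDegree + 1), g.coeff i • AdjoinRoot.of f X ^ i := by
  conv_lhs => rw [g.as_sum_range_C_mul_X_pow, map_sum]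
  refine Finset.sum_congr rfl fun i _ ↦ ?_
  rw [map_mul, map_pow, Algebra.smul_def, AdjoinRoot.algebraMap_eq']
  rfl

theorem of_mul_mem_boxSpan {n a : ℕ} {g : S[X]} (hg : g.natDegree ≤ a) {z : AdjoinRoot f}
    (hz : z ∈ boxSpan f n) : AdjoinRoot.of f g * z ∈ boxSpan f (n + a) := by
  rw [of_eq_sum, Finset.sum_mul]
  refine Submodule.sum_mem _ fun i hi ↦ ?_
  rw [smul_mul_assoc]
  rw [Finset.mem_range] at hi
  exact Submodule.smul_mem _ _ (boxSpan_mono (by omega) (X_pow_mul_mem_boxSpan i hz))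

variable {e : ℕ} (hf : f.Monic) (he : ∀ j, (f.coeff j).natDegree ≤ e)
include hf he

theorem root_mul_mem_boxSpan {n : ℕ} {z : AdjoinRoot f} (hz : z ∈ boxSpan f n) :
    AdjoinRoot.root f * z ∈ boxSpan f (n + e) := by
  have : boxSpan f n ≤ (boxSpan f (n + e)).comap
      (LinearMap.mulLeft S (AdjoinRoot.root f)) := by
    apply Submodule.span_le.2
    rintro _ ⟨i, j, hi, hj, rfl⟩
    simp only [SetLike.mem_coe, Submodule.mem_comap, LinearMap.mulLeft_apply]
    rw [mul_left_comm, ← pow_succ']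
    rcases Nat.lt_or_ge (j + 1) f.natDegree with h | h
    · exact monomial_mem_boxSpan (by omega) h
    · have h1 : j + 1 = f.natDegree := by omega
      have h0 : AdjoinRoot.mk f (X ^ f.natDegree +
          ∑ i ∈ Finset.range f.natDegree, C (f.coeff i) * X ^ i) = 0 := by
        rw [← hf.as_sum, AdjoinRoot.mk_self]
      rw [map_add, map_pow, AdjoinRoot.mk_X, map_sum] at h0
      rw [h1, eq_neg_of_add_eq_zero_left h0, mul_neg, Finset.mul_sum]
      refine Submodule.neg_mem _ (Submodule.sum_mem _ fun k hk ↦ ?_)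
      rw [map_mul, map_pow, AdjoinRoot.mk_X, AdjoinRoot.mk_C, mul_left_comm]
      exact of_mul_mem_boxSpan (he k) (monomial_mem_boxSpan hi (Finset.mem_range.1 hk))
  exact this hz

theorem root_pow_mul_mem_boxSpan {n : ℕ} (j : ℕ) {z : AdjoinRoot f} (hz : z ∈ boxSpan f n) :
    AdjoinRoot.root f ^ j * z ∈ boxSpan f (n + e * j) := by
  induction j with
  | zero => simpa using hz
  | succ j ih =>
    rw [pow_succ', mul_assoc, mul_add, mul_one, ← add_assoc]
    exact root_mul_mem_boxSpan hf he ih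

theorem mul_mem_boxSpan {m n : ℕ} {w z : AdjoinRoot f} (hw : w ∈ boxSpan f m)
    (hz : z ∈ boxSpan f n) : w * z ∈ boxSpan f (m + n + e * f.natDegree) := by
  have : boxSpan f m ≤ (boxSpan f (m + n + e * f.natDegree)).comap
      (LinearMap.mulRight S z) := by
    apply Submodule.span_le.2
    rintro _ ⟨i, j, hi, hj, rfl⟩
    simp only [SetLike.mem_coe, Submodule.mem_comap, LinearMap.mulRight_apply]
    rw [mul_assoc]
    refine boxSpan_mono ?_ (X_pow_mul_mem_boxSpan i (root_pow_mul_mem_boxSpan hf he j hz))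
    have := Nat.mul_le_mul_left e hj.le
    omega
  exact this hw

omit hf he in
theorem natDegree_repr_le_of_mem_boxSpan (hf : f.Monic) {n : ℕ} {z : AdjoinRoot f}
    (hz : z ∈ boxSpan f n) (j : Fin f.natDegree) :
    ((AdjoinRoot.powerBasisAux' hf).repr z j).natDegree ≤ n := by
  induction hz using Submodule.span_induction with
  | mem z h =>
    obtain ⟨i, j', hi, hj', rfl⟩ := h
    have : AdjoinRoot.of f X ^ i * AdjoinRoot.root f ^ j' =
        AdjoinRoot.mk f (C (X ^ i) * X ^ j') := by
      simp
    have hmod : (C (X ^ i) * X ^ j' : S[X][X]) %ₘ f = C (X ^ i) * X ^ j' := by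
      nontriviality S
      rw [Polynomial.modByMonic_eq_self_iff hf]
      refine (degree_C_mul_X_pow_le _ _).trans_lt ?_
      rw [degree_eq_natDegree hf.ne_zero]
      exact_mod_cast hj'
    rw [this, AdjoinRoot.powerBasisAux'_repr_apply_to_fun, AdjoinRoot.modByMonicHom_mk, hmod,
      coeff_C_mul, coeff_X_pow]
    split_ifs
    · simpa using (natDegree_X_pow_le i).trans hi.le
    · simp
  | zero => simp
  | add x y _ _ hx hy =>
    rw [map_add, Finsupp.add_apply]
    exact natDegree_add_le_of_degree_le hx hy
  | smul a x _ hx =>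
    rw [← algebraMap_smul S[X] a x, map_smul, Finsupp.smul_apply, smul_eq_mul, algebraMap_eq]
    exact (natDegree_C_mul_le _ _).trans hx

theorem natDegree_norm_le_of_mem_boxSpan {n : ℕ} {z : AdjoinRoot f} (hz : z ∈ boxSpan f n) :
    (Algebra.norm S[X] z).natDegree ≤ f.natDegree * (n + e * f.natDegree) := by
  rw [Algebra.norm_eq_matrix_det (AdjoinRoot.powerBasisAux' hf), Matrix.det_apply]
  refine natDegree_sum_le_of_forall_le _ _ fun σ _ ↦ ?_
  refine (natDegree_smul_le _ _).trans ((natDegree_prod_le _ _).trans ?_)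
  refine (Finset.sum_le_card_nsmul _ _ (n + e * f.natDegree) fun i _ ↦ ?_).trans (by simp)
  rw [Algebra.leftMulMatrix_eq_repr_mul]
  apply natDegree_repr_le_of_mem_boxSpan hf
  have hi : AdjoinRoot.powerBasisAux' hf i = AdjoinRoot.root f ^ (i : ℕ) :=
    (AdjoinRoot.powerBasis' hf).basis_eq_pow i
  rw [hi, mul_comm z]
  refine boxSpan_mono ?_ (root_pow_mul_mem_boxSpan hf he i hz)
  have := Nat.mul_le_mul_left e i.2.le
  omega

end BoxSpan

section CurveDerivation

variable {k : Type*} [CommRing k]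

/-- The derivation of `k[X][Y]` differentiating coefficients with respect to `X`. -/
noncomputable def partialX (k : Type*) [CommRing k] : Derivation k k[X][X] k[X][X] :=
  PolynomialModule.equivPolynomialSelf.compDer (derivative' (R := k)).mapCoeffs

theorem coeff_partialX (g : k[X][X]) (j : ℕ) :
    (partialX k g).coeff j = derivative (g.coeff j) := rfl

theorem partialX_C_X : partialX k (C X) = 1 := by
  ext j : 1
  rw [coeff_partialX, coeff_C, coeff_one]
  split_ifs <;> simp

theorem partialX_X : partialX k X = 0 := by
  ext j : 1
  rw [coeff_partialX, coeff_X]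
  split_ifs <;> simp

/-- The derivation `f_Y ∂_X - f_X ∂_Y` of `k[X][Y]`, which annihilates `f`. -/
noncomputable def hamiltonianDerivation (f : k[X][X]) : Derivation k k[X][X] k[X][X] :=
  derivative f • partialX k - partialX k f • (derivative' (R := k[X])).restrictScalars k

theorem hamiltonianDerivation_apply (f g : k[X][X]) : hamiltonianDerivation f g =
    derivative f * partialX k g - partialX k f * derivative g := rfl

theorem mk_hamiltonianDerivation_eq_zero (f : k[X][X]) (g : k[X][X])
    (hg : AdjoinRoot.mk f g = 0) : AdjoinRoot.mk f (hamiltonianDerivation f g) = 0 := by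
  rw [AdjoinRoot.mk_eq_zero] at hg ⊢
  obtain ⟨h, rfl⟩ := hg
  rw [Derivation.leibniz, hamiltonianDerivation_apply f f, mul_comm (derivative f), sub_self,
    smul_zero, add_zero]
  exact Dvd.intro _ rfl

/-- The derivation of `k[X, Y] / (f)` induced by `f_Y ∂_X - f_X ∂_Y`. -/
noncomputable def curveDerivation (f : k[X][X]) :
    Derivation k (AdjoinRoot f) (AdjoinRoot f) :=
  Derivation.liftOfSurjective (f := (AdjoinRoot.mkₐ f).restrictScalars k)
    (d := hamiltonianDerivation f) AdjoinRoot.mk_surjective (mk_hamiltonianDerivation_eq_zero f)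

theorem curveDerivation_mk (f g : k[X][X]) :
    curveDerivation f (AdjoinRoot.mk f g) = AdjoinRoot.mk f (hamiltonianDerivation f g) :=
  Derivation.liftOfSurjective_apply (f := (AdjoinRoot.mkₐ f).restrictScalars k)
    AdjoinRoot.mk_surjective (mk_hamiltonianDerivation_eq_zero f) g

theorem curveDerivation_of_X (f : k[X][X]) :
    curveDerivation f (AdjoinRoot.of f X) = AdjoinRoot.mk f (derivative f) := by
  rw [← AdjoinRoot.mk_C, curveDerivation_mk, hamiltonianDerivation_apply, partialX_C_X]
  simp

theorem curveDerivation_root (f : k[X][X]) :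
    curveDerivation f (AdjoinRoot.root f) = - AdjoinRoot.mk f (partialX k f) := by
  rw [← AdjoinRoot.mk_X, curveDerivation_mk, hamiltonianDerivation_apply, partialX_X]
  simp

variable {f : k[X][X]} {e : ℕ} (hf : f.Monic) (he : ∀ j, (f.coeff j).natDegree ≤ e)
  (hd : 0 < f.natDegree)
include hf he hd

theorem mk_mem_boxSpan {g : k[X][X]} {a : ℕ} (ha : ∀ j, (g.coeff j).natDegree ≤ a) :
    AdjoinRoot.mk f g ∈ boxSpan f (1 + e * g.natDegree + a) := by
  rw [g.as_sum_range_C_mul_X_pow, map_sum, ← g.as_sum_range_C_mul_X_pow]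
  refine Submodule.sum_mem _ fun j hj ↦ ?_
  rw [map_mul, map_pow, AdjoinRoot.mk_X, AdjoinRoot.mk_C]
  apply of_mul_mem_boxSpan (ha j)
  have h1 : (1 : AdjoinRoot f) ∈ boxSpan f 1 := by
    simpa using monomial_mem_boxSpan (f := f) (i := 0) (j := 0) one_pos hd
  have := root_pow_mul_mem_boxSpan hf he j h1
  rw [mul_one] at this
  refine boxSpan_mono ?_ this
  have := Nat.mul_le_mul_left e (Nat.lt_succ_iff.1 (Finset.mem_range.1 hj))
  omega

theorem curveDerivation_mem_boxSpan {n : ℕ} {z : AdjoinRoot f} (hz : z ∈ boxSpan f n) :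
    curveDerivation f z ∈ boxSpan f (n + (1 + 2 * (e * f.natDegree) + e)) := by
  have hx : curveDerivation f (AdjoinRoot.of f X) ∈ boxSpan f (1 + e * f.natDegree + e) := by
    rw [curveDerivation_of_X]
    refine boxSpan_mono ?_ (mk_mem_boxSpan hf he hd (a := e) fun j ↦ ?_)
    · have := Nat.mul_le_mul_left e ((natDegree_derivative_le f).trans (Nat.sub_le _ 1))
      omega
    · rw [coeff_derivative]
      have : ((j : k[X]) + 1) = C ((j : k) + 1) := by simp
      rw [this]
      exact (natDegree_mul_C_le _ _).trans (he _)
  have hy : curveDerivation f (AdjoinRoot.root f) ∈ boxSpan f (1 + e * f.natDegree + e) := by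
    rw [curveDerivation_root]
    refine Submodule.neg_mem _ (boxSpan_mono ?_ (mk_mem_boxSpan hf he hd (a := e) fun j ↦ ?_))
    · have : (partialX k f).natDegree ≤ f.natDegree := by
        refine natDegree_le_iff_coeff_eq_zero.2 fun N hN ↦ ?_
        rw [coeff_partialX, coeff_eq_zero_of_natDegree_lt hN, derivative_zero]
      have := Nat.mul_le_mul_left e this
      omega
    · rw [coeff_partialX]
      exact (natDegree_derivative_le _).trans ((Nat.sub_le _ 1).trans (he j))
  have : boxSpan f n ≤ (boxSpan f (n + (1 + 2 * (e * f.natDegree) + e))).comap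
      (curveDerivation f).toLinearMap := by
    apply Submodule.span_le.2
    rintro _ ⟨i, j, hi, hj, rfl⟩
    simp only [SetLike.mem_coe, Submodule.mem_comap, Derivation.coeFn_coe]
    rw [Derivation.leibniz, Derivation.leibniz_pow, Derivation.leibniz_pow]
    have key : ∀ {i' j' : ℕ} {w : AdjoinRoot f} (m : ℕ), i' < n → j' < f.natDegree →
        w ∈ boxSpan f (1 + e * f.natDegree + e) →
        (AdjoinRoot.of f X ^ i' * AdjoinRoot.root f ^ j') * (m • w) ∈
          boxSpan f (n + (1 + 2 * (e * f.natDegree) + e)) := by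
      intro i' j' w m hi' hj' hw
      refine boxSpan_mono ?_ (mul_mem_boxSpan hf he (monomial_mem_boxSpan hi' hj')
        (nsmul_mem hw m))
      omega
    refine Submodule.add_mem _ ?_ ?_
    · convert key (i' := i) (j' := j - 1) j hi (by omega) hy using 1
      simp only [smul_eq_mul, nsmul_eq_mul]; ring
    · convert key (i' := i - 1) (j' := j) i (by omega) hj hx using 1
      simp only [smul_eq_mul, nsmul_eq_mul]; ring
  exact this hz

theorem iterate_curveDerivation_mem_boxSpan {n : ℕ} (l : ℕ) {z : AdjoinRoot f}
    (hz : z ∈ boxSpan f n) :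
    (curveDerivation f)^[l] z ∈ boxSpan f (n + l * (1 + 2 * (e * f.natDegree) + e)) := by
  induction l with
  | zero => simpa using hz
  | succ l ih =>
    rw [Function.iterate_succ_apply', Nat.succ_mul, ← add_assoc]
    exact curveDerivation_mem_boxSpan hf he hd ih

end CurveDerivation

/-- A nontrivial finitely generated algebra over a field `E` has a point in every algebraically
closed extension of `E`. -/
theorem nonempty_algHom_of_finiteType (E B Ω : Type) [Field E] [CommRing B] [Nontrivial B]
    [Algebra E B] [Algebra.FiniteType E B] [Field Ω] [IsAlgClosed Ω] [Algebra E Ω] :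
    Nonempty (B →ₐ[E] Ω) := by
  obtain ⟨m, hm⟩ := Ideal.exists_maximal B
  let _ : Field (B ⧸ m) := Ideal.Quotient.field m
  have hfin : Module.Finite E (B ⧸ m) := finite_of_finite_type_of_isJacobsonRing E (B ⧸ m)
  exact ⟨(IsAlgClosed.lift (R := E) (S := B ⧸ m) (M := Ω)).comp (Ideal.Quotient.mkₐ E m)⟩

/-- A finitely generated algebra over a domain `A ⊆ Ω`, with `Ω` algebraically closed, either has
an `Ω`-point over `A` or is killed by a nonzero element of `A`. -/
theorem exists_ringHom_or_exists_algebraMap_eq_zero {A Ω B : Type} [CommRing A] [IsDomain A]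
    [Field Ω] [IsAlgClosed Ω] [CommRing B] [Algebra A B] [Algebra.FiniteType A B]
    (j : A →+* Ω) (hj : Function.Injective j) :
    (∃ ψ : B →+* Ω, ψ.comp (algebraMap A B) = j) ∨ ∃ a : A, a ≠ 0 ∧ algebraMap A B a = 0 := by
  by_cases h : ∃ a : A, a ≠ 0 ∧ algebraMap A B a = 0
  · exact Or.inr h
  left
  push Not at h
  have hft : Algebra.FiniteType (FractionRing A)
      (Localization (Algebra.algebraMapSubmonoid B (nonZeroDivisors A))) := by
    have : IsLocalization (Submonoid.map (algebraMap A B) (nonZeroDivisors A))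
        (Localization (Algebra.algebraMapSubmonoid B (nonZeroDivisors A))) :=
      Localization.isLocalization
    rw [← RingHom.finiteType_algebraMap]
    exact RingHom.finiteType_localizationPreserves (algebraMap A B) (nonZeroDivisors A)
      (FractionRing A) (Localization (Algebra.algebraMapSubmonoid B (nonZeroDivisors A)))
      (RingHom.finiteType_algebraMap.2 inferInstance)
  have hnt : Nontrivial (Localization (Algebra.algebraMapSubmonoid B (nonZeroDivisors A))) := by
    rw [← not_subsingleton_iff_nontrivial,
      IsLocalization.subsingleton_iff (M := Algebra.algebraMapSubmonoid B (nonZeroDivisors A))]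
    rintro ⟨a, ha, ha0⟩
    exact h a (nonZeroDivisors.ne_zero ha) ha0
  let _ : Algebra A Ω := j.toAlgebra
  have : FaithfulSMul A Ω := (faithfulSMul_iff_algebraMap_injective A Ω).2 hj
  let _ : Algebra (FractionRing A) Ω := FractionRing.liftAlgebra A Ω
  obtain ⟨θ⟩ := nonempty_algHom_of_finiteType (FractionRing A)
    (Localization (Algebra.algebraMapSubmonoid B (nonZeroDivisors A))) Ω
  refine ⟨θ.toRingHom.comp (algebraMap B _), ?_⟩
  ext a
  have h2 := θ.commutes (algebraMap A (FractionRing A) a)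
  rw [← IsScalarTower.algebraMap_apply A (FractionRing A) Ω,
    ← IsScalarTower.algebraMap_apply A (FractionRing A),
    IsScalarTower.algebraMap_apply A B] at h2
  exact h2

/-- The bivariate polynomial, monic of degree `i` in the outer variable, whose other coefficients
are the polynomials of degree at most `e` with coefficients `u`. -/
noncomputable def monicBox {A : Type} [CommRing A] (i e : ℕ) (u : Fin i × Fin (e + 1) → A) :
    A[X][X] :=
  X ^ i + ∑ a : Fin i, C (∑ b : Fin (e + 1), C (u (a, b)) * X ^ (b : ℕ)) * X ^ (a : ℕ)

theorem monicBox_map {A L : Type} [CommRing A] [CommRing L] (φ : A →+* L) (i e : ℕ)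
    (u : Fin i × Fin (e + 1) → A) :
    (monicBox i e u).map (mapRingHom φ) = monicBox i e (φ ∘ u) := by
  simp [monicBox, Polynomial.map_sum]

theorem monicBox_monic {A : Type} [CommRing A] (i e : ℕ)
    (u : Fin i × Fin (e + 1) → A) : (monicBox i e u).Monic := by
  nontriviality A
  refine monic_X_pow_add ?_
  refine (degree_sum_fin_lt (n := i) fun a ↦ ∑ b : Fin (e + 1), C (u (a, b)) * X ^ (b : ℕ))

theorem natDegree_monicBox {A : Type} [CommRing A] [Nontrivial A] (i e : ℕ)
    (u : Fin i × Fin (e + 1) → A) : (monicBox i e u).natDegree = i := by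
  refine natDegree_eq_of_degree_eq_some ?_
  refine (degree_add_eq_left_of_degree_lt ?_).trans (degree_X_pow i)
  rw [degree_X_pow]
  exact (degree_sum_fin_lt (n := i) fun a ↦ ∑ b : Fin (e + 1), C (u (a, b)) * X ^ (b : ℕ))

theorem exists_eq_monicBox {A : Type} [CommRing A] {g : A[X][X]} {e : ℕ} (hg : g.Monic)
    (he : ∀ j, (g.coeff j).natDegree ≤ e) : ∃ u, g = monicBox g.natDegree e u := by
  refine ⟨fun ab ↦ (g.coeff ab.1).coeff ab.2, ?_⟩
  conv_lhs => rw [hg.as_sum]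
  rw [monicBox, Finset.sum_range]
  congr 1
  refine Finset.sum_congr rfl fun a _ ↦ ?_
  congr 2
  rw [(g.coeff a).as_sum_range_C_mul_X_pow' (n := e + 1) (Nat.lt_succ_of_le (he _)),
    Finset.sum_range]

/-- There is a universal factorization of prescribed shape. -/
theorem exists_universal_factorization {A : Type} [CommRing A] (f : A[X][X]) (i e : ℕ) :
    ∃ (B : Type) (_ : CommRing B) (_ : Algebra A B), Algebra.FiniteType A B ∧
      ∀ {L : Type} [Field L] (φ : A →+* L),
        (∃ ψ : B →+* L, ψ.comp (algebraMap A B) = φ) ↔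
        ∃ u v, monicBox i e u * monicBox (f.natDegree - i) e v = f.map (mapRingHom φ) := by
  let σ := (Fin i × Fin (e + 1)) ⊕ (Fin (f.natDegree - i) × Fin (e + 1))
  let P := MvPolynomial σ A
  let F : P[X][X] := monicBox i e (fun s ↦ MvPolynomial.X (Sum.inl s)) *
    monicBox (f.natDegree - i) e (fun s ↦ MvPolynomial.X (Sum.inr s)) -
      f.map (mapRingHom MvPolynomial.C)
  let I : Ideal P := Ideal.span {c | ∃ m n, c = (F.coeff m).coeff n}
  have hF {L : Type} [Field L] (θ : P →+* L) : F.map (mapRingHom θ) = 0 ↔ I ≤ RingHom.ker θ := by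
    rw [Ideal.span_le]
    constructor
    · rintro h _ ⟨m, n, rfl⟩
      rw [SetLike.mem_coe, RingHom.mem_ker, ← coeff_map, ← coe_mapRingHom, ← coeff_map, h]
      simp
    · intro h
      ext m n
      rw [coeff_map, coe_mapRingHom, coeff_map]
      exact h ⟨m, n, rfl⟩
  have hF' {L : Type} [Field L] (θ : P →+* L) : F.map (mapRingHom θ) =
      monicBox i e (fun s ↦ θ (MvPolynomial.X (Sum.inl s))) *
        monicBox (f.natDegree - i) e (fun s ↦ θ (MvPolynomial.X (Sum.inr s))) -
        f.map (mapRingHom (θ.comp MvPolynomial.C)) := by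
    simp only [F, Polynomial.map_sub, Polynomial.map_mul, monicBox_map, Polynomial.map_map,
      mapRingHom_comp]
    rfl
  refine ⟨P ⧸ I, inferInstance, inferInstance, inferInstance, fun {L} _ φ ↦ ⟨?_, ?_⟩⟩
  · rintro ⟨ψ, rfl⟩
    have h := (hF (ψ.comp (Ideal.Quotient.mk I))).2 (fun x hx ↦ by
      rw [RingHom.mem_ker, RingHom.comp_apply, Ideal.Quotient.eq_zero_iff_mem.2 hx, map_zero])
    rw [hF', sub_eq_zero] at h
    exact ⟨_, _, h⟩
  · rintro ⟨u, v, h⟩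
    let θ : P →+* L := MvPolynomial.eval₂Hom φ (Sum.elim u v)
    have hθ : F.map (mapRingHom θ) = 0 := by
      rw [hF', sub_eq_zero]
      have : θ.comp MvPolynomial.C = φ := RingHom.ext fun a ↦ MvPolynomial.eval₂Hom_C φ _ a
      rw [this, ← h]
      congr 2 <;> exact funext fun s ↦ MvPolynomial.eval₂Hom_X' φ _ _
    refine ⟨Ideal.Quotient.lift I θ fun a ha ↦ (hF θ).1 hθ ha, ?_⟩
    ext a
    exact MvPolynomial.eval₂Hom_C φ _ a

theorem natDegree_coeff_le_of_mul {L : Type} [Field L] {f g h : L[X][X]} (hf : f ≠ 0)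
    (hgh : g * h = f) {e : ℕ} (he : ∀ j, (f.coeff j).natDegree ≤ e) (j : ℕ) :
    (g.coeff j).natDegree ≤ e := by
  have coeff_swap (p : L[X][X]) (m n : ℕ) :
      ((Bivariate.swap p).coeff m).coeff n = (p.coeff n).coeff m := by
    induction p using Polynomial.induction_on' with
    | add p q hp hq => simp [hp, hq]
    | monomial a p =>
      induction p using Polynomial.induction_on' with
      | add p q hp hq => rw [map_add, map_add]; simp only [coeff_add, hp, hq]
      | monomial b r =>
        rw [Bivariate.swap_monomial_monomial]
        simp only [coeff_monomial]
        split_ifs <;> simp_all [coeff_monomial]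
  have hsf : (Bivariate.swap f).natDegree ≤ e := by
    refine natDegree_le_iff_coeff_eq_zero.2 fun N hN ↦ ?_
    ext n
    rw [coeff_swap, coeff_zero]
    exact coeff_eq_zero_of_natDegree_lt ((he n).trans_lt hN)
  have hsg : (Bivariate.swap g).natDegree ≤ e := by
    refine le_trans (natDegree_le_of_dvd (Dvd.intro (Bivariate.swap h) ?_) ?_) hsf
    · rw [← map_mul, hgh]
    · simpa using hf
  refine natDegree_le_iff_coeff_eq_zero.2 fun N hN ↦ ?_
  rw [← coeff_swap, coeff_eq_zero_of_natDegree_lt (hsg.trans_lt hN), coeff_zero]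

/-- **Bertini–Noether**: absolute irreducibility is preserved by generic specialization. -/
theorem exists_ne_zero_irreducible_map {A Ω : Type} [CommRing A] [IsDomain A]
    [Field Ω] [IsAlgClosed Ω] (j : A →+* Ω) (hj : Function.Injective j) {f : A[X][X]}
    (hf : f.Monic) (hirr : Irreducible (f.map (mapRingHom j))) :
    ∃ a : A, a ≠ 0 ∧ ∀ {L : Type} [Field L] (φ : A →+* L), φ a ≠ 0 →
      Irreducible (f.map (mapRingHom φ)) := by
  classical
  obtain ⟨e, he⟩ : ∃ e, ∀ j, (f.coeff j).natDegree ≤ e := by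
    refine ⟨f.support.sup fun j ↦ (f.coeff j).natDegree, fun j ↦ ?_⟩
    by_cases hj : j ∈ f.support
    · exact Finset.le_sup (f := fun j ↦ (f.coeff j).natDegree) hj
    · simp [notMem_support_iff.1 hj]
  have hpos : f.natDegree ≠ 0 := by
    intro h
    rw [hf.natDegree_eq_zero.1 h] at hirr
    simp at hirr
  have key (i : ℕ) (hi : 0 < i) (hi' : i < f.natDegree) : ∃ a : A, a ≠ 0 ∧
      ∀ {L : Type} [Field L] (φ : A →+* L), φ a ≠ 0 →
        ¬ ∃ u v, monicBox i e u * monicBox (f.natDegree - i) e v = f.map (mapRingHom φ) := by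
    obtain ⟨B, _, _, _, hB⟩ := exists_universal_factorization f i e
    rcases exists_ringHom_or_exists_algebraMap_eq_zero (B := B) j hj with h | ⟨a, ha, ha0⟩
    · obtain ⟨u, v, h⟩ := (hB j).1 h
      rw [(hf.map _).irreducible_iff_natDegree] at hirr
      have := hirr.2 _ _ (monicBox_monic _ _ _) (monicBox_monic _ _ _) h
      rw [natDegree_monicBox, natDegree_monicBox] at this
      omega
    · refine ⟨a, ha, fun φ hφ h ↦ hφ ?_⟩
      obtain ⟨ψ, rfl⟩ := (hB φ).2 h
      simp [ha0]
  choose! a ha0 ha using key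
  refine ⟨∏ i ∈ Finset.Ioo 0 f.natDegree, a i, ?_, fun {L} _ φ hφ ↦ ?_⟩
  · rw [Finset.prod_ne_zero_iff]
    exact fun i hi ↦ ha0 i (Finset.mem_Ioo.1 hi).1 (Finset.mem_Ioo.1 hi).2
  · rw [map_prod, Finset.prod_ne_zero_iff] at hφ
    rw [(hf.map _).irreducible_iff_natDegree]
    have hdeg : (f.map (mapRingHom φ)).natDegree = f.natDegree := hf.natDegree_map _
    refine ⟨fun h ↦ hpos (by rw [← hdeg, h, natDegree_one]), fun g h hg hh hgh ↦ ?_⟩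
    by_contra! hne
    have hadd : g.natDegree + h.natDegree = f.natDegree := by
      rw [← hdeg, ← hgh, hg.natDegree_mul hh]
    have he' (j : ℕ) : ((f.map (mapRingHom φ)).coeff j).natDegree ≤ e := by
      rw [coeff_map]
      exact natDegree_map_le.trans (he j)
    obtain ⟨u, hu⟩ := exists_eq_monicBox hg
      (natDegree_coeff_le_of_mul (hf.map _).ne_zero hgh he')
    obtain ⟨v, hv⟩ := exists_eq_monicBox hh
      (natDegree_coeff_le_of_mul (hf.map _).ne_zero ((mul_comm h g).trans hgh) he')
    have hi : 0 < g.natDegree ∧ g.natDegree < f.natDegree := by omega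
    refine ha g.natDegree hi.1 hi.2 φ (hφ _ (Finset.mem_Ioo.2 hi)) ?_
    have h2 : f.natDegree - g.natDegree = h.natDegree := by omega
    rw [h2]
    exact ⟨u, v, by rw [← hu, ← hv, hgh]⟩

/-- A polynomial that is irreducible over an algebraically closed field stays irreducible over any
extension. -/
theorem irreducible_map_of_isAlgClosed {k K : Type} [Field k] [IsAlgClosed k] [Field K]
    (φ : k →+* K) {f : k[X][X]} (hf : f.Monic) (hirr : Irreducible f) :
    Irreducible (f.map (mapRingHom φ)) := by
  obtain ⟨a, ha, h⟩ := exists_ne_zero_irreducible_map (RingHom.id k) Function.injective_id hf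
    (by simpa [mapRingHom_id] using hirr)
  exact h φ ((map_ne_zero φ).2 ha)

/-- An element of a finite free algebra divides its norm. -/
theorem dvd_algebraMap_norm {R S : Type*} [CommRing R] [CommRing S] [Algebra R S] [Module.Free R S]
    [Module.Finite R S] (z : S) : z ∣ algebraMap R S (Algebra.norm R z) := by
  rcases subsingleton_or_nontrivial R with hR | hR
  · have := Module.subsingleton R S
    exact ⟨0, Subsingleton.elim _ _⟩
  set q := (Algebra.lmul R S z).charpoly with hq
  have h0 : aeval z q = 0 := by
    have h := (Algebra.lmul R S z).aeval_self_charpoly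
    rw [Polynomial.aeval_algHom_apply] at h
    have := congrArg (fun φ : Module.End R S ↦ φ 1) h
    simpa [hq] using this
  have hn : Algebra.norm R z = (-1) ^ Module.finrank R S * q.coeff 0 := by
    rw [Algebra.norm_apply]
    exact LinearMap.det_eq_sign_charpoly_coeff _
  rw [hn, map_mul]
  apply Dvd.dvd.mul_left
  rw [← q.divX_mul_X_add] at h0
  simp only [map_add, map_mul, aeval_X, aeval_C] at h0
  rw [eq_neg_of_add_eq_zero_right h0]
  exact (Dvd.intro_left _ rfl).neg_right

/-- If `x` is not a `p`-th power in a field `K` of characteristic `p`, then its powers of exponent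
less than `p` are linearly independent over `K ^ p`. -/
theorem eq_zero_of_eval₂_frobenius_eq_zero {K : Type*} [Field K] {p : ℕ} [Fact p.Prime] [CharP K p]
    {x : K} (hx : ∀ w, w ^ p ≠ x) {N : K[X]} (hN : N.natDegree < p)
    (h : N.eval₂ (frobenius K p) x = 0) : N = 0 := by
  let _ : Algebra K K := (frobenius K p).toAlgebra
  have hp := (Fact.out : p.Prime)
  have hmin : X ^ p - C x = minpoly K x := by
    refine minpoly.eq_of_irreducible_of_monic (X_pow_sub_C_irreducible_of_prime hp hx) ?_
      (monic_X_pow_sub_C _ hp.ne_zero)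
    simp only [map_sub, map_pow, aeval_X, aeval_C]
    rw [show algebraMap K K x = x ^ p from rfl, sub_self]
  by_contra hne
  have := natDegree_le_of_dvd (minpoly.dvd K x (p := N) h) hne
  rw [← hmin, natDegree_X_pow_sub_C] at this
  omega

section Stepanov

variable {k : Type} [Field k] {p : ℕ} [hp : Fact p.Prime] [CharP k p] {f : k[X][X]}

omit hp in
theorem mk_derivative_ne_zero (hf : f.Monic) (hd : 0 < f.natDegree) (hdp : f.natDegree < p) :
    AdjoinRoot.mk f (derivative f) ≠ 0 := by
  have hne : derivative f ≠ 0 := by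
    intro h
    have := congrArg (fun g ↦ g.coeff (f.natDegree - 1)) h
    simp only [coeff_derivative, coeff_zero, Nat.sub_add_cancel hd] at this
    rw [hf.coeff_natDegree, one_mul] at this
    norm_cast at this
    rw [Nat.sub_add_cancel hd, CharP.cast_eq_zero_iff k[X] p] at this
    exact absurd (Nat.le_of_dvd hd this) (by omega)
  refine AdjoinRoot.mk_ne_zero_of_natDegree_lt hf hne ?_
  exact natDegree_derivative_lt hd.ne'

theorem isDomain_adjoinRoot {S : Type*} [Field S] {g : S[X][X]} (hg : Irreducible g) :
    IsDomain (AdjoinRoot g) :=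
  AdjoinRoot.isDomain_of_prime hg.prime

omit hp in
theorem pow_ne_of_X {K : Type*} [Field K] [Algebra (AdjoinRoot f) K] [CharP K p]
    [IsDomain (AdjoinRoot f)]
    [IsFractionRing (AdjoinRoot f) K] (hf : f.Monic) (hd : 0 < f.natDegree)
    (hdp : f.natDegree < p) (w : K) : w ^ p ≠ algebraMap (AdjoinRoot f) K (AdjoinRoot.of f X) := by
  intro h
  obtain ⟨u, v, hv, rfl⟩ := IsFractionRing.div_surjective (A := AdjoinRoot f) w
  have hv0 : v ≠ 0 := nonZeroDivisors.ne_zero hv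
  rw [div_pow, div_eq_iff (pow_ne_zero _ (by simpa using hv0)), ← map_pow, ← map_pow,
    ← map_mul] at h
  have h := IsFractionRing.injective (AdjoinRoot f) K h
  have h2 := congrArg (curveDerivation f) h
  have hchar : (p : AdjoinRoot f) = 0 := by
    have : (p : AdjoinRoot f) = algebraMap k _ (p : k) := (map_natCast (algebraMap k _) p).symm
    rw [this, CharP.cast_eq_zero, map_zero]
  have hpow (z : AdjoinRoot f) : curveDerivation f (z ^ p) = 0 := by
    rw [Derivation.leibniz_pow, ← Nat.cast_smul_eq_nsmul (AdjoinRoot f), hchar, zero_smul]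
  rw [Derivation.leibniz, hpow, hpow, curveDerivation_of_X, smul_zero, zero_add, smul_eq_mul] at h2
  exact mul_ne_zero (pow_ne_zero _ hv0) (mk_derivative_ne_zero (p := p) hf hd hdp) h2.symm

/-- The monomials `x ^ i * y ^ j` with `i < A` and `j < deg f` are linearly independent over
the `p`-th powers in `k[x, y] / (f)`, as long as `p` is large compared to `A` and `f`. -/
theorem eq_zero_of_sum_mul_pow_eq_zero [IsAlgClosed k] (hf : f.Monic) (hirr : Irreducible f)
    (hfp : f.map (mapRingHom (frobenius k p)) = f) {e : ℕ} (he : ∀ j, (f.coeff j).natDegree ≤ e)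
    {A : ℕ} (hA : f.natDegree * (A + e * f.natDegree) < p) (hdp : f.natDegree < p)
    (r : Fin A → Fin f.natDegree → AdjoinRoot f)
    (h : ∑ i : Fin A, ∑ j : Fin f.natDegree,
      AdjoinRoot.of f X ^ (i : ℕ) * AdjoinRoot.root f ^ (j : ℕ) * r i j ^ p = 0) :
    r = 0 := by
  have hd : 0 < f.natDegree := by
    rw [Nat.pos_iff_ne_zero]
    intro h0
    rw [hf.natDegree_eq_zero.1 h0] at hirr
    exact not_irreducible_one hirr
  have := isDomain_adjoinRoot hirr
  let R := AdjoinRoot f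
  let K := FractionRing R
  let x : K := algebraMap R K (AdjoinRoot.of f X)
  let y : K := algebraMap R K (AdjoinRoot.root f)
  let ι : k →+* K := algebraMap k K
  have hι : ι = ((algebraMap R K).comp (AdjoinRoot.of f)).comp C := by
    ext c; rfl
  have : CharP K p := charP_of_injective_algebraMap (algebraMap k K).injective p
  let F : K[X][X] := f.map (mapRingHom ι)
  have hF : F.Monic := hf.map _
  have hFd : F.natDegree = f.natDegree := hf.natDegree_map _
  have hFirr : Irreducible F := irreducible_map_of_isAlgClosed ι hf hirr
  have hFe (j : ℕ) : (F.coeff j).natDegree ≤ e := by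
    rw [coeff_map]; exact natDegree_map_le.trans (he j)
  have := isDomain_adjoinRoot hFirr
  have : Module.Free K[X] (AdjoinRoot F) := .of_basis (AdjoinRoot.powerBasisAux' hF)
  have : Module.Finite K[X] (AdjoinRoot F) := .of_basis (AdjoinRoot.powerBasisAux' hF)
  let φ : K[X] →+* K := eval₂RingHom (frobenius K p) x
  have hφ0 : eval₂ φ y F = 0 := by
    have h1 : φ.comp (mapRingHom ι) = ((algebraMap R K).comp (AdjoinRoot.of f)).comp
        (mapRingHom (frobenius k p)) := by
      ext c
      · simp [φ, hι, frobenius_def]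
      · simp [φ, x]
    rw [eval₂_map, h1, ← eval₂_map, hfp]
    have := AdjoinRoot.eval₂_root f
    rw [← hom_eval₂, this, map_zero]
  let θ : AdjoinRoot F →+* K := AdjoinRoot.lift φ y hφ0
  let H : K[X][X] := ∑ i, ∑ j, C (C (algebraMap R K (r i j)) * X ^ (i : ℕ)) * X ^ (j : ℕ)
  have hmk : AdjoinRoot.mk F H = ∑ i, ∑ j : Fin f.natDegree, algebraMap R K (r i j) •
      (AdjoinRoot.of F X ^ (i : ℕ) * AdjoinRoot.root F ^ (j : ℕ)) := by
    simp only [H, map_sum, map_mul, map_pow, AdjoinRoot.mk_X, AdjoinRoot.mk_C]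
    refine Finset.sum_congr rfl fun i _ ↦ Finset.sum_congr rfl fun j _ ↦ ?_
    rw [Algebra.smul_def, mul_assoc]
    rfl
  have hbox : AdjoinRoot.mk F H ∈ boxSpan F A := by
    rw [hmk]
    refine Submodule.sum_mem _ fun i _ ↦ Submodule.sum_mem _ fun j _ ↦ Submodule.smul_mem _ _ ?_
    exact monomial_mem_boxSpan i.2 (by rw [hFd]; exact j.2)
  have hθ : θ (AdjoinRoot.mk F H) = 0 := by
    rw [hmk, map_sum, ← map_zero (algebraMap R K), ← h, map_sum]
    refine Finset.sum_congr rfl fun i _ ↦ ?_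
    rw [map_sum, map_sum]
    refine Finset.sum_congr rfl fun j _ ↦ ?_
    rw [Algebra.smul_def, map_mul, map_mul, map_mul, map_mul, map_pow, map_pow, map_pow, map_pow,
      map_pow, mul_comm]
    congr 1
    · congr 2
      · simp [θ, φ, x]
      · simp [θ, y]
    · rw [IsScalarTower.algebraMap_apply K K[X] (AdjoinRoot F), AdjoinRoot.algebraMap_eq]
      simp [θ, φ, frobenius_def]
  have hnorm : Algebra.norm K[X] (AdjoinRoot.mk F H) = 0 := by
    refine eq_zero_of_eval₂_frobenius_eq_zero (p := p) (x := x)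
      (pow_ne_of_X (p := p) hf hd hdp) ?_ ?_
    · refine (natDegree_norm_le_of_mem_boxSpan hF hFe hbox).trans_lt ?_
      rwa [hFd]
    · have h1 : θ (algebraMap K[X] (AdjoinRoot F) (Algebra.norm K[X] (AdjoinRoot.mk F H))) = 0 := by
        obtain ⟨w, hw⟩ := dvd_algebraMap_norm (R := K[X]) (AdjoinRoot.mk F H)
        rw [hw, map_mul, hθ, zero_mul]
      rw [AdjoinRoot.algebraMap_eq] at h1
      simpa [θ, φ] using h1
  rw [Algebra.norm_eq_zero_iff] at hnorm
  have hH : H = 0 := by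
    by_contra hne
    refine AdjoinRoot.mk_ne_zero_of_natDegree_lt hF hne ?_ hnorm
    rw [hFd, Nat.lt_iff_le_pred hd]
    refine natDegree_sum_le_of_forall_le _ _ fun i _ ↦
      natDegree_sum_le_of_forall_le _ _ fun j _ ↦ ?_
    exact (natDegree_C_mul_X_pow_le _ _).trans (Nat.le_pred_of_lt j.2)
  ext i j
  have := congrArg (fun g : K[X][X] ↦ (g.coeff (j : ℕ)).coeff (i : ℕ)) hH
  simp only [H, finsetSum_coeff, coeff_C_mul_X_pow, coeff_zero, Fin.val_inj] at this
  rw [Finset.sum_eq_single i, Finset.sum_eq_single j] at this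
  · simpa using this
  · intro j' _ hj
    rw [if_neg (Ne.symm hj), coeff_zero]
  · simp
  · intro i' _ hi
    refine Finset.sum_eq_zero fun j' _ ↦ ?_
    split_ifs
    · rw [coeff_C_mul_X_pow, if_neg fun h ↦ hi (Fin.ext h).symm]
    · rw [coeff_zero]
  · simp

end Stepanov

section Vanishing

variable {k R : Type*} [Field k] [CommRing R] [Algebra k R] (D : Derivation k R R) (ε : R →ₐ[k] k)

/-- `VanishesToOrder D ε n z` means that `z` and its first `n - 1` derivatives vanish at `ε`. -/
def VanishesToOrder (n : ℕ) (z : R) : Prop := ∀ l < n, ε (D^[l] z) = 0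

variable {D ε}

theorem VanishesToOrder.mono {m n : ℕ} (h : m ≤ n) {z : R} (hz : VanishesToOrder D ε n z) :
    VanishesToOrder D ε m z := fun l hl ↦ hz l (hl.trans_le h)

theorem VanishesToOrder.derivation {n : ℕ} {z : R} (hz : VanishesToOrder D ε n z) :
    VanishesToOrder D ε (n - 1) (D z) := fun l hl ↦ by
  simpa using hz (l + 1) (by omega)

theorem VanishesToOrder.mul {m n : ℕ} {z w : R} (hz : VanishesToOrder D ε m z)
    (hw : VanishesToOrder D ε n w) : VanishesToOrder D ε (m + n) (z * w) := by
  intro l hl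
  induction l generalizing m n z w with
  | zero =>
    rw [Function.iterate_zero_apply, map_mul]
    rcases Nat.eq_zero_or_pos m with rfl | hm
    · rw [show ε w = 0 from hw 0 (by omega), mul_zero]
    · rw [show ε z = 0 from hz 0 hm, zero_mul]
  | succ l ih =>
    rw [Function.iterate_succ_apply, Derivation.leibniz, iterate_map_add, map_add, smul_eq_mul,
      smul_eq_mul]
    rcases Nat.eq_zero_or_pos m with rfl | hm
    · rcases Nat.eq_zero_or_pos n with rfl | hn
      · omega
      rw [ih hz hw.derivation (by omega), ih (hw.mono (Nat.sub_le n 1)) hz.derivation (by omega),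
        add_zero]
    · rcases Nat.eq_zero_or_pos n with rfl | hn
      · rw [ih (hz.mono (Nat.sub_le m 1)) hw.derivation (by omega), ih hw hz.derivation (by omega),
          add_zero]
      rw [ih hz hw.derivation (by omega), ih hw hz.derivation (by omega), add_zero]

theorem VanishesToOrder.pow {z : R} (hz : ε z = 0) (n : ℕ) : VanishesToOrder D ε n (z ^ n) := by
  induction n with
  | zero => intro l hl; omega
  | succ n ih =>
    rw [pow_succ]
    refine ih.mul fun l hl ↦ ?_
    obtain rfl : l = 0 := by omega
    exact hz

theorem eval_iterate_derivation_pow_mul {u : R} (hu : ε u = 0) (l : ℕ) (w : R) :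
    ε (D^[l] (u ^ l * w)) = l.factorial * ε (D u) ^ l * ε w := by
  induction l generalizing w with
  | zero => simp
  | succ l ih =>
    have h : D (u ^ (l + 1) * w) = u ^ l * (u * D w + (l + 1) * D u * w) := by
      rw [Derivation.leibniz, Derivation.leibniz_pow]
      simp only [smul_eq_mul, nsmul_eq_mul, Nat.add_sub_cancel]
      push_cast
      ring
    rw [Function.iterate_succ_apply, h, ih, Nat.factorial_succ]
    simp only [map_add, map_mul, hu, map_natCast, map_one]
    push_cast
    ring

theorem iterate_derivation_sum {ι : Type*} (D : Derivation k R R) (l : ℕ) (s : Finset ι)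
    (z : ι → R) : D^[l] (∑ i ∈ s, z i) = ∑ i ∈ s, D^[l] (z i) := by
  simp_rw [← Derivation.coeFn_coe, ← Module.End.pow_apply, map_sum]

theorem iterate_derivation_smul (D : Derivation k R R) (l : ℕ) (c : k) (z : R) :
    D^[l] (c • z) = c • D^[l] z := by
  simp_rw [← Derivation.coeFn_coe, ← Module.End.pow_apply, map_smul]

/-- The number of common zeros of high order is controlled by the codimension of an ideal. -/
theorem card_mul_le_finrank_quotient {ι : Type*} [Fintype ι] (D : Derivation k R R)
    {ε : ι → R →ₐ[k] k} (hε : Function.Injective ε) {u : ι → R} (hu : ∀ i, ε i (u i) = 0)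
    (hu' : ∀ i, ε i (D (u i)) ≠ 0) {M : ℕ} (hM : ∀ l < M, (l.factorial : k) ≠ 0) {g : R}
    (hg : ∀ i, VanishesToOrder D (ε i) M g) [Module.Finite k (R ⧸ Ideal.span {g})] :
    Fintype.card ι * M ≤ Module.finrank k (R ⧸ Ideal.span {g}) := by
  classical
  have hsep (i j : ι) : ∃ v, i ≠ j → ε i v ≠ 0 ∧ ε j v = 0 := by
    by_cases h : i = j
    · exact ⟨0, fun h' ↦ absurd h h'⟩
    obtain ⟨v, hv⟩ := DFunLike.ne_iff.1 (hε.ne h)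
    refine ⟨v - algebraMap k R (ε j v), fun _ ↦ ⟨?_, ?_⟩⟩
    · simpa [sub_eq_zero] using hv
    · simp
  choose v hv using hsep
  let w (i : ι) : R := ∏ j ∈ Finset.univ.erase i, v i j ^ M
  let z (s : ι × Fin M) : R := u s.1 ^ (s.2 : ℕ) * w s.1
  have hw (i : ι) : ε i (w i) ≠ 0 := by
    rw [map_prod, Finset.prod_ne_zero_iff]
    intro j hj
    rw [map_pow]
    exact pow_ne_zero _ (hv i j (Finset.ne_of_mem_erase hj).symm).1
  have hwz (i j : ι) (hij : j ≠ i) (l : ℕ) : VanishesToOrder D (ε j) M (u i ^ l * w i) := by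
    rw [show w i = v i j ^ M * _ from
      (Finset.mul_prod_erase _ _ (Finset.mem_erase.2 ⟨hij, Finset.mem_univ j⟩)).symm,
      mul_left_comm]
    exact VanishesToOrder.mul (n := 0) (VanishesToOrder.pow (hv i j hij.symm).2 M)
      (fun l hl ↦ by omega)
  have hli : LinearIndependent k (fun s ↦ Ideal.Quotient.mk (Ideal.span {g}) (z s)) := by
    rw [Fintype.linearIndependent_iff]
    intro c hc
    have hmem : ∑ s, c s • z s ∈ Ideal.span {g} := by
      rw [← Ideal.Quotient.eq_zero_iff_mem, ← hc, map_sum]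
      rfl
    have hvan (i : ι) : VanishesToOrder D (ε i) M (∑ s, c s • z s) := by
      obtain ⟨h, hh⟩ := Ideal.mem_span_singleton'.1 hmem
      rw [← hh, mul_comm]
      exact VanishesToOrder.mul (n := 0) (hg i) (fun l hl ↦ by omega)
    have key (i : ι) (l : ℕ) (hl : l < M) : c (i, ⟨l, hl⟩) = 0 := by
      induction l using Nat.strong_induction_on with
      | _ l ih =>
        have h := hvan i l hl
        rw [iterate_derivation_sum, map_sum, Finset.sum_eq_single (i, ⟨l, hl⟩)] at h
        · rw [iterate_derivation_smul, map_smul, eval_iterate_derivation_pow_mul (hu i)] at h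
          simpa [hM l hl, hu' i, hw i] using h
        · rintro ⟨j, m, hm⟩ - hne
          rw [iterate_derivation_smul, map_smul]
          by_cases hij : j = i
          · subst hij
            rcases lt_trichotomy m l with hml | rfl | hml
            · rw [ih m hml hm, zero_smul]
            · exact absurd rfl hne
            · rw [VanishesToOrder.mul (n := 0) (VanishesToOrder.pow (hu j) m)
                (fun l hl ↦ by omega) l hml, smul_zero]
          · rw [hwz j i (Ne.symm hij) m l hl, smul_zero]
        · simp
    rintro ⟨i, l, hl⟩
    exact key i l hl
  simpa using hli.fintype_card_le_finrank

end Vanishing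

section CurvePoints

variable {k : Type} [Field k] {f : k[X][X]}

/-- The evaluation homomorphism of the coordinate ring at a point of a plane curve. -/
noncomputable def evalPoint (f : k[X][X]) (P : {P : k × k // f.evalEval P.1 P.2 = 0}) :
    AdjoinRoot f →ₐ[k] k :=
  { AdjoinRoot.evalEval P.2 with
    commutes' := fun c ↦ by
      change AdjoinRoot.evalEval P.2 (AdjoinRoot.mk f (C (C c))) = c
      rw [AdjoinRoot.evalEval_mk]
      simp }

theorem evalPoint_mk (P : {P : k × k // f.evalEval P.1 P.2 = 0}) (g : k[X][X]) :
    evalPoint f P (AdjoinRoot.mk f g) = g.evalEval P.1.1 P.1.2 :=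
  AdjoinRoot.evalEval_mk P.2 g

@[simp]
theorem evalPoint_X (P : {P : k × k // f.evalEval P.1 P.2 = 0}) :
    evalPoint f P (AdjoinRoot.of f X) = P.1.1 := by
  rw [← AdjoinRoot.mk_C, evalPoint_mk, evalEval_C, eval_X]

@[simp]
theorem evalPoint_root (P : {P : k × k // f.evalEval P.1 P.2 = 0}) :
    evalPoint f P (AdjoinRoot.root f) = P.1.2 := by
  rw [← AdjoinRoot.mk_X, evalPoint_mk, evalEval_X]

theorem evalPoint_injective : Function.Injective (evalPoint f) := by
  intro P Q h
  refine Subtype.ext (Prod.ext ?_ ?_)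
  · simpa using DFunLike.congr_fun h (AdjoinRoot.of f X)
  · simpa using DFunLike.congr_fun h (AdjoinRoot.root f)

/-- The number of zeros of high order of a function on a plane curve is bounded by the degree of
its norm. -/
theorem card_mul_le_natDegree_norm (hf : f.Monic) (hirr : Irreducible f)
    (S : Finset {P : k × k // f.evalEval P.1 P.2 = 0})
    (hS : ∀ P ∈ S, (derivative f).evalEval P.1.1 P.1.2 ≠ 0) {M : ℕ}
    (hM : ∀ l < M, (l.factorial : k) ≠ 0) {g : AdjoinRoot f} (hg0 : g ≠ 0)
    (hg : ∀ P ∈ S, VanishesToOrder (curveDerivation f) (evalPoint f P) M g) :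
    S.card * M ≤ (Algebra.norm k[X] g).natDegree := by
  have := isDomain_adjoinRoot hirr
  have : Module.Free k[X] (AdjoinRoot f) := .of_basis (AdjoinRoot.powerBasisAux' hf)
  have : Module.Finite k[X] (AdjoinRoot f) := .of_basis (AdjoinRoot.powerBasisAux' hf)
  have hrank := finrank_quotient_span_eq_natDegree_norm (F := k) (AdjoinRoot.powerBasisAux' hf) hg0
  rcases Nat.eq_zero_or_pos (Algebra.norm k[X] g).natDegree with h0 | h0
  · rcases Nat.eq_zero_or_pos M with rfl | hM0
    · simp
    rcases S.eq_empty_or_nonempty with rfl | ⟨P, hP⟩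
    · simp
    exfalso
    obtain ⟨c, hc⟩ := natDegree_eq_zero.1 h0
    have hc0 : c ≠ 0 := by
      rintro rfl
      rw [map_zero] at hc
      exact Algebra.norm_ne_zero_iff.2 hg0 hc.symm
    obtain ⟨w, hw⟩ := dvd_algebraMap_norm (R := k[X]) g
    have h1 := congrArg (evalPoint f P) hw
    rw [map_mul, show evalPoint f P g = 0 from hg P hP 0 hM0, zero_mul, ← hc, ← algebraMap_eq,
      ← IsScalarTower.algebraMap_apply, AlgHom.commutes] at h1
    exact hc0 h1
  · have : Module.Finite k (AdjoinRoot f ⧸ Ideal.span {g}) :=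
      Module.finite_of_finrank_pos (by rwa [hrank])
    rw [← hrank]
    have := card_mul_le_finrank_quotient (curveDerivation f) (ι := S)
      (ε := fun P ↦ evalPoint f P) (fun P Q h ↦ Subtype.ext (evalPoint_injective h))
      (u := fun P ↦ AdjoinRoot.of f X - algebraMap k _ P.1.1.1) (fun P ↦ by simp)
      (fun P ↦ by
        rw [map_sub, Derivation.map_algebraMap, sub_zero, curveDerivation_of_X, evalPoint_mk]
        exact hS P.1 P.2) hM (fun P ↦ hg P.1 P.2)
    simpa using this

end CurvePoints

section Auxiliary

variable {k : Type} [Field k] {f : k[X][X]}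

/-- The linear combinations of the monomials `x ^ i * y ^ j` with `i < n` and `j < deg f`. -/
noncomputable def monomialSum (f : k[X][X]) (n : ℕ) :
    (Fin n × Fin f.natDegree → k) →ₗ[k] AdjoinRoot f :=
  Fintype.linearCombination k
    fun s ↦ AdjoinRoot.of f X ^ (s.1 : ℕ) * AdjoinRoot.root f ^ (s.2 : ℕ)

theorem monomialSum_apply {n : ℕ} (a : Fin n × Fin f.natDegree → k) : monomialSum f n a =
    ∑ s, a s • (AdjoinRoot.of f X ^ (s.1 : ℕ) * AdjoinRoot.root f ^ (s.2 : ℕ)) :=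
  Fintype.linearCombination_apply _ _ _

theorem monomialSum_mem_boxSpan {n : ℕ} (a : Fin n × Fin f.natDegree → k) :
    monomialSum f n a ∈ boxSpan f n := by
  rw [monomialSum_apply]
  exact Submodule.sum_mem _ fun s _ ↦ Submodule.smul_mem _ _ (monomial_mem_boxSpan s.1.2 s.2.2)

theorem eq_zero_of_monomialSum_eq_zero (hf : f.Monic) (hd : 0 < f.natDegree) {n : ℕ}
    {a : Fin n × Fin f.natDegree → k} (h : monomialSum f n a = 0) : a = 0 := by
  let H : k[X][X] := ∑ s : Fin n × Fin f.natDegree, C (C (a s) * X ^ (s.1 : ℕ)) * X ^ (s.2 : ℕ)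
  have hmk : AdjoinRoot.mk f H = monomialSum f n a := by
    rw [monomialSum_apply]
    simp only [H, map_sum, map_mul, map_pow, AdjoinRoot.mk_X, AdjoinRoot.mk_C]
    refine Finset.sum_congr rfl fun s _ ↦ ?_
    rw [Algebra.smul_def, mul_assoc]
    rfl
  have hH : H = 0 := by
    by_contra hne
    refine AdjoinRoot.mk_ne_zero_of_natDegree_lt hf hne ?_ (hmk.trans h)
    rw [Nat.lt_iff_le_pred hd]
    refine natDegree_sum_le_of_forall_le _ _ fun s _ ↦ ?_
    exact (natDegree_C_mul_X_pow_le _ _).trans (Nat.le_pred_of_lt s.2.2)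
  ext s
  have := congrArg (fun g : k[X][X] ↦ (g.coeff (s.2 : ℕ)).coeff (s.1 : ℕ)) hH
  simp only [H, finsetSum_coeff, coeff_C_mul_X_pow, coeff_zero, Fin.val_inj] at this
  rw [Finset.sum_eq_single s] at this
  · simpa using this
  · intro s' _ hs
    split_ifs with h2
    · rw [coeff_C_mul_X_pow, if_neg fun h ↦ hs (Prod.ext (Fin.ext h).symm h2.symm)]
    · rw [coeff_zero]
  · simp

variable {p : ℕ} [hp : Fact p.Prime] [CharP k p]

omit hp in
theorem iterate_derivation_mul_pow {R : Type*} [CommRing R] [Algebra k R] (D : Derivation k R R)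
    (l : ℕ) (w r : R) : D^[l] (w * r ^ p) = D^[l] w * r ^ p := by
  have hchar : (p : R) = 0 := by
    rw [← map_natCast (algebraMap k R), CharP.cast_eq_zero, map_zero]
  induction l generalizing w with
  | zero => rfl
  | succ l ih =>
    rw [Function.iterate_succ_apply, Function.iterate_succ_apply, ← ih, Derivation.leibniz,
      Derivation.leibniz_pow, ← Nat.cast_smul_eq_nsmul R, hchar, zero_smul, smul_zero, zero_add,
      smul_eq_mul, mul_comm]

/-- The linear conditions of Stepanov's method have a nonzero solution. -/
theorem exists_stepanov_coefficients (hf : f.Monic) (hd : 0 < f.natDegree) {e : ℕ}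
    (he : ∀ j, (f.coeff j).natDegree ≤ e) {c n : ℕ} {g : Fin f.natDegree → Fin c → AdjoinRoot f}
    (hg : ∀ i j, g i j ∈ boxSpan f n) {A B M : ℕ}
    (hcount : M * c * (A + M * (1 + 2 * (e * f.natDegree) + e) + B + n + e * f.natDegree) <
      A * B * f.natDegree) :
    ∃ a : Fin B × Fin f.natDegree → Fin A × Fin f.natDegree → k, a ≠ 0 ∧ ∀ l < M, ∀ j,
      ∑ s, (curveDerivation f)^[l] (monomialSum f A (a s)) *
        (AdjoinRoot.of f X ^ (s.1 : ℕ) * g s.2 j) = 0 := by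
  set W := A + M * (1 + 2 * (e * f.natDegree) + e) + B + n + e * f.natDegree with hW
  let Φ (l : ℕ) (j : Fin c) :
      (Fin B × Fin f.natDegree → Fin A × Fin f.natDegree → k) →ₗ[k] AdjoinRoot f :=
    ∑ s, LinearMap.mulRight k (AdjoinRoot.of f X ^ (s.1 : ℕ) * g s.2 j) ∘ₗ
      ((curveDerivation f).toLinearMap ^ l) ∘ₗ monomialSum f A ∘ₗ LinearMap.proj s
  have hΦ (l : ℕ) (j : Fin c) (a) : Φ l j a =
      ∑ s, (curveDerivation f)^[l] (monomialSum f A (a s)) *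
        (AdjoinRoot.of f X ^ (s.1 : ℕ) * g s.2 j) := by
    simp [Φ, Module.End.pow_apply, mul_assoc]
  have hmem (s : Fin M × Fin c) (a) : Φ s.1 s.2 a ∈ boxSpan f W := by
    rw [hΦ]
    refine Submodule.sum_mem _ fun t _ ↦ ?_
    have h1 := iterate_curveDerivation_mem_boxSpan hf he hd s.1
      (monomialSum_mem_boxSpan (a t))
    have h2 := mul_mem_boxSpan hf he h1 (X_pow_mul_mem_boxSpan (t.1 : ℕ) (hg t.2 s.2))
    refine boxSpan_mono ?_ h2
    have := Nat.mul_le_mul_right (1 + 2 * (e * f.natDegree) + e) s.1.2.le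
    have := t.1.2
    omega
  let Ψ : (Fin B × Fin f.natDegree → Fin A × Fin f.natDegree → k) →ₗ[k]
      (Fin M × Fin c → boxSpan f W) :=
    LinearMap.pi fun s ↦ (Φ s.1 s.2).codRestrict (boxSpan f W) (hmem s)
  have hker : LinearMap.ker Ψ ≠ ⊥ := by
    apply LinearMap.ker_ne_bot_of_finrank_lt
    rw [Module.finrank_pi_fintype, Module.finrank_pi_fintype]
    simp only [Module.finrank_fintype_fun_eq_card, Fintype.card_prod, Fintype.card_fin,
      Finset.sum_const, Finset.card_univ, smul_eq_mul]
    calc _ ≤ M * c * (W * f.natDegree) := Nat.mul_le_mul_left _ (finrank_boxSpan_le f W)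
      _ = M * c * W * f.natDegree := by ring
      _ < A * B * f.natDegree * f.natDegree := Nat.mul_lt_mul_of_pos_right hcount hd
      _ = _ := by ring
  obtain ⟨a, ha, ha0⟩ := Submodule.exists_mem_ne_zero_of_ne_bot hker
  refine ⟨a, ha0, fun l hl j ↦ ?_⟩
  rw [← hΦ]
  have := congrArg Subtype.val (congrFun (LinearMap.mem_ker.1 ha) (⟨l, hl⟩, j))
  exact this

/-- The basic inequality of Stepanov's method. -/
theorem stepanov_inequality [IsAlgClosed k] (hf : f.Monic) (hirr : Irreducible f)
    (hfp : f.map (mapRingHom (frobenius k p)) = f) {e : ℕ} (he : ∀ j, (f.coeff j).natDegree ≤ e)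
    (hdp : f.natDegree < p) {c n : ℕ} {g : Fin f.natDegree → Fin c → AdjoinRoot f}
    (hg : ∀ i j, g i j ∈ boxSpan f n) {A B M : ℕ} (hA : f.natDegree * (A + e * f.natDegree) < p)
    (hMp : M ≤ p)
    (hcount : M * c * (A + M * (1 + 2 * (e * f.natDegree) + e) + B + n + e * f.natDegree) <
      A * B * f.natDegree)
    (S : Finset {P : k × k // f.evalEval P.1 P.2 = 0})
    (hS : ∀ P ∈ S, (derivative f).evalEval P.1.1 P.1.2 ≠ 0) (hSp : ∀ P ∈ S, P.1.1 ^ p = P.1.1)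
    (hSg : ∀ P ∈ S, ∃ τ : Fin c → k, ∀ i : Fin f.natDegree,
      (P.1.2 ^ (i : ℕ)) ^ p = ∑ j, evalPoint f P (g i j) * τ j) :
    S.card * M ≤ f.natDegree * (A + p * B + e * (p * f.natDegree) + e * f.natDegree) := by
  have hd : 0 < f.natDegree := by
    rw [Nat.pos_iff_ne_zero]
    intro h0
    rw [hf.natDegree_eq_zero.1 h0] at hirr
    exact not_irreducible_one hirr
  have := isDomain_adjoinRoot hirr
  obtain ⟨a, ha0, ha⟩ := exists_stepanov_coefficients hf hd he hg hcount
  let z : AdjoinRoot f := ∑ s, monomialSum f A (a s) *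
    (AdjoinRoot.of f X ^ (s.1 : ℕ) * AdjoinRoot.root f ^ (s.2 : ℕ)) ^ p
  have hz0 : z ≠ 0 := by
    intro hz
    obtain ⟨b, hb⟩ : ∃ b : Fin B × Fin f.natDegree → Fin A × Fin f.natDegree → k,
        ∀ s t, b s t ^ p = a s t :=
      ⟨fun s t ↦ (IsAlgClosed.exists_pow_nat_eq (a s t) hp.out.pos).choose,
        fun s t ↦ (IsAlgClosed.exists_pow_nat_eq (a s t) hp.out.pos).choose_spec⟩
    have : CharP (AdjoinRoot f) p :=
      charP_of_injective_algebraMap (algebraMap k (AdjoinRoot f)).injective p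
    have h := eq_zero_of_sum_mul_pow_eq_zero hf hirr hfp he hA hdp
      (fun i j ↦ monomialSum f B (fun s ↦ b s (i, j))) (by
        rw [← hz]
        simp only [z, monomialSum_apply, sum_pow_char, Finset.sum_mul, Finset.mul_sum]
        rw [← Fintype.sum_prod_type', Finset.sum_comm]
        refine Finset.sum_congr rfl fun s _ ↦ Finset.sum_congr rfl fun t _ ↦ ?_
        rw [← hb, _root_.smul_pow, mul_smul_comm, smul_mul_assoc])
    refine ha0 (funext fun s ↦ funext fun t ↦ ?_)
    have h1 := eq_zero_of_monomialSum_eq_zero hf hd (congrFun (congrFun h t.1) t.2)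
    rw [← hb, show b s t = 0 from congrFun h1 s, zero_pow hp.out.ne_zero]
    rfl
  have hzbox : z ∈ boxSpan f (A + p * B + e * (p * f.natDegree)) := by
    refine Submodule.sum_mem _ fun s _ ↦ ?_
    rw [mul_pow, ← pow_mul, ← pow_mul, mul_comm (monomialSum f A (a s)), mul_assoc]
    have h := X_pow_mul_mem_boxSpan ((s.1 : ℕ) * p) (root_pow_mul_mem_boxSpan hf he
      ((s.2 : ℕ) * p) (monomialSum_mem_boxSpan (a s)))
    refine boxSpan_mono ?_ h
    have h1 : (s.1 : ℕ) * p ≤ p * B := by rw [mul_comm p]; exact Nat.mul_le_mul_right p s.1.2.le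
    have h2 : e * ((s.2 : ℕ) * p) ≤ e * (p * f.natDegree) := by
      rw [mul_comm p]
      exact Nat.mul_le_mul_left e (Nat.mul_le_mul_right p s.2.2.le)
    omega
  have hfact : ∀ l < M, (l.factorial : k) ≠ 0 := by
    intro l hl h
    rw [CharP.cast_eq_zero_iff k p, hp.out.dvd_factorial] at h
    omega
  refine (card_mul_le_natDegree_norm hf hirr S hS hfact hz0 fun P hP l hl ↦ ?_).trans
    (natDegree_norm_le_of_mem_boxSpan hf he hzbox)
  obtain ⟨τ, hτ⟩ := hSg P hP
  have h1 (s : Fin B × Fin f.natDegree) :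
      evalPoint f P ((curveDerivation f)^[l] (monomialSum f A (a s) *
        (AdjoinRoot.of f X ^ (s.1 : ℕ) * AdjoinRoot.root f ^ (s.2 : ℕ)) ^ p)) =
      ∑ j, evalPoint f P ((curveDerivation f)^[l] (monomialSum f A (a s)) *
        (AdjoinRoot.of f X ^ (s.1 : ℕ) * g s.2 j)) * τ j := by
    rw [iterate_derivation_mul_pow, map_mul, map_pow, map_mul, map_pow, map_pow, evalPoint_X,
      evalPoint_root, mul_pow, ← pow_mul, mul_comm (s.1 : ℕ), pow_mul, hSp P hP, hτ s.2,
      Finset.mul_sum, Finset.mul_sum]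
    refine Finset.sum_congr rfl fun j _ ↦ ?_
    rw [map_mul, map_mul, map_pow, evalPoint_X]
    ring
  rw [iterate_derivation_sum, map_sum, Finset.sum_congr rfl fun s _ ↦ h1 s, Finset.sum_comm]
  refine Finset.sum_eq_zero fun j _ ↦ ?_
  rw [← Finset.sum_mul, ← map_sum, ha l hl j, map_zero, zero_mul]

end Auxiliary

theorem exists_stepanov_parameters (d e c n : ℕ) (hd : 0 < d) (hc : 0 < c) :
    ∃ C : ℕ, ∀ p : ℕ, C < p → ∃ A B M, d * (A + e * d) < p ∧ M ≤ p ∧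
      M * c * (A + M * (1 + 2 * (e * d) + e) + B + n + e * d) < A * B * d ∧
      ∀ N, N * M ≤ d * (A + p * B + e * (p * d) + e * d) → N ≤ c * p + C * Nat.sqrt p := by
  obtain ⟨κ₀, hκ₀⟩ : ∃ κ₀, κ₀ = d * (1 + 2 * (e * d) + e) + c + n + e * d := ⟨_, rfl⟩
  obtain ⟨κ, hκ⟩ : ∃ κ, κ = 4 * (d * d) * κ₀ + 1 := ⟨_, rfl⟩
  obtain ⟨κ₂, hκ₂⟩ : ∃ κ₂, κ₂ = c * κ + d + 2 * (e * (d * d)) := ⟨_, rfl⟩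
  refine ⟨8 * κ₂ + 1 + (2 * κ + 3) * (2 * κ + 3) + 4 * d + 2 * (e * (d * d)), fun p hp ↦ ?_⟩
  obtain ⟨C, hC⟩ : ∃ C, C = 8 * κ₂ + 1 + (2 * κ + 3) * (2 * κ + 3) + 4 * d + 2 * (e * (d * d)) :=
    ⟨_, rfl⟩
  rw [← hC] at hp ⊢
  obtain ⟨s, hs⟩ : ∃ s, s = Nat.sqrt p := ⟨_, rfl⟩
  have hs1 : s * s ≤ p := hs ▸ Nat.sqrt_le p
  have hs2 : p < (s + 1) * (s + 1) := hs ▸ Nat.lt_succ_sqrt p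
  rw [← hs]
  have hsκ : 2 * κ + 2 ≤ s := by
    by_contra! h
    have : (s + 1) * (s + 1) ≤ (2 * κ + 3) * (2 * κ + 3) := Nat.mul_le_mul (by omega) (by omega)
    omega
  have hκ₀1 : 1 ≤ κ₀ := by omega
  have hκd : d ≤ κ := by
    have h1 : d * d ≤ d * d * κ₀ := Nat.le_mul_of_pos_right _ hκ₀1
    have h2 := Nat.le_mul_self d
    rw [hκ, mul_assoc 4]
    omega
  obtain ⟨A, hA⟩ : ∃ A, A = p / (2 * d) := ⟨_, rfl⟩
  have hA1 : 2 * d * A ≤ p := hA ▸ Nat.mul_div_le p (2 * d)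
  have hA2 : p < 2 * d * (A + 1) := by
    rw [hA]; exact Nat.lt_mul_div_succ p (by omega)
  obtain ⟨M, hM⟩ : ∃ M, M + κ = d * s := ⟨d * s - κ, by
    have := Nat.mul_le_mul hd (show κ ≤ s by omega); omega⟩
  have hds : d * s ≤ p := (Nat.mul_le_mul_right s (show d ≤ s by omega)).trans hs1
  have hAp : A ≤ p := by rw [hA]; exact Nat.div_le_self _ _
  refine ⟨A, c * s, M, ?_, by omega, ?_, ?_⟩
  · have : 2 * (d * (A + e * d)) = 2 * d * A + 2 * (e * (d * d)) := by ring
    omega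
  · have h1 : A + M * (1 + 2 * (e * d) + e) + c * s + n + e * d ≤ A + s * κ₀ := by
      have h2 : M * (1 + 2 * (e * d) + e) ≤ d * s * (1 + 2 * (e * d) + e) :=
        Nat.mul_le_mul_right _ (by omega)
      have h3 : n + e * d ≤ s * (n + e * d) := Nat.le_mul_of_pos_left _ (by omega)
      have h4 : s * κ₀ = d * s * (1 + 2 * (e * d) + e) + c * s + s * (n + e * d) := by
        rw [hκ₀]; ring
      omega
    have h2 : d * κ₀ * (s * s) ≤ 4 * (d * d) * κ₀ * A := by
      have h3 : p ≤ 4 * d * A := by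
        have h5 : 2 * d * (A + 1) = 2 * d * A + 2 * d := by ring
        have h6 : 4 * d * A = 2 * (2 * d * A) := by ring
        omega
      calc d * κ₀ * (s * s) ≤ d * κ₀ * (4 * d * A) := Nat.mul_le_mul_left _ (hs1.trans h3)
        _ = _ := by ring
    have h4 : M * (A + s * κ₀) < A * s * d := by
      have h5 : (M + κ) * (A + s * κ₀) = d * s * (A + s * κ₀) := by rw [hM]
      have h6 : 0 < κ * (s * κ₀) := by
        apply Nat.mul_pos (by omega) (Nat.mul_pos (by omega) hκ₀1)
      have h7 : d * κ₀ * (s * s) ≤ κ * A := h2.trans (Nat.mul_le_mul_right _ (by omega))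
      have h8 : (M + κ) * (A + s * κ₀) = M * (A + s * κ₀) + (κ * A + κ * (s * κ₀)) := by ring
      have h9 : d * s * (A + s * κ₀) = A * s * d + d * κ₀ * (s * s) := by ring
      omega
    calc M * c * (A + M * (1 + 2 * (e * d) + e) + c * s + n + e * d)
        ≤ M * c * (A + s * κ₀) := Nat.mul_le_mul_left _ h1
      _ = c * (M * (A + s * κ₀)) := by ring
      _ < c * (A * s * d) := Nat.mul_lt_mul_of_pos_left h4 hc
      _ = _ := by ring
  · intro N hN
    by_contra! hlt
    have h1 : (c * p + C * s) * M ≤ N * M := Nat.mul_le_mul_right _ hlt.le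
    have h2 : d * (A + p * (c * s) + e * (p * d) + e * d) ≤
        c * p * (d * s) + (d + 2 * (e * (d * d))) * p := by
      have : d * A ≤ d * p := Nat.mul_le_mul_left _ hAp
      have h3 : e * (d * d) ≤ e * (d * d) * p := Nat.le_mul_of_pos_right _ (by omega)
      have h4 : d * (A + p * (c * s) + e * (p * d) + e * d) =
        d * A + c * p * (d * s) + e * (d * d) * p + e * (d * d) := by ring
      have h5 : (d + 2 * (e * (d * d))) * p = d * p + 2 * (e * (d * d) * p) := by ring
      omega
    have h3 : C * s * M ≤ κ₂ * p := by
      have : (c * p + C * s) * M + c * p * κ = c * p * (d * s) + C * s * M := by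
        rw [← hM]; ring
      have h4 : κ₂ * p = c * p * κ + (d + 2 * (e * (d * d))) * p := by rw [hκ₂]; ring
      omega
    have h4 : s ≤ 2 * M := by
      have := Nat.le_mul_of_pos_left s hd
      omega
    have h5 : C * s * s ≤ 2 * (κ₂ * p) := by
      calc C * s * s ≤ C * s * (2 * M) := Nat.mul_le_mul_left _ h4
        _ = 2 * (C * s * M) := by ring
        _ ≤ _ := by omega
    have h6 : p ≤ 4 * (s * s) := by
      have h7 : (s + 1) * (s + 1) ≤ (2 * s) * (2 * s) := Nat.mul_le_mul (by omega) (by omega)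
      have h8 : (2 * s) * (2 * s) = 4 * (s * s) := by ring
      omega
    have h7 : κ₂ * p ≤ κ₂ * (4 * (s * s)) := Nat.mul_le_mul_left _ h6
    have h8 : (8 * κ₂ + 1) * (s * s) ≤ C * (s * s) := Nat.mul_le_mul_right _ (by omega)
    have h9 : 0 < s * s := Nat.mul_pos (by omega) (by omega)
    rw [mul_assoc] at h5
    rw [mul_left_comm] at h7
    rw [add_mul, one_mul, mul_assoc] at h8
    omega

/-- **Stepanov's bound** for the points of a plane curve over `k` with `x ^ p = x` whose `p`-power
Frobenius satisfies prescribed relations. -/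
theorem stepanov_bound (d e c n : ℕ) : ∃ C : ℕ, ∀ (p : ℕ) [Fact p.Prime] (k : Type) [Field k]
    [CharP k p] [IsAlgClosed k] (f : k[X][X]), C < p → f.Monic → Irreducible f →
    f.map (mapRingHom (frobenius k p)) = f → (∀ j, (f.coeff j).natDegree ≤ e) →
    f.natDegree = d → ∀ (g : Fin f.natDegree → Fin c → AdjoinRoot f),
    (∀ i j, g i j ∈ boxSpan f n) → ∀ (S : Finset {P : k × k // f.evalEval P.1 P.2 = 0}),
    (∀ P ∈ S, (derivative f).evalEval P.1.1 P.1.2 ≠ 0) → (∀ P ∈ S, P.1.1 ^ p = P.1.1) →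
    (∀ P ∈ S, ∃ τ : Fin c → k, ∀ i : Fin f.natDegree,
      (P.1.2 ^ (i : ℕ)) ^ p = ∑ j, evalPoint f P (g i j) * τ j) →
    S.card ≤ c * p + C * Nat.sqrt p := by
  rcases Nat.eq_zero_or_pos d with rfl | hd
  · refine ⟨0, fun p _ k _ _ _ f _ hf hirr _ _ h0 ↦ ?_⟩
    rw [hf.natDegree_eq_zero.1 h0] at hirr
    exact absurd hirr not_irreducible_one
  rcases Nat.eq_zero_or_pos c with rfl | hc
  · refine ⟨0, fun p _ k _ _ _ f _ _ _ _ _ hfd g _ S _ _ hSg ↦ ?_⟩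
    refine (Finset.card_eq_zero.2 (Finset.eq_empty_of_forall_notMem fun P hP ↦ ?_)).le.trans
      (Nat.zero_le _)
    obtain ⟨τ, hτ⟩ := hSg P hP
    simpa using hτ ⟨0, by omega⟩
  obtain ⟨C, hC⟩ := exists_stepanov_parameters d e c n hd hc
  refine ⟨C + d, fun p _ k _ _ _ f hp hf hirr hfp he hfd g hg S hS hSp hSg ↦ ?_⟩
  obtain ⟨A, B, M, hA, hMp, hcount, hN⟩ := hC p (by omega)
  subst hfd
  refine (hN _ (stepanov_inequality hf hirr hfp he (by omega) hg hA hMp hcount S hS hSp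
    hSg)).trans ?_
  gcongr
  omega

section CurveOverAlgClosure

theorem pow_eq_self_iff_mem_range {p : ℕ} [Fact p.Prime] {k : Type*} [Field k] [Algebra (ZMod p) k]
    {x : k} : x ^ p = x ↔ ∃ a, algebraMap (ZMod p) k a = x := by
  have := charP_of_injective_algebraMap (algebraMap (ZMod p) k).injective p
  rw [← Subfield.mem_bot_iff_pow_eq_self, ← ZMod.fieldRange_castHom_eq_bot p,
    Subsingleton.elim (ZMod.castHom dvd_rfl k) (algebraMap (ZMod p) k), RingHom.mem_fieldRange]

variable {k : Type} [Field k]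

theorem one_mem_boxSpan {f : k[X][X]} (hd : 0 < f.natDegree) : 1 ∈ boxSpan f 1 := by
  simpa using monomial_mem_boxSpan (f := f) one_pos hd

/-- The number of `𝔽_p`-points of the curve `f = 0` at which `f_Y` does not vanish is at most
`p + O(√p)`. -/
theorem card_rational_le (d e : ℕ) : ∃ C : ℕ, ∀ (p : ℕ) [Fact p.Prime] (k : Type) [Field k]
    [CharP k p] [IsAlgClosed k] (f : k[X][X]), C < p → f.Monic → Irreducible f →
    f.map (mapRingHom (frobenius k p)) = f → (∀ j, (f.coeff j).natDegree ≤ e) →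
    f.natDegree = d → ∀ T : Finset (k × k), (∀ P ∈ T, f.evalEval P.1 P.2 = 0 ∧
      (derivative f).evalEval P.1 P.2 ≠ 0 ∧ P.1 ^ p = P.1 ∧ P.2 ^ p = P.2) →
    T.card ≤ p + C * Nat.sqrt p := by
  classical
  obtain ⟨C, hC⟩ := stepanov_bound d e 1 (1 + e * d)
  refine ⟨C, fun p _ k _ _ _ f hp hf hirr hfp he hd T hT ↦ ?_⟩
  have h := hC p k f hp hf hirr hfp he hd (fun i _ ↦ AdjoinRoot.root f ^ (i : ℕ))
    (fun i _ ↦ ?_) (T.subtype _) (fun P hP ↦ (hT _ (Finset.mem_subtype.1 hP)).2.1)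
    (fun P hP ↦ (hT _ (Finset.mem_subtype.1 hP)).2.2.1) (fun P hP ↦ ⟨1, fun i ↦ ?_⟩)
  · rwa [Finset.card_subtype, Finset.filter_true_of_mem fun P hP ↦ (hT P hP).1, one_mul] at h
  · have := root_pow_mul_mem_boxSpan hf he i (one_mem_boxSpan (Fin.pos i))
    rw [mul_one] at this
    refine boxSpan_mono ?_ this
    gcongr
    exact i.2.le.trans_eq hd
  · rw [← pow_mul, mul_comm (i : ℕ), pow_mul, (hT _ (Finset.mem_subtype.1 hP)).2.2.2]
    simp

theorem evalEval_frobenius {p : ℕ} [Fact p.Prime] [CharP k p] {f : k[X][X]}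
    (hfp : f.map (mapRingHom (frobenius k p)) = f) {x y : k} (hx : x ^ p = x)
    (hf : f.evalEval x y = 0) : f.evalEval x (y ^ p) = 0 := by
  have h := map_mapRingHom_evalEval (frobenius k p) f x y
  rw [hfp, hf, map_zero, frobenius_def, frobenius_def, hx] at h
  exact h

/-- The quotient of `f(Z)` by `Z - y`, where `y` is the root of `f` in `AdjoinRoot f`. -/
noncomputable def rootQuotient (f : k[X][X]) : (AdjoinRoot f)[X] :=
  f.map (AdjoinRoot.of f) /ₘ (X - C (AdjoinRoot.root f))

theorem rootQuotient_coeff_mem_boxSpan {f : k[X][X]} (hf : f.Monic) {e : ℕ}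
    (he : ∀ j, (f.coeff j).natDegree ≤ e) (hd : 0 < f.natDegree) (j : ℕ) :
    (rootQuotient f).coeff j ∈ boxSpan f (1 + e * f.natDegree + e) := by
  have := AdjoinRoot.nontrivial f (natDegree_pos_iff_degree_pos.1 hd).ne'
  rw [rootQuotient, coeff_divByMonic_X_sub_C]
  refine Submodule.sum_mem _ fun i hi ↦ ?_
  have hi2 : i ≤ f.natDegree := (Finset.mem_Icc.1 hi).2.trans natDegree_map_le
  rw [coeff_map, mul_comm (AdjoinRoot.root f ^ _)]
  refine of_mul_mem_boxSpan (he i) ?_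
  have := root_pow_mul_mem_boxSpan hf he (i - (j + 1)) (one_mem_boxSpan hd)
  rw [mul_one] at this
  refine boxSpan_mono (Nat.add_le_add_left (Nat.mul_le_mul_left e ?_) 1) this
  omega

theorem eval_rootQuotient {f : k[X][X]}
    (P : {P : k × k // f.evalEval P.1 P.2 = 0}) {z : k} (hz : f.evalEval P.1.1 z = 0)
    (hzP : z ≠ P.1.2) : ((rootQuotient f).map (evalPoint f P : AdjoinRoot f →+* k)).eval z = 0 := by
  have h : (X - C (AdjoinRoot.root f)) * rootQuotient f = f.map (AdjoinRoot.of f) :=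
    mul_divByMonic_eq_iff_isRoot.2 (AdjoinRoot.isRoot_root f)
  have h1 := congrArg (fun g ↦ (g.map (evalPoint f P : AdjoinRoot f →+* k)).eval z) h
  have h2 : (evalPoint f P : AdjoinRoot f →+* k).comp (AdjoinRoot.of f) = evalRingHom P.1.1 := by
    ext
    · simp [← AdjoinRoot.mk_C, evalPoint_mk, evalEval_C]
    · simp
  simp only [Polynomial.map_mul, Polynomial.map_sub, map_X, map_C, eval_mul, eval_sub, eval_X,
    eval_C, Polynomial.map_map, h2, RingHom.coe_coe, evalPoint_root] at h1
  rw [map_evalRingHom_eval, hz, mul_eq_zero, sub_eq_zero] at h1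
  exact h1.resolve_left hzP

theorem natDegree_rootQuotient {f : k[X][X]} (hf : f.Monic) (hd : 0 < f.natDegree) :
   (rootQuotient f).Monic ∧ (rootQuotient f).natDegree + 1 = f.natDegree  := by
  have := AdjoinRoot.nontrivial f (natDegree_pos_iff_degree_pos.1 hd).ne'
  have h : (X - C (AdjoinRoot.root f)) * rootQuotient f = f.map (AdjoinRoot.of f) :=
    mul_divByMonic_eq_iff_isRoot.2 (AdjoinRoot.isRoot_root f)
  have h1 : (rootQuotient f).Monic :=
    (monic_X_sub_C _).of_mul_monic_left (h ▸ hf.map _)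
  refine ⟨h1, ?_⟩
  rw [← hf.natDegree_map (AdjoinRoot.of f), ← h, (monic_X_sub_C _).natDegree_mul h1,
    natDegree_X_sub_C, add_comm]

/-- The number of points `(x, y)` with `x ∈ 𝔽_p` and `y ∉ 𝔽_p` of the curve `f = 0` at which `f_Y`
does not vanish is at most `(deg f - 1) p + O(√p)`. -/
theorem card_nonrational_le (d e : ℕ) : ∃ C : ℕ, ∀ (p : ℕ) [Fact p.Prime] (k : Type) [Field k]
    [CharP k p] [IsAlgClosed k] (f : k[X][X]), C < p → f.Monic → Irreducible f →
    f.map (mapRingHom (frobenius k p)) = f → (∀ j, (f.coeff j).natDegree ≤ e) →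
    f.natDegree = d → ∀ T : Finset (k × k), (∀ P ∈ T, f.evalEval P.1 P.2 = 0 ∧
      (derivative f).evalEval P.1 P.2 ≠ 0 ∧ P.1 ^ p = P.1 ∧ P.2 ^ p ≠ P.2) →
    T.card ≤ (d - 1) * p + C * Nat.sqrt p := by
  classical
  obtain ⟨C, hC⟩ := stepanov_bound d e (d - 1) (1 + e * d + e)
  refine ⟨C, fun p _ k _ _ _ f hp hf hirr hfp he hd T hT ↦ ?_⟩
  have hd0 (i : Fin f.natDegree) : 0 < f.natDegree := Fin.pos i
  have h := hC p k f hp hf hirr hfp he hd (fun i j ↦ if (i : ℕ) < d - 1 then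
      if (i : ℕ) = j then 1 else 0 else - (rootQuotient f).coeff j)
    (fun i j ↦ ?_) (T.subtype _) (fun P hP ↦ (hT _ (Finset.mem_subtype.1 hP)).2.1)
    (fun P hP ↦ (hT _ (Finset.mem_subtype.1 hP)).2.2.1)
    (fun P hP ↦ ⟨fun j ↦ (P.1.2 ^ p) ^ (j : ℕ), fun i ↦ ?_⟩)
  · rwa [Finset.card_subtype, Finset.filter_true_of_mem fun P hP ↦ (hT P hP).1] at h
  · split_ifs
    · exact boxSpan_mono (by omega) (one_mem_boxSpan (hd0 i))
    · exact Submodule.zero_mem _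
    · subst hd
      exact Submodule.neg_mem _ (rootQuotient_coeff_mem_boxSpan hf he (hd0 i) j)
  · have hPT := hT _ (Finset.mem_subtype.1 hP)
    rw [← pow_mul, mul_comm (i : ℕ), pow_mul]
    split_ifs with hi
    · rw [Finset.sum_eq_single ⟨i, hi⟩] <;> simp +contextual [Fin.ext_iff, eq_comm]
    · obtain ⟨h1, h2⟩ := natDegree_rootQuotient hf (hd0 i)
      have h3 := eval_rootQuotient P (evalEval_frobenius hfp hPT.2.2.1 hPT.1) hPT.2.2.2
      have h4 : (rootQuotient f).natDegree = d - 1 := by omega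
      rw [eval_map, eval₂_eq_sum_range, Finset.sum_range_succ, h1.coeff_natDegree, map_one, one_mul,
        h4, add_comm] at h3
      rw [show (i : ℕ) = d - 1 by have := i.2; omega, eq_neg_of_add_eq_zero_left h3,
        Finset.sum_range, ← Finset.sum_neg_distrib]
      simp

end CurveOverAlgClosure

section PlaneCurve

variable {p : ℕ} [Fact p.Prime]

/-- The points over `k` of the curve `f = 0` whose first coordinate lies in `𝔽_p`. -/
noncomputable def fiberPoints (k : Type) [Field k] [Algebra (ZMod p) k] (f : (ZMod p)[X][X])
    (s : Finset (ZMod p)) : Finset (k × k) := by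
  classical
  exact (s.sigma fun a ↦ ((f.map (evalRingHom a)).map (algebraMap (ZMod p) k)).roots.toFinset).map
    ⟨fun x ↦ (algebraMap (ZMod p) k x.1, x.2), fun x y h ↦ by
      obtain ⟨a, b⟩ := x
      obtain ⟨a', b'⟩ := y
      obtain ⟨h1, rfl⟩ := Prod.ext_iff.1 h
      obtain rfl := (algebraMap (ZMod p) k).injective h1
      rfl⟩

variable {k : Type} [Field k] [Algebra (ZMod p) k] {f : (ZMod p)[X][X]}

theorem evalEval_map_algebraMap (a : ZMod p) (y : k) :
    (f.map (mapRingHom (algebraMap (ZMod p) k))).evalEval (algebraMap (ZMod p) k a) y =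
    ((f.map (evalRingHom a)).map (algebraMap (ZMod p) k)).eval y := by
  rw [← map_evalRingHom_eval, Polynomial.map_map, Polynomial.map_map]
  congr 2
  ext <;> simp

theorem mem_fiberPoints (hf : f.Monic) {s : Finset (ZMod p)} {P : k × k} :
    P ∈ fiberPoints k f s ↔ (∃ a ∈ s, algebraMap (ZMod p) k a = P.1) ∧
      (f.map (mapRingHom (algebraMap (ZMod p) k))).evalEval P.1 P.2 = 0 := by
  classical
  have h0 (a : ZMod p) : (f.map (evalRingHom a)).map (algebraMap (ZMod p) k) ≠ 0 :=
    ((hf.map _).map _).ne_zero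
  simp only [fiberPoints, Finset.mem_map, Finset.mem_sigma, Multiset.mem_toFinset,
    mem_roots (h0 _), IsRoot, ← evalEval_map_algebraMap]
  constructor
  · rintro ⟨⟨a, b⟩, ⟨ha, hb⟩, rfl⟩
    exact ⟨⟨a, ha, rfl⟩, hb⟩
  · rintro ⟨⟨a, ha, h⟩, hb⟩
    exact ⟨⟨a, P.2⟩, ⟨ha, by rwa [h]⟩, Prod.ext h rfl⟩

theorem card_fiberPoints_le (hf : f.Monic) (s : Finset (ZMod p)) :
    (fiberPoints k f s).card ≤ s.card * f.natDegree := by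
  classical
  rw [fiberPoints, Finset.card_map, Finset.card_sigma]
  refine Finset.sum_le_card_nsmul _ _ _ fun a _ ↦ ?_
  refine (Multiset.toFinset_card_le _).trans ((card_roots' _).trans ?_)
  rw [(hf.map _).natDegree_map, hf.natDegree_map]

theorem card_fiberPoints_eq [IsAlgClosed k] (hf : f.Monic) {δ : (ZMod p)[X]} {u v : (ZMod p)[X][X]}
    (huv : u * f + v * derivative f = C δ) (s : Finset (ZMod p)) (hs : ∀ a ∈ s, δ.eval a ≠ 0) :
    (fiberPoints k f s).card = s.card * f.natDegree := by
  classical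
  rw [fiberPoints, Finset.card_map, Finset.card_sigma]
  refine Finset.sum_const_nat fun a ha ↦ ?_
  have hsep : (f.map (evalRingHom a)).Separable := by
    refine ⟨C (δ.eval a)⁻¹ * u.map (evalRingHom a), C (δ.eval a)⁻¹ * v.map (evalRingHom a), ?_⟩
    have := congrArg (Polynomial.map (evalRingHom a)) huv
    rw [Polynomial.map_add, Polynomial.map_mul, Polynomial.map_mul, map_C, ← derivative_map,
      coe_evalRingHom] at this
    rw [mul_assoc, mul_assoc, ← mul_add, this, ← C_mul, inv_mul_cancel₀ (hs a ha), C_1]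
  rw [Multiset.toFinset_card_of_nodup (nodup_roots (hsep.map)),
    ← (IsAlgClosed.splits _).natDegree_eq_card_roots, (hf.map _).natDegree_map, hf.natDegree_map]

theorem natCard_points_eq (hf : f.Monic) [DecidableEq k] :
    Nat.card {P : ZMod p × ZMod p // f.evalEval P.1 P.2 = 0} =
      ((fiberPoints k f Finset.univ).filter fun P ↦ P.2 ^ p = P.2).card := by
  let ι := algebraMap (ZMod p) k
  have hι : Function.Injective (Prod.map ι ι) := ι.injective.prodMap ι.injective
  rw [Nat.card_eq_fintype_card, Fintype.card_subtype, ← Finset.card_map ⟨_, hι⟩]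
  congr 1
  ext ⟨x, y⟩
  rw [Finset.mem_map, Finset.mem_filter, mem_fiberPoints hf, pow_eq_self_iff_mem_range]
  constructor
  · rintro ⟨⟨a, b⟩, h, hab⟩
    obtain ⟨rfl, rfl⟩ := Prod.ext_iff.1 hab
    refine ⟨⟨⟨a, Finset.mem_univ a, rfl⟩, ?_⟩, b, rfl⟩
    have := map_mapRingHom_evalEval ι f a b
    rw [(Finset.mem_filter.1 h).2, map_zero] at this
    exact this
  · rintro ⟨⟨⟨a, -, h1⟩, h⟩, b, h2⟩
    obtain rfl : ι a = x := h1
    obtain rfl : ι b = y := h2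
    refine ⟨(a, b), Finset.mem_filter.2 ⟨Finset.mem_univ _, ι.injective ?_⟩, rfl⟩
    rw [map_zero, ← h]
    exact (map_mapRingHom_evalEval ι f a b).symm

/-- The Hasse–Weil estimate, up to the constant, for plane curves over prime fields. -/
theorem curve_bound (d e e' : ℕ) : ∃ C : ℕ, ∀ (p : ℕ) [Fact p.Prime] (f u v : (ZMod p)[X][X])
    (δ : (ZMod p)[X]), C < p → f.Monic →
    Irreducible (f.map (mapRingHom (algebraMap (ZMod p) (AlgebraicClosure (ZMod p))))) →
    f.natDegree = d → (∀ j, (f.coeff j).natDegree ≤ e) → δ ≠ 0 → δ.natDegree ≤ e' →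
    u * f + v * derivative f = Polynomial.C δ →
    |(Nat.card {P : ZMod p × ZMod p // f.evalEval P.1 P.2 = 0} : ℤ) - p| ≤ C * Nat.sqrt p := by
  classical
  obtain ⟨C₁, hC₁⟩ := card_rational_le d e
  obtain ⟨C₂, hC₂⟩ := card_nonrational_le d e
  refine ⟨C₁ + C₂ + 2 * (e' * d), fun p _ f u v δ hp hf hirr hd he hδ hδe huv ↦ ?_⟩
  let k := AlgebraicClosure (ZMod p)
  let ι := algebraMap (ZMod p) k
  have : CharP k p := charP_of_injective_algebraMap (algebraMap (ZMod p) k).injective p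
  let F := f.map (mapRingHom ι)
  have hF : F.Monic := hf.map _
  have hFd : F.natDegree = d := by rw [hf.natDegree_map, hd]
  have hd0 : 0 < d := by
    rw [← hFd, Nat.pos_iff_ne_zero]
    intro h
    refine not_irreducible_one ((hF.natDegree_eq_zero.1 h) ▸ (show Irreducible F from hirr))
  have hFp : F.map (mapRingHom (frobenius k p)) = F := by
    rw [Polynomial.map_map]
    congr 1
    ext a
    · simp [frobenius_def, ← map_pow]
    · simp
  have hFe (j : ℕ) : (F.coeff j).natDegree ≤ e := by
    rw [coeff_map]
    exact natDegree_map_le.trans (he j)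
  let bad := (Finset.univ : Finset (ZMod p)).filter fun a ↦ δ.eval a = 0
  have hbad : bad.card ≤ e' := by
    refine le_trans ?_ ((card_roots' δ).trans hδe)
    refine (Finset.card_le_card fun a ha ↦ ?_).trans (Multiset.toFinset_card_le _)
    simpa [hδ] using (Finset.mem_filter.1 ha).2
  let Z := fiberPoints k f Finset.univ
  have hZ {P : k × k} (h : P ∈ Z) : F.evalEval P.1 P.2 = 0 ∧ P.1 ^ p = P.1 := by
    obtain ⟨⟨a, -, h1⟩, h2⟩ := (mem_fiberPoints hf).1 h
    exact ⟨h2, pow_eq_self_iff_mem_range.2 ⟨a, h1⟩⟩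
  have hZcard : p * d ≤ Z.card + e' * d := by
    have h1 : (fiberPoints k f badᶜ).card ≤ Z.card := by
      refine Finset.card_le_card fun P hP ↦ (mem_fiberPoints hf).2 ?_
      obtain ⟨⟨a, -, h1⟩, h2⟩ := (mem_fiberPoints hf).1 hP
      exact ⟨⟨a, Finset.mem_univ a, h1⟩, h2⟩
    rw [card_fiberPoints_eq hf huv _ fun a ha ↦ by simpa [bad] using ha, hd] at h1
    have h2 : bad.card + badᶜ.card = p := by rw [Finset.card_add_card_compl, ZMod.card]
    rw [← h2, add_mul]
    have := Nat.mul_le_mul_right d hbad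
    omega
  let D (P : k × k) : Prop := (derivative F).evalEval P.1 P.2 = 0
  have hsing : (Z.filter D).card ≤ e' * d := by
    refine le_trans ?_ ((card_fiberPoints_le (k := k) hf bad).trans
      (by rw [hd]; exact Nat.mul_le_mul_right d hbad))
    refine Finset.card_le_card fun P hP ↦ (mem_fiberPoints hf).2 ?_
    rw [Finset.mem_filter] at hP
    obtain ⟨⟨a, -, h1⟩, h2⟩ := (mem_fiberPoints hf).1 hP.1
    refine ⟨⟨a, Finset.mem_filter.2 ⟨Finset.mem_univ a, ?_⟩, h1⟩, h2⟩
    have h3 := congrArg (fun g ↦ (g.map (mapRingHom ι)).evalEval P.1 P.2) huv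
    have h4 : (derivative F).evalEval P.1 P.2 = 0 := hP.2
    simp only [Polynomial.map_add, Polynomial.map_mul, ← derivative_map, evalEval_add, evalEval_mul,
      map_C, evalEval_C] at h3
    rw [h2, h4, mul_zero, mul_zero, zero_add, ← h1, coe_mapRingHom, eval_map, eval₂_at_apply] at h3
    exact ι.injective (by rw [← h3, map_zero])
  let r (P : k × k) : Prop := P.2 ^ p = P.2
  have h1 : ((Z.filter r).filter fun P ↦ ¬ D P).card ≤ p + C₁ * Nat.sqrt p := by
    refine hC₁ p k F (by omega) hF hirr hFp hFe hFd _ fun P hP ↦ ?_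
    simp only [Finset.mem_filter] at hP
    exact ⟨(hZ hP.1.1).1, hP.2, (hZ hP.1.1).2, hP.1.2⟩
  have h2 : ((Z.filter fun P ↦ ¬ r P).filter fun P ↦ ¬ D P).card ≤
      (d - 1) * p + C₂ * Nat.sqrt p := by
    refine hC₂ p k F (by omega) hF hirr hFp hFe hFd _ fun P hP ↦ ?_
    simp only [Finset.mem_filter] at hP
    exact ⟨(hZ hP.1.1).1, hP.2, (hZ hP.1.1).2, hP.1.2⟩
  have h3 := Finset.card_filter_add_card_filter_not (s := Z) r
  have h4 := Finset.card_filter_add_card_filter_not (s := Z.filter r) D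
  have h5 := Finset.card_filter_add_card_filter_not (s := Z.filter fun P ↦ ¬ r P) D
  have h6 : ((Z.filter r).filter D).card ≤ (Z.filter D).card :=
    Finset.card_le_card (Finset.filter_subset_filter _ (Finset.filter_subset _ _))
  have h7 : ((Z.filter fun P ↦ ¬ r P).filter D).card ≤ (Z.filter D).card :=
    Finset.card_le_card (Finset.filter_subset_filter _ (Finset.filter_subset _ _))
  rw [natCard_points_eq (k := k) hf]
  change |((Z.filter r).card : ℤ) - p| ≤ _
  have h8 : 1 ≤ Nat.sqrt p := Nat.sqrt_pos.2 (by omega)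
  have h9 : e' * d ≤ e' * d * Nat.sqrt p := Nat.le_mul_of_pos_right _ h8
  obtain ⟨d', rfl⟩ : ∃ d', d = d' + 1 := ⟨d - 1, by omega⟩
  have h10 : p * (d' + 1) = d' * p + p := by ring
  rw [Nat.add_sub_cancel] at h2
  have h11 : (C₁ + C₂ + 2 * (e' * (d' + 1))) * Nat.sqrt p =
    C₁ * Nat.sqrt p + C₂ * Nat.sqrt p + 2 * (e' * (d' + 1) * Nat.sqrt p) := by ring
  have h12 : (((C₁ + C₂ + 2 * (e' * (d' + 1)) : ℕ) : ℤ)) * (Nat.sqrt p : ℤ) =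
    ((C₁ * Nat.sqrt p + C₂ * Nat.sqrt p + 2 * (e' * (d' + 1) * Nat.sqrt p) : ℕ) : ℤ) := by
    rw [← h11]; push_cast; ring
  rw [h12, abs_le]
  constructor <;> omega

end PlaneCurve

section LinearDisjoint

variable {E M : Type*} [Field E] [Field M] [Algebra E M] {K : IntermediateField E M}

/-- If `E` is algebraically closed in `K`, minimal polynomials over `E` stay irreducible
over `K`. -/
theorem natDegree_minpoly_eq_of_isAlgebraic_imp_mem_bot
    (hK : ∀ z ∈ K, IsAlgebraic E z → z ∈ (⊥ : IntermediateField E M)) {θ : M}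
    (hθ : IsIntegral E θ) : (minpoly K θ).natDegree = (minpoly E θ).natDegree := by
  have hθK : IsIntegral K θ := hθ.tower_top
  refine le_antisymm ?_ ?_
  · have := natDegree_le_of_dvd (minpoly.dvd_map_of_isScalarTower E K θ)
      ((minpoly.monic hθ).map _).ne_zero
    rwa [(minpoly.monic hθ).natDegree_map] at this
  · have h := integralClosure.mem_lifts_of_monic_of_dvd_map K (minpoly.monic hθ)
      (minpoly.monic hθK) (minpoly.dvd_map_of_isScalarTower E K θ)
    have h' : minpoly K θ ∈ lifts (algebraMap E K) := by
      rw [lifts_iff_coeff_lifts] at h ⊢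
      intro n
      obtain ⟨c, hc⟩ := h n
      have hcE : IsAlgebraic E (((minpoly K θ).coeff n : K) : M) := by
        rw [← hc]
        exact (c.2.map K.val).isAlgebraic
      obtain ⟨e, he⟩ := IntermediateField.mem_bot.1 (hK _ ((minpoly K θ).coeff n).2 hcE)
      exact ⟨e, Subtype.ext he⟩
    obtain ⟨q, hq, hdeg, hmon⟩ := lifts_and_natDegree_eq_and_monic h' (minpoly.monic hθK)
    rw [← hdeg]
    refine natDegree_le_of_dvd (minpoly.dvd E θ ?_) hmon.ne_zero
    rw [← aeval_map_algebraMap K, hq, minpoly.aeval]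

/-- If `E` is algebraically closed in `K`, then `K` is linearly disjoint from every algebraic
extension of `E`. -/
theorem linearDisjoint_of_isAlgebraic [CharZero E]
    (hK : ∀ z ∈ K, IsAlgebraic E z → z ∈ (⊥ : IntermediateField E M))
    (Ω : IntermediateField E M) [Algebra.IsAlgebraic E Ω] : K.LinearDisjoint Ω := by
  rw [IntermediateField.linearDisjoint_iff']
  have : Algebra.IsIntegral E Ω.toSubalgebra := (inferInstance : Algebra.IsIntegral E Ω)
  refine Subalgebra.LinearDisjoint.of_linearDisjoint_finite_right _ _ fun B hB _ ↦ ?_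
  have hBalg : Algebra.IsAlgebraic E B := Algebra.IsAlgebraic.of_finite E B
  let B' : IntermediateField E M := B.toIntermediateField'
    (isField_of_isIntegral_of_isField' (Field.toIsField E))
  have hfin : FiniteDimensional E B' := (inferInstance : Module.Finite E B)
  obtain ⟨θ, hθ⟩ := Field.exists_primitive_element E B'
  have hθi : IsIntegral E θ := Algebra.IsIntegral.isIntegral θ
  have hθi' : IsIntegral E (θ : M) := hθi.map B'.val
  let pb := (IntermediateField.adjoin.powerBasis hθi).map
    ((IntermediateField.equivOfEq hθ).trans IntermediateField.topEquiv)
  have hgen : pb.gen = θ := by simp [pb]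
  change K.toSubalgebra.LinearDisjoint B'.toSubalgebra
  rw [← IntermediateField.linearDisjoint_iff']
  refine IntermediateField.LinearDisjoint.of_basis_right pb.basis ?_
  have hdim : pb.dim = (minpoly K (θ : M)).natDegree := by
    rw [natDegree_minpoly_eq_of_isAlgebraic_imp_mem_bot hK hθi', ← hgen,
      ← pb.natDegree_minpoly]
    congr 1
    exact (minpoly.algebraMap_eq (A := E) (B := B') (B' := M) B'.val.injective pb.gen).symm
  have h := linearIndependent_pow (K := K) (θ : M)
  rw [← hdim] at h
  have hb : (B'.val ∘ pb.basis : Fin pb.dim → M) =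
        fun i : Fin pb.dim ↦ (θ : M) ^ (i : ℕ) := by
    ext i
    simp [hgen]
  rw [hb]
  exact h

end LinearDisjoint

section PlaneModel

variable {E M : Type*} [Field E] [Field M] [Algebra E M]

/-- A bivariate polynomial as the sum of its monomials, evaluated at a point. -/
theorem eval₂_eval₂RingHom_eq_sum {A B : Type*} [CommRing A] [CommRing B] (φ : A →+* B) (x y : B)
    (g : A[X][X]) {d N : ℕ} (hd : g.natDegree < d) (hN : ∀ j, (g.coeff j).natDegree < N) :
    eval₂ (eval₂RingHom φ x) y g =
      ∑ q ∈ (Finset.univ : Finset (Fin d)) ×ˢ Finset.range N,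
        φ ((g.coeff q.1).coeff q.2) * (x ^ q.2 * y ^ (q.1 : ℕ)) := by
  rw [eval₂_eq_sum_range' _ hd, Finset.sum_product, ← Fin.sum_univ_eq_sum_range
    (fun j ↦ (eval₂RingHom φ x) (g.coeff j) * y ^ j)]
  refine Finset.sum_congr rfl fun j _ ↦ ?_
  rw [coe_eval₂RingHom, eval₂_eq_sum_range' _ (hN j), Finset.sum_mul]
  exact Finset.sum_congr rfl fun i _ ↦ by ring

/-- If no nonzero polynomial of `Y`-degree less than `d` vanishes at `(x, y)`, then the monomials
`X ^ i * Y ^ j` with `j < d` have linearly independent values. -/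
theorem linearIndependent_monomials {K : Type*} [Field K] [Algebra E K] {x y : K} {d : ℕ}
    (hmin : ∀ g : E[X][X], g.natDegree < d →
      eval₂ (eval₂RingHom (algebraMap E K) x) y g = 0 → g = 0) :
    LinearIndependent E fun q : Fin d × ℕ ↦ x ^ q.2 * y ^ (q.1 : ℕ) := by
  rw [linearIndependent_iff']
  intro s c hc q hq
  have hd : 0 < d := q.1.pos
  let g : E[X][X] := ∑ r ∈ s, monomial (r.1 : ℕ) (monomial r.2 (c r))
  have hg : g = 0 := by
    refine hmin g ?_ ?_
    · refine lt_of_le_of_lt (natDegree_sum_le_of_forall_le s _ (n := d - 1) fun r _ ↦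
        (natDegree_monomial_le _).trans (by have := r.1.2; omega)) (by omega)
    · rw [← hc, eval₂_finsetSum]
      refine Finset.sum_congr rfl fun r _ ↦ ?_
      rw [eval₂_monomial, coe_eval₂RingHom, eval₂_monomial, Algebra.smul_def, mul_assoc]
  have h := congr(($hg).coeff q.1 |>.coeff q.2)
  simp only [g, finsetSum_coeff, coeff_monomial, coeff_zero] at h
  rw [Finset.sum_eq_single q] at h
  · simpa using h
  · intro r _ hr
    by_cases h1 : r.1 = q.1
    · have h2 : r.2 ≠ q.2 := fun h2 ↦ hr (Prod.ext h1 h2)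
      simp [h1, coeff_monomial, h2]
    · have : (r.1 : ℕ) ≠ q.1 := fun h ↦ h1 (Fin.ext h)
      simp [this]
  · exact fun h ↦ absurd hq h

/-- The equation of a plane model stays irreducible over any linearly disjoint extension of the
base field. -/
theorem irreducible_map_of_linearDisjoint {K Ω : IntermediateField E M}
    (hΩ : K.LinearDisjoint Ω) {x y : M} (hx : x ∈ K) (hy : y ∈ K) {f : E[X][X]} (hf : f.Monic)
    (h0 : eval₂ (eval₂RingHom (algebraMap E M) x) y f = 0)
    (hmin : ∀ g : E[X][X], g.natDegree < f.natDegree →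
      eval₂ (eval₂RingHom (algebraMap E M) x) y g = 0 → g = 0) :
    Irreducible (f.map (mapRingHom (algebraMap E Ω))) := by
  have hli := hΩ.linearIndependent_left (linearIndependent_monomials (K := K) (x := ⟨x, hx⟩)
    (y := ⟨y, hy⟩) (d := f.natDegree) fun g hg h ↦ hmin g hg <| by
      have := congr(algebraMap K M $h)
      rw [hom_eval₂, map_zero] at this
      have he : (algebraMap K M).comp (eval₂RingHom (algebraMap E K) ⟨x, hx⟩) =
          eval₂RingHom (algebraMap E M) x := by
        ext
        · simp [← IsScalarTower.algebraMap_apply]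
        · simp
      rw [he] at this
      exact this)
  have hdeg : (f.map (mapRingHom (algebraMap E Ω))).natDegree = f.natDegree :=
    hf.natDegree_map _
  have hval : ∀ g : E[X][X], eval₂ (eval₂RingHom (algebraMap Ω M) x) y
      (g.map (mapRingHom (algebraMap E Ω))) = eval₂ (eval₂RingHom (algebraMap E M) x) y g := by
    intro g
    rw [eval₂_map]
    congr 1
    ext
    · simp [← IsScalarTower.algebraMap_apply]
    · simp
  have hmin' : ∀ g : Polynomial (Polynomial Ω), g.natDegree < f.natDegree → g.Monic →
      eval₂ (eval₂RingHom (algebraMap Ω M) x) y g ≠ 0 := by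
    intro g hg hmon h
    obtain ⟨N, hN⟩ : ∃ N, ∀ j, (g.coeff j).natDegree < N := by
      refine ⟨(g.support.sup fun j ↦ (g.coeff j).natDegree) + 1, fun j ↦ Nat.lt_succ_of_le ?_⟩
      by_cases hj : j ∈ g.support
      · exact Finset.le_sup (f := fun j ↦ (g.coeff j).natDegree) hj
      · simp [notMem_support_iff.1 hj]
    rw [eval₂_eval₂RingHom_eq_sum _ _ _ _ hg hN] at h
    have h' := linearIndependent_iff'.1 hli _ (fun q ↦ (g.coeff q.1).coeff q.2)
      (by rw [← h]; rfl) (⟨g.natDegree, hg⟩, 0) (by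
        simp only [Finset.mem_product, Finset.mem_univ, Finset.mem_range, true_and]
        exact (Nat.zero_le _).trans_lt (hN 0))
    rw [hmon.coeff_natDegree] at h'
    simp at h'
  refine (hf.map _).irreducible_iff_natDegree.2 ⟨fun h1 ↦ ?_, fun g h hg hh hgh ↦ ?_⟩
  · have := hval f
    rw [h0, h1, eval₂_one] at this
    exact one_ne_zero this
  · have hv := hval f
    rw [h0, ← hgh, eval₂_mul, mul_eq_zero] at hv
    have hs := hg.natDegree_mul hh
    rw [hgh, hdeg] at hs
    rcases hv with hv | hv
    · have : ¬ g.natDegree < f.natDegree := fun h ↦ hmin' g h hg hv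
      omega
    · have : ¬ h.natDegree < f.natDegree := fun h' ↦ hmin' h h' hh hv
      omega

end PlaneModel

section PlaneModelExists

/-- An irreducible monic polynomial over a normal domain of characteristic zero satisfies a
Bezout identity with its derivative, up to a nonzero constant. -/
theorem exists_bezout_derivative {A : Type*} [CommRing A] [IsDomain A] [IsIntegrallyClosed A]
    [CharZero A] {f : A[X]} (hf : f.Monic) (hirr : Irreducible f) :
    ∃ (u v : A[X]) (δ : A), δ ≠ 0 ∧ u * f + v * derivative f = C δ := by
  have hirr' := (hf.irreducible_iff_irreducible_map_fraction_map (K := FractionRing A)).1 hirr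
  have : CharZero (FractionRing A) := IsFractionRing.charZero A
  have hd : f.natDegree ≠ 0 := fun h ↦ hirr.not_isUnit (by
    rw [eq_one_of_monic_natDegree_zero hf h]; exact isUnit_one)
  obtain ⟨u, v, -, -, h⟩ := exists_mul_add_mul_eq_C_resultant f (derivative f) le_rfl le_rfl
    (Or.inl hd)
  refine ⟨u, v, _, fun h0 ↦ ?_, by rw [← h]; ring⟩
  have hinj := IsFractionRing.injective A (FractionRing A)
  have h1 := congr(algebraMap A (FractionRing A) $h0)
  rw [map_zero, ← resultant_map_map] at h1
  have h2 : resultant (f.map (algebraMap A (FractionRing A)))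
      (derivative (f.map (algebraMap A (FractionRing A)))) = 0 := by
    rw [derivative_map, natDegree_map_eq_of_injective hinj, natDegree_map_eq_of_injective hinj]
    exact h1
  exact (resultant_eq_zero_iff.1 h2).2 hirr'.separable

variable {E M : Type*} [Field E] [Field M] [Algebra E M]

theorem exists_adjoin_pair_eq [CharZero E] {K : IntermediateField E M} (hfg : K.FG) {x : M}
    (hx : x ∈ K) (halg : ∀ z ∈ K, IsAlgebraic (IntermediateField.adjoin E {x}) z) :
    ∃ y ∈ K, IntermediateField.adjoin E {x, y} = K := by
  have hle : IntermediateField.adjoin E {x} ≤ K := by simpa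
  let K' := IntermediateField.extendScalars hle
  have hess : Algebra.EssFiniteType E K := IntermediateField.essFiniteType_iff.2 hfg
  have hess' : Algebra.EssFiniteType E K' := hess
  have : Algebra.EssFiniteType (IntermediateField.adjoin E {x}) K' := .of_comp E _ _
  have : Algebra.IsAlgebraic (IntermediateField.adjoin E {x}) K' :=
    ⟨fun z ↦ (isAlgebraic_algebraMap_iff (algebraMap K' M).injective).1 (halg z z.2)⟩
  have : FiniteDimensional (IntermediateField.adjoin E {x}) K' :=
    Algebra.finite_of_essFiniteType_of_isAlgebraic
  obtain ⟨y, hy⟩ := Field.exists_primitive_element (IntermediateField.adjoin E {x}) K'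
  refine ⟨y, y.2, ?_⟩
  have h := congr(IntermediateField.lift $hy)
  rw [IntermediateField.lift_adjoin_simple, IntermediateField.lift_top] at h
  have h' := congr(IntermediateField.restrictScalars E $h)
  rw [IntermediateField.adjoin_simple_adjoin_simple] at h'
  exact h'

theorem exists_planeModel [CharZero E] [IsAlgClosed M] {K : IntermediateField E M} (hfg : K.FG)
    (hK : ∀ z ∈ K, IsAlgebraic E z → z ∈ (⊥ : IntermediateField E M))
    {x : M} (hx : x ∈ K) (htr : Transcendental E x)
    (halg : ∀ z ∈ K, IsAlgebraic (IntermediateField.adjoin E {x}) z) :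
    ∃ y ∈ K, IntermediateField.adjoin E {x, y} = K ∧ ∃ (f u v : E[X][X]) (δ : E[X]),
      f.Monic ∧ eval₂ (eval₂RingHom (algebraMap E M) x) y f = 0 ∧
      (∀ g : E[X][X], g.natDegree < f.natDegree →
        eval₂ (eval₂RingHom (algebraMap E M) x) y g = 0 → g = 0) ∧
      Irreducible (f.map (mapRingHom (algebraMap E (algebraicClosure E M)))) ∧
      δ ≠ 0 ∧ u * f + v * derivative f = C δ := by
  obtain ⟨y, hy, hxy⟩ := exists_adjoin_pair_eq hfg hx halg
  let _ : Algebra E[X] M := (eval₂RingHom (algebraMap E M) x).toAlgebra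
  have hinj : Function.Injective (algebraMap E[X] M) := transcendental_iff_injective.1 htr
  have : FaithfulSMul E[X] M := (faithfulSMul_iff_algebraMap_injective _ _).2 hinj
  have hya : IsAlgebraic E[X] y := by
    have h1 := IntermediateField.isAlgebraic_adjoin_iff.1 (halg y hy)
    have hmem : ∀ g : E[X], algebraMap E[X] M g ∈ Algebra.adjoin E {x} := fun g ↦
      aeval_mem_adjoin_singleton E x
    refine h1.of_ringHom_of_comp_eq ((algebraMap E[X] M).codRestrict _ hmem) (RingHom.id M) ?_
      Function.injective_id rfl
    rintro ⟨z, hz⟩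
    rw [Algebra.adjoin_singleton_eq_range_aeval] at hz
    obtain ⟨g, rfl⟩ := hz
    exact ⟨g, rfl⟩
  obtain ⟨r, hr0, hr⟩ := hya.exists_integral_multiple
  have hrx : algebraMap E[X] M r ∈ IntermediateField.adjoin E {x} :=
    IntermediateField.algebra_adjoin_le_adjoin _ _ (aeval_mem_adjoin_singleton E x)
  have hrx0 : algebraMap E[X] M r ≠ 0 := by rwa [Ne, map_eq_zero_iff _ hinj]
  have hle : IntermediateField.adjoin E {x} ≤ K := by simpa
  have hyK : r • y ∈ K := by
    rw [Algebra.smul_def]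
    exact mul_mem (hle hrx) hy
  have hxy' : IntermediateField.adjoin E {x, r • y} = K := by
    refine le_antisymm (IntermediateField.adjoin_le_iff.2 ?_) ?_
    · rintro z (rfl | rfl)
      exacts [hx, hyK]
    · rw [← hxy]
      refine IntermediateField.adjoin_le_iff.2 ?_
      have hx' : x ∈ IntermediateField.adjoin E {x, r • y} :=
        IntermediateField.subset_adjoin _ _ (by simp)
      rintro z (rfl | rfl)
      · exact hx'
      · have h1 : r • z ∈ IntermediateField.adjoin E {x, r • z} :=
          IntermediateField.subset_adjoin _ _ (by simp)
        have h2 : algebraMap E[X] M r ∈ IntermediateField.adjoin E {x, r • z} := by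
          have : IntermediateField.adjoin E {x} ≤ IntermediateField.adjoin E {x, r • z} := by
            simpa
          exact this hrx
        have h3 := div_mem h1 h2
        rwa [Algebra.smul_def, mul_div_cancel_left₀ _ hrx0] at h3
  refine ⟨r • y, hyK, hxy', ?_⟩
  have hmin : ∀ g : E[X][X], g.natDegree < (minpoly E[X] (r • y)).natDegree →
      eval₂ (eval₂RingHom (algebraMap E M) x) (r • y) g = 0 → g = 0 := by
    intro g hg h0
    by_contra hne
    have := natDegree_le_of_dvd (minpoly.isIntegrallyClosed_dvd hr (p := g) h0) hne
    omega
  have h0 : eval₂ (eval₂RingHom (algebraMap E M) x) (r • y) (minpoly E[X] (r • y)) = 0 :=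
    minpoly.aeval E[X] (r • y)
  obtain ⟨u, v, δ, hδ, huv⟩ := exists_bezout_derivative (minpoly.monic hr) (minpoly.irreducible hr)
  exact ⟨_, u, v, δ, minpoly.monic hr, h0, hmin,
    irreducible_map_of_linearDisjoint (linearDisjoint_of_isAlgebraic hK _) hx hyK
      (minpoly.monic hr) h0 hmin, hδ, huv⟩

end PlaneModelExists

section Tower

variable {k M : Type} [Field k] [Field M] [Algebra k M]

theorem mem_bot_of_mem_adjoin_of_transcendental {x z : M} (hx : Transcendental k x)
    (hz : z ∈ IntermediateField.adjoin k {x}) (hza : IsAlgebraic k z) :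
    z ∈ (⊥ : IntermediateField k M) := by
  obtain ⟨P, Q, hPQ⟩ := (IntermediateField.mem_adjoin_simple_iff _ _).1 hz
  by_contra hbot
  have hQ0 : Q ≠ 0 := by
    rintro rfl
    exact hbot (by rw [hPQ, map_zero, div_zero]; exact zero_mem _)
  have hQx : aeval x Q ≠ 0 := fun h ↦ hx ⟨Q, hQ0, h⟩
  let L := IntermediateField.adjoin k {z}
  let z' : L := ⟨z, IntermediateField.mem_adjoin_simple_self k z⟩
  have : Algebra.IsAlgebraic k L := IntermediateField.isAlgebraic_adjoin_simple hza.isIntegral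
  let G : Polynomial L := P.map (algebraMap k L) - C z' * Q.map (algebraMap k L)
  have hG : G ≠ 0 := by
    intro h
    obtain ⟨i, hi⟩ : ∃ i, Q.coeff i ≠ 0 := by
      by_contra! hc
      exact hQ0 (ext hc)
    have h1 := congr(algebraMap L M (($h).coeff i))
    simp only [G, coeff_sub, coeff_map, coeff_C_mul, coeff_zero, map_sub, map_mul, map_zero,
      ← IsScalarTower.algebraMap_apply] at h1
    have h2 : algebraMap k M (Q.coeff i) ≠ 0 := by simpa using hi
    refine hbot (IntermediateField.mem_bot.2 ⟨P.coeff i / Q.coeff i, ?_⟩)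
    rw [map_div₀, div_eq_iff h2]
    exact sub_eq_zero.1 h1
  have hxL : IsAlgebraic L x := by
    refine ⟨G, hG, ?_⟩
    simp only [G, map_sub, map_mul, aeval_map_algebraMap, aeval_C]
    rw [sub_eq_zero, eq_comm, ← eq_div_iff hQx]
    exact hPQ
  exact hx (hxL.restrictScalars k)

/-- The relative algebraic closure of `k` in a finitely generated extension of transcendence degree
one is finite over `k`. -/
theorem finiteDimensional_algebraicClosure_inf [CharZero k] {K : IntermediateField k M}
    (hfg : K.FG) {x : M} (hx : x ∈ K) (htr : Transcendental k x)
    (halg : ∀ z ∈ K, IsAlgebraic (IntermediateField.adjoin k {x}) z) :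
    FiniteDimensional k (algebraicClosure k M ⊓ K : IntermediateField k M) := by
  have hle : IntermediateField.adjoin k {x} ≤ K := by simpa
  let K' := IntermediateField.extendScalars hle
  have hess : Algebra.EssFiniteType k K := IntermediateField.essFiniteType_iff.2 hfg
  have hess' : Algebra.EssFiniteType k K' := hess
  have : Algebra.EssFiniteType (IntermediateField.adjoin k {x}) K' := .of_comp k _ _
  have : Algebra.IsAlgebraic (IntermediateField.adjoin k {x}) K' :=
    ⟨fun z ↦ (isAlgebraic_algebraMap_iff (algebraMap K' M).injective).1 (halg z z.2)⟩
  have : FiniteDimensional (IntermediateField.adjoin k {x}) K' :=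
    Algebra.finite_of_essFiniteType_of_isAlgebraic
  set E : IntermediateField k M := algebraicClosure k M ⊓ K
  have : Algebra.IsAlgebraic k E := ⟨fun z ↦
    (isAlgebraic_algebraMap_iff (algebraMap E M).injective).1
      (mem_algebraicClosure_iff.1 z.2.1)⟩
  have hdisj : (IntermediateField.adjoin k {x}).LinearDisjoint E :=
    linearDisjoint_of_isAlgebraic
      (fun z hz hza ↦ mem_bot_of_mem_adjoin_of_transcendental htr hz hza) E
  let b := Module.Basis.ofVectorSpace k E
  have hli := hdisj.linearIndependent_right b.linearIndependent
  have hli' : LinearIndependent (IntermediateField.adjoin k {x})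
      (fun i ↦ (⟨b i, (b i).2.2⟩ : K')) :=
    LinearIndependent.of_comp K'.val.toLinearMap hli
  have := hli'.finite_of_isNoetherian
  exact Module.Finite.of_basis b

end Tower

section Fibration

/-- A finitely generated field of positive transcendence degree is the function field of a
geometrically irreducible plane curve over a finitely generated field. -/
theorem exists_fibration {K : IntermediateField ℚ ℂ} (hfg : K.FG) {ι : Type} [Finite ι] (x : ι → ℂ)
    (hxK : ∀ j, x j ∈ K) (hind : AlgebraicIndependent ℚ x)
    (halg : ∀ z ∈ K, IsAlgebraic (IntermediateField.adjoin ℚ (Set.range x)) z) (i : ι) :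
    ∃ E : IntermediateField ℚ ℂ, E ≤ K ∧ E.FG ∧ (∀ j : {j // j ≠ i}, x j ∈ E) ∧
      (∀ z ∈ E, IsAlgebraic
        (IntermediateField.adjoin ℚ (Set.range fun j : {j // j ≠ i} ↦ x j)) z) ∧
      (∀ z ∈ K, IsAlgebraic ℚ z → z ∈ E) ∧
      ∃ y ∈ K, IntermediateField.adjoin ℚ ((E : Set ℂ) ∪ {x i, y}) = K ∧
      ∃ (f u v : E[X][X]) (δ : E[X]),
        f.Monic ∧ eval₂ (eval₂RingHom (algebraMap E ℂ) (x i)) y f = 0 ∧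
        (∀ g : E[X][X], g.natDegree < f.natDegree →
          eval₂ (eval₂RingHom (algebraMap E ℂ) (x i)) y g = 0 → g = 0) ∧
        Irreducible (f.map (mapRingHom (algebraMap E (algebraicClosure E ℂ)))) ∧
        δ ≠ 0 ∧ u * f + v * derivative f = C δ := by
  obtain ⟨-, htr'⟩ := (AlgebraicIndependent.iff_transcendental_adjoin_image i).1 hind
  have himg : x '' {i}ᶜ = Set.range fun j : {j // j ≠ i} ↦ x j := by
    ext z
    simp
  rw [himg] at htr'
  set k : IntermediateField ℚ ℂ :=
    IntermediateField.adjoin ℚ (Set.range fun j : {j // j ≠ i} ↦ x j) with hk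
  have htr : Transcendental k (x i) := IntermediateField.transcendental_adjoin_iff.2 htr'
  have hkK : k ≤ K := IntermediateField.adjoin_le_iff.2 (by rintro _ ⟨j, rfl⟩; exact hxK j)
  have hess : Algebra.EssFiniteType ℚ K := IntermediateField.essFiniteType_iff.2 hfg
  let K₁ : IntermediateField k ℂ := IntermediateField.extendScalars hkK
  have hess₁ : Algebra.EssFiniteType ℚ K₁ := hess
  have hK₁fg : K₁.FG := IntermediateField.essFiniteType_iff.1 (.of_comp ℚ _ _)
  have hsub : IntermediateField.adjoin ℚ (Set.range x) ≤
      (IntermediateField.adjoin k {x i}).restrictScalars ℚ := by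
    refine IntermediateField.adjoin_le_iff.2 ?_
    rintro _ ⟨j, rfl⟩
    by_cases hj : j = i
    · rw [hj]
      exact IntermediateField.mem_adjoin_simple_self k (x i)
    · have : x j ∈ k := IntermediateField.subset_adjoin _ _ ⟨⟨j, hj⟩, rfl⟩
      exact (IntermediateField.adjoin k {x i}).algebraMap_mem ⟨x j, this⟩
  have halg₁ : ∀ z ∈ K₁, IsAlgebraic (IntermediateField.adjoin k {x i}) z := fun z hz ↦
    (halg z hz).ringHom_of_comp_eq (IntermediateField.inclusion hsub).toRingHom (RingHom.id ℂ)
      (IntermediateField.inclusion_injective hsub) rfl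
  have hfin := finiteDimensional_algebraicClosure_inf hK₁fg (hxK i) htr halg₁
  set E₁ : IntermediateField k ℂ := algebraicClosure k ℂ ⊓ K₁
  let E : IntermediateField ℚ ℂ := E₁.restrictScalars ℚ
  have hEalg : Algebra.IsAlgebraic k E₁ := Algebra.IsAlgebraic.of_finite k E₁
  have hEK : E ≤ K := fun z hz ↦ hz.2
  have hEfg : E.FG := by
    have : Algebra.EssFiniteType ℚ k := IntermediateField.essFiniteType_iff.2
      (IntermediateField.fg_adjoin_of_finite (Set.finite_range _))
    have : Algebra.EssFiniteType ℚ E₁ := .comp ℚ k E₁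
    exact IntermediateField.essFiniteType_iff.1 this
  have hkE : k ≤ E := fun z hz ↦ E₁.algebraMap_mem ⟨z, hz⟩
  let K₂ : IntermediateField E ℂ := IntermediateField.extendScalars hEK
  have hess₂ : Algebra.EssFiniteType ℚ K₂ := hess
  have hK₂fg : K₂.FG := IntermediateField.essFiniteType_iff.1 (.of_comp ℚ _ _)
  have hdown : ∀ z : ℂ, IsAlgebraic E z → IsAlgebraic k z := fun z hz ↦ by
    have hz' : IsAlgebraic E₁ z := hz
    exact hz'.restrictScalars k
  have hclosed : ∀ z ∈ K₂, IsAlgebraic E z → z ∈ (⊥ : IntermediateField E ℂ) := fun z hz hza ↦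
    IntermediateField.mem_bot.2 ⟨⟨z, mem_algebraicClosure_iff.2 (hdown z hza), hz⟩, rfl⟩
  have htr₂ : Transcendental E (x i) := fun h ↦ htr (hdown _ h)
  have hsub₂ : IntermediateField.adjoin ℚ (Set.range x) ≤
      (IntermediateField.adjoin E {x i}).restrictScalars ℚ := by
    refine IntermediateField.adjoin_le_iff.2 ?_
    rintro _ ⟨j, rfl⟩
    by_cases hj : j = i
    · rw [hj]
      exact IntermediateField.mem_adjoin_simple_self E (x i)
    · have : x j ∈ k := IntermediateField.subset_adjoin _ _ ⟨⟨j, hj⟩, rfl⟩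
      exact (IntermediateField.adjoin E {x i}).algebraMap_mem ⟨x j, hkE this⟩
  have halg₂ : ∀ z ∈ K₂, IsAlgebraic (IntermediateField.adjoin E {x i}) z := fun z hz ↦
    (halg z hz).ringHom_of_comp_eq (IntermediateField.inclusion hsub₂).toRingHom (RingHom.id ℂ)
      (IntermediateField.inclusion_injective hsub₂) rfl
  obtain ⟨y, hy, hxy, hmodel⟩ := exists_planeModel hK₂fg hclosed (hxK i) htr₂ halg₂
  refine ⟨E, hEK, hEfg, fun j ↦ hkE (IntermediateField.subset_adjoin _ _ ⟨j, rfl⟩),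
    fun z hz ↦ mem_algebraicClosure_iff.1 hz.1,
    fun z hz hza ↦ ⟨mem_algebraicClosure_iff.2 (hza.tower_top k), hz⟩, y, hy, ?_, hmodel⟩
  rw [← IntermediateField.restrictScalars_adjoin, hxy]
  rfl

end Fibration

/-- A subring of `ℂ` generated by finitely many elements. -/
def IsFGSubring (R : Subring ℂ) : Prop := ∃ s : Finset ℂ, Subring.closure (s : Set ℂ) = R

theorem mem_adjoin_subring_iff (R : Subring ℂ) {z : ℂ} :
    z ∈ IntermediateField.adjoin ℚ (R : Set ℂ) ↔ ∃ a ∈ R, ∃ b ∈ R, a / b = z := by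
  have h := Subfield.mem_closure_iff (s := (R : Set ℂ)) (x := z)
  rw [Subring.closure_eq] at h
  rw [← h]
  constructor
  · intro hz
    have hle : IntermediateField.adjoin ℚ (R : Set ℂ) ≤
        (Subfield.closure (R : Set ℂ)).toIntermediateField fun q ↦ by
          rw [eq_ratCast]; exact SubfieldClass.ratCast_mem _ q :=
      IntermediateField.adjoin_le_iff.2 fun w hw ↦ Subfield.subset_closure hw
    exact hle hz
  · intro hz
    have hle : Subfield.closure (R : Set ℂ) ≤
        (IntermediateField.adjoin ℚ (R : Set ℂ)).toSubfield :=
      Subfield.closure_le.2 fun w hw ↦ IntermediateField.subset_adjoin ℚ _ hw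
    exact hle hz

theorem exists_common_denominator (R : Subring ℂ) (s : Finset ℂ)
    (hs : ∀ z ∈ s, z ∈ IntermediateField.adjoin ℚ (R : Set ℂ)) :
    ∃ a ∈ R, a ≠ 0 ∧ ∀ z ∈ s, a * z ∈ R := by
  classical
  induction s using Finset.induction_on with
  | empty => exact ⟨1, R.one_mem, one_ne_zero, by simp⟩
  | insert w s hw ih =>
    obtain ⟨a, haR, ha0, ha⟩ := ih fun z hz ↦ hs z (Finset.mem_insert_of_mem hz)
    obtain ⟨c, hc, b, hb, hcb⟩ := (mem_adjoin_subring_iff R).1 (hs w (Finset.mem_insert_self w s))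
    obtain ⟨b', hb', hb0, hbw⟩ : ∃ b' ∈ R, b' ≠ 0 ∧ b' * w ∈ R := by
      by_cases hb0 : b = 0
      · refine ⟨1, R.one_mem, one_ne_zero, ?_⟩
        rw [← hcb, hb0, div_zero, mul_zero]
        exact R.zero_mem
      · refine ⟨b, hb, hb0, ?_⟩
        rwa [← hcb, mul_div_cancel₀ _ hb0]
    refine ⟨a * b', R.mul_mem haR hb', mul_ne_zero ha0 hb0, fun z hz ↦ ?_⟩
    rcases Finset.mem_insert.1 hz with rfl | hz
    · rw [mul_assoc]
      exact R.mul_mem haR hbw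
    · rw [mul_right_comm]
      exact R.mul_mem (ha z hz) hb'

theorem exists_pow_mul_mem (R : Subring ℂ) {S : Subring ℂ} (hS : IsFGSubring S)
    (hSR : ∀ z ∈ S, z ∈ IntermediateField.adjoin ℚ (R : Set ℂ)) :
    ∃ a ∈ R, a ≠ 0 ∧ ∀ z ∈ S, ∃ n : ℕ, a ^ n * z ∈ R := by
  obtain ⟨s, rfl⟩ := hS
  obtain ⟨a, haR, ha0, ha⟩ := exists_common_denominator R s
    fun z hz ↦ hSR z (Subring.subset_closure hz)
  refine ⟨a, haR, ha0, fun z hz ↦ ?_⟩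
  induction hz using Subring.closure_induction with
  | mem z hz => exact ⟨1, by simpa using ha z hz⟩
  | zero => exact ⟨0, by simp⟩
  | one => exact ⟨0, by simp⟩
  | add z w _ _ hz hw =>
    obtain ⟨n, hn⟩ := hz
    obtain ⟨m, hm⟩ := hw
    refine ⟨n + m, ?_⟩
    have : a ^ (n + m) * (z + w) = a ^ m * (a ^ n * z) + a ^ n * (a ^ m * w) := by ring
    rw [this]
    exact R.add_mem (R.mul_mem (R.pow_mem haR _) hn) (R.mul_mem (R.pow_mem haR _) hm)
  | neg z _ hz =>
    obtain ⟨n, hn⟩ := hz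
    exact ⟨n, by rw [mul_neg]; exact R.neg_mem hn⟩
  | mul z w _ _ hz hw =>
    obtain ⟨n, hn⟩ := hz
    obtain ⟨m, hm⟩ := hw
    refine ⟨n + m, ?_⟩
    have : a ^ (n + m) * (z * w) = (a ^ n * z) * (a ^ m * w) := by ring
    rw [this]
    exact R.mul_mem hn hm

theorem exists_extension_of_pow_mul_mem {R S : Subring ℂ} (hRS : R ≤ S) (a : R)
    (h : ∀ z ∈ S, ∃ n : ℕ, (a : ℂ) ^ n * z ∈ R) {k : Type*} [Field k] (φ : R →+* k)
    (hφ : φ a ≠ 0) : ∃ ψ : S →+* k, ψ.comp (Subring.inclusion hRS) = φ := by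
  choose n hn using fun z : S ↦ h z z.2
  let g : S → k := fun z ↦ φ ⟨_, hn z⟩ / φ a ^ n z
  have key : ∀ (z : S) (m : ℕ) (r : R), (r : ℂ) = (a : ℂ) ^ m * z → φ r = g z * φ a ^ m := by
    intro z m r hr
    have h1 : r * a ^ n z = ⟨_, hn z⟩ * a ^ m := by
      apply Subtype.ext
      push_cast
      rw [hr]
      ring
    have h2 := congrArg φ h1
    rw [map_mul, map_mul, map_pow, map_pow] at h2
    rw [div_mul_eq_mul_div, eq_div_iff (pow_ne_zero _ hφ), h2]
  have hg : ∀ z : S, φ ⟨_, hn z⟩ = g z * φ a ^ n z := fun z ↦ key z (n z) _ rfl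
  have hR : ∀ r : R, g (Subring.inclusion hRS r) = φ r := by
    intro r
    have := key (Subring.inclusion hRS r) 0 r (by simp)
    rw [this, pow_zero, mul_one]
  refine ⟨{ toFun := g, map_one' := ?_, map_zero' := ?_, map_mul' := ?_, map_add' := ?_ }, ?_⟩
  · have := hR 1
    rwa [map_one, map_one] at this
  · intro z w
    have := key (z * w) (n z + n w) (⟨_, hn z⟩ * ⟨_, hn w⟩) (by push_cast; ring)
    rw [map_mul, hg, hg, pow_add] at this
    have h0 : φ a ^ n z * φ a ^ n w ≠ 0 := mul_ne_zero (pow_ne_zero _ hφ) (pow_ne_zero _ hφ)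
    apply mul_right_cancel₀ h0
    rw [← this]
    ring
  · have := hR 0
    rwa [map_zero, map_zero] at this
  · intro z w
    have := key (z + w) (n z + n w) (⟨_, hn z⟩ * a ^ n w + ⟨_, hn w⟩ * a ^ n z)
      (by push_cast; ring)
    rw [map_add, map_mul, map_mul, map_pow, map_pow, hg, hg, pow_add] at this
    have h0 : φ a ^ n z * φ a ^ n w ≠ 0 := mul_ne_zero (pow_ne_zero _ hφ) (pow_ne_zero _ hφ)
    apply mul_right_cancel₀ h0
    rw [← this]
    ring
  · ext r
    exact hR r

theorem IsFGSubring.sup {R S : Subring ℂ} (hR : IsFGSubring R) (hS : IsFGSubring S) :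
    IsFGSubring (R ⊔ S) := by
  classical
  obtain ⟨s, rfl⟩ := hR
  obtain ⟨s', rfl⟩ := hS
  exact ⟨s ∪ s', by rw [Finset.coe_union, Subring.closure_union]⟩

theorem ringHom_ext_of_closure_eq {s : Set ℂ} {R : Subring ℂ} (hs : Subring.closure s = R)
    {k : Type*} [Ring k] {φ ψ : R →+* k} (h : ∀ z : R, (z : ℂ) ∈ s → φ z = ψ z) : φ = ψ := by
  subst hs
  refine RingHom.ext fun z ↦ ?_
  obtain ⟨z, hz⟩ := z
  induction hz using Subring.closure_induction with
  | mem z hz => exact h ⟨z, Subring.subset_closure hz⟩ hz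
  | zero => exact (map_zero φ).trans (map_zero ψ).symm
  | one => exact (map_one φ).trans (map_one ψ).symm
  | add z w hz' hw' hz hw =>
    have : (⟨z + w, add_mem hz' hw'⟩ : Subring.closure s) = ⟨z, hz'⟩ + ⟨w, hw'⟩ := rfl
    rw [this, map_add, map_add, hz, hw]
  | neg z hz' hz =>
    have : (⟨-z, neg_mem hz'⟩ : Subring.closure s) = -⟨z, hz'⟩ := rfl
    rw [this, map_neg, map_neg, hz]
  | mul z w hz' hw' hz hw =>
    have : (⟨z * w, mul_mem hz' hw'⟩ : Subring.closure s) = ⟨z, hz'⟩ * ⟨w, hw'⟩ := rfl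
    rw [this, map_mul, map_mul, hz, hw]

theorem IsFGSubring.finite_ringHom {R : Subring ℂ} (hR : IsFGSubring R) {k : Type*} [Ring k]
    [Finite k] : Finite (R →+* k) := by
  obtain ⟨s, hs⟩ := hR
  refine Finite.of_injective
    (fun (φ : R →+* k) (z : s) ↦ φ ⟨z, hs ▸ Subring.subset_closure z.2⟩) fun φ ψ h ↦ ?_
  exact ringHom_ext_of_closure_eq hs fun z hz ↦ congrFun h ⟨z, hz⟩

theorem adjoin_sup_eq {R S : Subring ℂ} {K : IntermediateField ℚ ℂ}
    (hR : IntermediateField.adjoin ℚ (R : Set ℂ) = K)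
    (hS : IntermediateField.adjoin ℚ (S : Set ℂ) = K) :
    IntermediateField.adjoin ℚ ((R ⊔ S : Subring ℂ) : Set ℂ) = K := by
  refine le_antisymm (IntermediateField.adjoin_le_iff.2 ?_) ?_
  · have : R ⊔ S ≤ K.toSubalgebra.toSubring := by
      refine sup_le (fun z hz ↦ ?_) fun z hz ↦ ?_
      · exact hR ▸ IntermediateField.subset_adjoin ℚ _ hz
      · exact hS ▸ IntermediateField.subset_adjoin ℚ _ hz
    exact this
  · rw [← hR]
    exact IntermediateField.adjoin.mono ℚ _ _ fun z hz ↦ (le_sup_left : R ≤ R ⊔ S) hz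

theorem exists_int_mul_mem (R : Subring ℂ) {z : ℂ} (hz : z ∈ Algebra.adjoin ℚ (R : Set ℂ)) :
    ∃ m : ℤ, m ≠ 0 ∧ (m : ℂ) * z ∈ R := by
  induction hz using Algebra.adjoin_induction with
  | mem z hz => exact ⟨1, one_ne_zero, by simpa using hz⟩
  | algebraMap q =>
    refine ⟨q.den, by exact_mod_cast q.den_ne_zero, ?_⟩
    have : ((q.den : ℤ) : ℂ) * algebraMap ℚ ℂ q = (q.num : ℂ) := by
      rw [eq_ratCast]
      have := Rat.den_mul_eq_num q
      exact_mod_cast congrArg (fun r : ℚ ↦ (r : ℂ)) this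
    rw [this]
    exact intCast_mem R _
  | add z w _ _ hz hw =>
    obtain ⟨n, hn0, hn⟩ := hz
    obtain ⟨m, hm0, hm⟩ := hw
    refine ⟨n * m, mul_ne_zero hn0 hm0, ?_⟩
    have : ((n * m : ℤ) : ℂ) * (z + w) = (m : ℂ) * (n * z) + (n : ℂ) * (m * w) := by
      push_cast; ring
    rw [this]
    exact R.add_mem (R.mul_mem (intCast_mem R _) hn) (R.mul_mem (intCast_mem R _) hm)
  | mul z w _ _ hz hw =>
    obtain ⟨n, hn0, hn⟩ := hz
    obtain ⟨m, hm0, hm⟩ := hw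
    refine ⟨n * m, mul_ne_zero hn0 hm0, ?_⟩
    have : ((n * m : ℤ) : ℂ) * (z * w) = (n * z) * (m * w) := by
      push_cast; ring
    rw [this]
    exact R.mul_mem hn hm

theorem coeff_zero_minpoly_ne_zero {A B : Type*} [CommRing A] [Nontrivial A] [CommRing B]
    [IsDomain B] [Algebra A B] {x : B} (hx : IsIntegral A x) (h : x ≠ 0) :
    (minpoly A x).coeff 0 ≠ 0 := by
  intro h0
  obtain ⟨D, hD⟩ : ∃ D : A[X], D * X = minpoly A x := ⟨divX (minpoly A x), by
    simpa [h0] using divX_mul_X_add (minpoly A x)⟩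
  have hmon : D.Monic := monic_X.of_mul_monic_right (hD ▸ minpoly.monic hx)
  have hroot : aeval x D = 0 := by
    have := minpoly.aeval A x
    rw [← hD, map_mul, aeval_X] at this
    exact (mul_eq_zero.1 this).resolve_right h
  have hdeg := minpoly.min A x hmon hroot
  rw [← hD, monic_X.degree_mul, degree_X, degree_eq_natDegree hmon.ne_zero] at hdeg
  norm_cast at hdeg
  omega

theorem exists_integral_coordinates {R : Subring ℂ} (hR : IsFGSubring R) :
    ∃ (s : ℕ) (w : Fin s → R), AlgebraicIndependent ℚ (fun i : Fin s ↦ (w i : ℂ)) ∧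
      ∀ r : R, ∃ N : ℤ, N ≠ 0 ∧ ∃ P : (MvPolynomial (Fin s) ℤ)[X], P.Monic ∧
        eval₂ (MvPolynomial.eval₂Hom (Int.castRingHom R) w) ((N : R) * r) P = 0 ∧
        (r ≠ 0 → P.coeff 0 ≠ 0) := by
  have hRg := hR
  obtain ⟨S, hS⟩ := hRg
  have hSR : Algebra.adjoin ℚ (S : Set ℂ) = Algebra.adjoin ℚ (R : Set ℂ) := by
    apply le_antisymm
    · exact Algebra.adjoin_mono fun z hz ↦ hS ▸ Subring.subset_closure hz
    · refine Algebra.adjoin_le fun z hz ↦ ?_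
      have : Subring.closure (S : Set ℂ) ≤ (Algebra.adjoin ℚ (S : Set ℂ)).toSubring :=
        Subring.closure_le.2 Algebra.subset_adjoin
      exact this (hS ▸ hz)
  set T := Algebra.adjoin ℚ (R : Set ℂ) with hT
  have : Algebra.FiniteType ℚ T :=
    (Subalgebra.fg_iff_finiteType T).1 (hSR ▸ Subalgebra.fg_adjoin_finset S)
  obtain ⟨s, g, hg, hint⟩ := exists_integral_inj_algHom_of_fg ℚ T
  choose m hm0 hm using fun i : Fin s ↦ exists_int_mul_mem R (g (MvPolynomial.X i)).2
  let w : Fin s → R := fun i ↦ ⟨_, hm i⟩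
  let ζ : Fin s → ℂ := fun i ↦ g (MvPolynomial.X i)
  have hζ : MvPolynomial.aeval ζ = T.val.comp g := by
    ext i
    simp [ζ]
  have hζind : AlgebraicIndependent ℚ ζ := by
    rw [AlgebraicIndependent, hζ]
    exact Subtype.val_injective.comp hg
  let W : Fin s → ℂ := fun i ↦ w i
  let σ : MvPolynomial (Fin s) ℚ →ₐ[ℚ] MvPolynomial (Fin s) ℚ :=
    MvPolynomial.aeval fun i ↦ MvPolynomial.C ((m i : ℚ)⁻¹) * MvPolynomial.X i
  let τ : MvPolynomial (Fin s) ℚ →ₐ[ℚ] MvPolynomial (Fin s) ℚ :=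
    MvPolynomial.aeval fun i ↦ MvPolynomial.C (m i : ℚ) * MvPolynomial.X i
  have hσ : (MvPolynomial.aeval W).comp σ = MvPolynomial.aeval ζ := by
    ext i
    have : (m i : ℂ) ≠ 0 := by exact_mod_cast hm0 i
    simp [σ, W, w, ζ, this]
  have hτ : (MvPolynomial.aeval ζ).comp τ = MvPolynomial.aeval W := by
    ext i
    simp [τ, W, w, ζ]
  have hστ : σ.comp τ = AlgHom.id ℚ _ := by
    ext1 i
    have h0 : (m i : ℚ) ≠ 0 := by exact_mod_cast hm0 i
    simp only [σ, τ, AlgHom.comp_apply, MvPolynomial.aeval_X, map_mul, MvPolynomial.aeval_C,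
      MvPolynomial.algebraMap_eq, AlgHom.id_apply]
    rw [← mul_assoc, ← map_mul, mul_inv_cancel₀ h0, map_one, one_mul]
  have hτinj : Function.Injective τ := fun P Q h ↦ by
    have := congrArg σ h
    rwa [← AlgHom.comp_apply, ← AlgHom.comp_apply, hστ] at this
  refine ⟨s, w, ?_, fun r ↦ ?_⟩
  · change Function.Injective (MvPolynomial.aeval W)
    rw [← hτ]
    exact (show Function.Injective (MvPolynomial.aeval ζ) from hζind).comp hτinj
  · let _ : Algebra (MvPolynomial (Fin s) ℚ) ℂ := (MvPolynomial.aeval W).toRingHom.toAlgebra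
    let _ : Algebra (MvPolynomial (Fin s) ℤ) ℂ :=
      (MvPolynomial.eval₂Hom (Int.castRingHom ℂ) W).toAlgebra
    let _ : Algebra (MvPolynomial (Fin s) ℤ) (MvPolynomial (Fin s) ℚ) :=
      MvPolynomial.algebraMvPolynomial
    have : IsScalarTower (MvPolynomial (Fin s) ℤ) (MvPolynomial (Fin s) ℚ) ℂ := by
      refine IsScalarTower.of_algebraMap_eq' ?_
      apply MvPolynomial.ringHom_ext
      · intro n
        simp
      · intro i
        have h1 : algebraMap (MvPolynomial (Fin s) ℤ) (MvPolynomial (Fin s) ℚ) =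
          MvPolynomial.map (Int.castRingHom ℚ) := rfl
        rw [h1]
        simp [RingHom.algebraMap_toAlgebra]
    have hrint : IsIntegral (MvPolynomial (Fin s) ℚ) (r : ℂ) := by
      obtain ⟨P, hP, hPr⟩ := hint ⟨r, Algebra.subset_adjoin r.2⟩
      refine ⟨P.map σ.toRingHom, hP.map _, ?_⟩
      rw [eval₂_map]
      have h1 : (algebraMap (MvPolynomial (Fin s) ℚ) ℂ).comp σ.toRingHom =
          T.val.toRingHom.comp g.toRingHom := by
        have := hσ.trans hζ
        exact congrArg AlgHom.toRingHom this
      rw [h1]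
      have h2 := congrArg T.val.toRingHom hPr
      rw [hom_eval₂, map_zero] at h2
      exact h2
    obtain ⟨⟨M, hM⟩, hMr⟩ := hrint.exists_multiple_integral_of_isLocalization
      ((nonZeroDivisors ℤ).map (MvPolynomial.C (σ := Fin s))) (r : ℂ)
    obtain ⟨N, hN, rfl⟩ := hM
    have hN0 : N ≠ 0 := nonZeroDivisors.ne_zero hN
    have hNr : (⟨MvPolynomial.C N, Submonoid.mem_map_of_mem _ hN⟩ :
        (nonZeroDivisors ℤ).map (MvPolynomial.C (σ := Fin s))) • (r : ℂ) = (N : ℂ) * r := by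
      rw [Submonoid.mk_smul, Algebra.smul_def, RingHom.algebraMap_toAlgebra]
      simp
    have hMr' : IsIntegral (MvPolynomial (Fin s) ℤ) ((N : ℂ) * r) := by
      rw [← hNr]
      exact hMr
    refine ⟨N, hN0, minpoly (MvPolynomial (Fin s) ℤ) ((N : ℂ) * r), minpoly.monic hMr', ?_, ?_⟩
    · apply Subtype.val_injective
      have h1 := minpoly.aeval (MvPolynomial (Fin s) ℤ) ((N : ℂ) * r)
      have h2 : algebraMap (MvPolynomial (Fin s) ℤ) ℂ =
          R.subtype.comp (MvPolynomial.eval₂Hom (Int.castRingHom R) w) := by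
        apply MvPolynomial.ringHom_ext
        · intro n
          simp
        · intro i
          simp [RingHom.algebraMap_toAlgebra, W]
      rw [aeval_def, h2] at h1
      have h3 : (N : ℂ) * r = R.subtype ((N : R) * r) := by simp
      change R.subtype _ = R.subtype 0
      rw [hom_eval₂, map_zero, ← h3]
      exact h1
    · intro hr
      refine coeff_zero_minpoly_ne_zero hMr' (mul_ne_zero (by exact_mod_cast hN0) ?_)
      exact fun h ↦ hr (Subtype.ext h)

theorem ZMod.intCast_ne_zero_of_natAbs_lt {p : ℕ} [Fact p.Prime] {c : ℤ} (hc : c ≠ 0)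
    (h : c.natAbs < p) : (c : ZMod p) ≠ 0 := by
  intro h0
  have h1 := (ZMod.intCast_zmod_eq_zero_iff_dvd c p).1 h0
  have h2 := Nat.le_of_dvd (Int.natAbs_pos.2 hc) (Int.natCast_dvd.1 h1)
  omega

theorem card_zeros_mul_le {p s : ℕ} [Fact p.Prime] {h : MvPolynomial (Fin s) (ZMod p)}
    (hh : h ≠ 0) :
    (Finset.univ.filter fun c : Fin s → ZMod p ↦ MvPolynomial.eval c h = 0).card * p ≤
      h.totalDegree * p ^ s := by
  have hp : 0 < (p : ℚ≥0) := by exact_mod_cast (Fact.out : p.Prime).pos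
  have := MvPolynomial.schwartz_zippel_totalDegree hh (Finset.univ : Finset (ZMod p))
  rw [Fintype.piFinset_univ, Finset.card_univ, ZMod.card, div_le_div_iff₀ (pow_pos hp s) hp] at this
  exact_mod_cast this

theorem exists_vanishing_bound {R : Subring ℂ} (hR : IsFGSubring R) {t : ℕ}
    (ht : ∀ (s : ℕ) (z : Fin s → ℂ), (∀ i, z i ∈ R) → AlgebraicIndependent ℚ z → s ≤ t)
    {a : R} (ha : a ≠ 0) :
    ∃ C : ℕ, ∀ (p : ℕ) [Fact p.Prime], C < p →
      Nat.card {φ : R →+* ZMod p // φ a = 0} * p ≤ C * p ^ t := by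
  classical
  obtain ⟨s, w, hw, h⟩ := exists_integral_coordinates hR
  have hst : s ≤ t := ht s _ (fun i ↦ (w i).2) hw
  choose N hN0 P hP hPr hP0 using h
  obtain ⟨S, hS⟩ := id hR
  let r : S → R := fun z ↦ ⟨z, hS ▸ Subring.subset_closure z.2⟩
  set D := ∏ z : S, (P (r z)).natDegree with hD
  set h := (P a).coeff 0 with hh
  have hne : h ≠ 0 := hP0 a ha
  obtain ⟨m, hm⟩ := MvPolynomial.ne_zero_iff.1 hne
  refine ⟨(h.coeff m).natAbs + ∑ z : S, (N (r z)).natAbs + D * h.totalDegree,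
    fun p _ hp ↦ ?_⟩
  have hp0 : 0 < p := (Fact.out : p.Prime).pos
  have : Finite (R →+* ZMod p) := hR.finite_ringHom
  have : Fintype (R →+* ZMod p) := Fintype.ofFinite _
  have hNz : ∀ z : S, ((N (r z) : ℤ) : ZMod p) ≠ 0 := fun z ↦ by
    refine ZMod.intCast_ne_zero_of_natAbs_lt (hN0 _) ?_
    have := Finset.single_le_sum (f := fun z : S ↦ (N (r z)).natAbs) (fun _ _ ↦ Nat.zero_le _)
      (Finset.mem_univ z)
    omega
  set h' := MvPolynomial.map (Int.castRingHom (ZMod p)) h with hh'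
  have hne' : h' ≠ 0 := by
    refine MvPolynomial.ne_zero_iff.2 ⟨m, ?_⟩
    rw [hh', MvPolynomial.coeff_map]
    exact ZMod.intCast_ne_zero_of_natAbs_lt hm (by omega)
  have hdeg : h'.totalDegree ≤ h.totalDegree :=
    Finset.sup_mono (MvPolynomial.support_map_subset _ _)
  let ev : (Fin s → ZMod p) → MvPolynomial (Fin s) ℤ →+* ZMod p := fun c ↦
    (MvPolynomial.eval c).comp (MvPolynomial.map (Int.castRingHom (ZMod p)))
  have hev : ∀ φ : R →+* ZMod p, ∀ q : R,
      eval₂ (ev fun i : Fin s ↦ φ (w i)) ((N q : ZMod p) * φ q) (P q) = 0 := by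
    intro φ q
    have h1 := congrArg φ (hPr q)
    rw [hom_eval₂, map_zero, map_mul, map_intCast] at h1
    have h2 : φ.comp (MvPolynomial.eval₂Hom (Int.castRingHom R) w) =
        ev fun i : Fin s ↦ φ (w i) := by
      apply MvPolynomial.ringHom_ext
      · intro n
        simp [ev]
      · intro i
        simp [ev]
    rwa [h2] at h1
  set A : Finset (R →+* ZMod p) := Finset.univ.filter fun φ ↦ φ a = 0 with hA
  set Z : Finset (Fin s → ZMod p) := Finset.univ.filter fun c ↦ MvPolynomial.eval c h' = 0 with hZ
  have hcard : Nat.card {φ : R →+* ZMod p // φ a = 0} = A.card := by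
    rw [Nat.card_eq_fintype_card, Fintype.card_subtype]
  have hmaps : ∀ φ ∈ A, (fun i : Fin s ↦ φ (w i)) ∈ Z := by
    intro φ hφ
    have hφa : φ a = 0 := (Finset.mem_filter.1 hφ).2
    have h1 := hev φ a
    rw [hφa, mul_zero, eval₂_at_zero] at h1
    exact Finset.mem_filter.2 ⟨Finset.mem_univ _, h1⟩
  have hfib : ∀ c ∈ Z, (A.filter fun φ ↦ (fun i : Fin s ↦ φ (w i)) = c).card ≤ D := by
    intro c _
    have hle : (A.filter fun φ ↦ (fun i : Fin s ↦ φ (w i)) = c).card ≤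
        (Fintype.piFinset fun z : S ↦ ((P (r z)).map (ev c)).roots.toFinset).card := by
      refine Finset.card_le_card_of_injOn (fun φ z ↦ (N (r z) : ZMod p) * φ (r z)) ?_ ?_
      · intro φ hφ
        have hc : (fun i : Fin s ↦ φ (w i)) = c := (Finset.mem_filter.1 hφ).2
        refine Fintype.mem_piFinset.2 fun z ↦ ?_
        rw [Multiset.mem_toFinset, mem_roots ((hP _).map _).ne_zero, IsRoot.def, eval_map, ← hc]
        exact hev φ _
      · intro φ _ ψ _ hφψ
        refine ringHom_ext_of_closure_eq hS fun z hz ↦ ?_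
        exact mul_left_cancel₀ (hNz ⟨z, hz⟩) (congrFun hφψ ⟨z, hz⟩)
    refine hle.trans ?_
    rw [Fintype.card_piFinset]
    refine Finset.prod_le_prod' fun z _ ↦ (Multiset.toFinset_card_le _).trans ?_
    exact (card_roots' _).trans natDegree_map_le
  have hAZ : A.card ≤ D * Z.card :=
    Finset.card_le_mul_card_image_of_maps_to hmaps D hfib
  have hZp := card_zeros_mul_le hne'
  rw [hcard]
  calc A.card * p ≤ D * Z.card * p := Nat.mul_le_mul_right _ hAZ
    _ = D * (Z.card * p) := mul_assoc _ _ _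
    _ ≤ D * (h'.totalDegree * p ^ s) := Nat.mul_le_mul_left _ hZp
    _ ≤ D * (h.totalDegree * p ^ t) :=
      Nat.mul_le_mul_left _ (Nat.mul_le_mul hdeg (Nat.pow_le_pow_right hp0 hst))
    _ = D * h.totalDegree * p ^ t := (mul_assoc _ _ _).symm
    _ ≤ _ := Nat.mul_le_mul_right _ (Nat.le_add_left _ _)

/-- For the primes satisfying `Q`, the ring `R` has `n * p ^ t + O(p ^ (t - 1 / 2))` homomorphisms
to `𝔽_p`. -/
def HasHomCount (Q : ℕ → Prop) (n t : ℕ) (R : Subring ℂ) : Prop :=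
  ∃ C : ℕ, ∀ (p : ℕ) [Fact p.Prime], C < p → Q p →
    |(Nat.card (R →+* ZMod p) : ℝ) - n * (p : ℝ) ^ t| ≤ C * ((p : ℝ) ^ t / √p)

theorem card_ringHom_eq_add {R : Subring ℂ} (hR : IsFGSubring R) (a : R) (p : ℕ) [NeZero p] :
    Nat.card (R →+* ZMod p) =
      Nat.card {φ : R →+* ZMod p // φ a = 0} + Nat.card {φ : R →+* ZMod p // ¬ φ a = 0} := by
  classical
  have : Finite (R →+* ZMod p) := hR.finite_ringHom
  rw [← Nat.card_sum]
  exact (Nat.card_congr (Equiv.sumCompl fun φ : R →+* ZMod p ↦ φ a = 0)).symm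

theorem card_ringHom_ne_zero_eq {R S : Subring ℂ} (hRS : R ≤ S) (a : R)
    (h : ∀ z ∈ S, ∃ n : ℕ, (a : ℂ) ^ n * z ∈ R) (p : ℕ) [Fact p.Prime] :
    Nat.card {φ : S →+* ZMod p // ¬ φ (Subring.inclusion hRS a) = 0} =
      Nat.card {φ : R →+* ZMod p // ¬ φ a = 0} := by
  refine Nat.card_congr (Equiv.ofBijective
    (fun φ ↦ ⟨φ.1.comp (Subring.inclusion hRS), φ.2⟩) ⟨fun φ ψ hφψ ↦ ?_, fun φ ↦ ?_⟩)
  · have hc : φ.1.comp (Subring.inclusion hRS) = ψ.1.comp (Subring.inclusion hRS) :=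
      congrArg Subtype.val hφψ
    refine Subtype.ext (RingHom.ext fun z ↦ ?_)
    obtain ⟨n, hn⟩ := h z z.2
    have h1 : Subring.inclusion hRS a ^ n * z = Subring.inclusion hRS ⟨_, hn⟩ := Subtype.ext rfl
    have h2 := congrArg φ.1 h1
    have h3 := congrArg ψ.1 h1
    have h4 := RingHom.congr_fun hc ⟨_, hn⟩
    have h5 : φ.1 (Subring.inclusion hRS a) = ψ.1 (Subring.inclusion hRS a) :=
      RingHom.congr_fun hc a
    rw [map_mul, map_pow] at h2 h3
    have h6 : φ.1 (Subring.inclusion hRS ⟨_, hn⟩) = ψ.1 (Subring.inclusion hRS ⟨_, hn⟩) := h4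
    rw [← h2, ← h3, h5] at h6
    exact mul_left_cancel₀ (pow_ne_zero _ ψ.2) h6
  · obtain ⟨ψ, hψ⟩ := exists_extension_of_pow_mul_mem hRS a h φ.1 φ.2
    refine ⟨⟨ψ, ?_⟩, Subtype.ext hψ⟩
    have := RingHom.congr_fun hψ a
    exact fun h0 ↦ φ.2 (this ▸ h0)

theorem exists_card_ringHom_sub_bound {R S : Subring ℂ} (hRS : R ≤ S) (hR : IsFGSubring R)
    (hS : IsFGSubring S) {K : IntermediateField ℚ ℂ}
    (hRK : IntermediateField.adjoin ℚ (R : Set ℂ) = K)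
    (hSK : IntermediateField.adjoin ℚ (S : Set ℂ) = K) {t : ℕ}
    (ht : ∀ (s : ℕ) (z : Fin s → ℂ), (∀ i, z i ∈ K) → AlgebraicIndependent ℚ z → s ≤ t) :
    ∃ C : ℕ, ∀ (p : ℕ) [Fact p.Prime], C < p →
      |(Nat.card (R →+* ZMod p) : ℝ) - Nat.card (S →+* ZMod p)| ≤ C * ((p : ℝ) ^ t / √p) := by
  have hRK' : ∀ z ∈ R, z ∈ K := fun z hz ↦ hRK ▸ IntermediateField.subset_adjoin ℚ _ hz
  have hSK' : ∀ z ∈ S, z ∈ K := fun z hz ↦ hSK ▸ IntermediateField.subset_adjoin ℚ _ hz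
  obtain ⟨a, haR, ha0, ha⟩ := exists_pow_mul_mem R hS fun z hz ↦ hRK.symm ▸ hSK' z hz
  let a' : R := ⟨a, haR⟩
  have ha' : a' ≠ 0 := fun h ↦ ha0 (congrArg Subtype.val h)
  have ha'' : Subring.inclusion hRS a' ≠ 0 := fun h ↦ ha0 (congrArg Subtype.val h)
  obtain ⟨C₁, hC₁⟩ := exists_vanishing_bound hR
    (fun s z hz hi ↦ ht s z (fun i ↦ hRK' _ (hz i)) hi) ha'
  obtain ⟨C₂, hC₂⟩ := exists_vanishing_bound hS
    (fun s z hz hi ↦ ht s z (fun i ↦ hSK' _ (hz i)) hi) ha''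
  refine ⟨C₁ + C₂, fun p _ hp ↦ ?_⟩
  have h1 := hC₁ p (by omega)
  have h2 := hC₂ p (by omega)
  have hp1 : (1 : ℝ) ≤ p := by exact_mod_cast (Fact.out : p.Prime).one_le
  have hp0 : (0 : ℝ) < p := by linarith
  rw [card_ringHom_eq_add hR a' p, card_ringHom_eq_add hS (Subring.inclusion hRS a') p,
    card_ringHom_ne_zero_eq hRS a' ha p]
  set X := Nat.card {φ : R →+* ZMod p // φ a' = 0}
  set Y := Nat.card {φ : S →+* ZMod p // φ (Subring.inclusion hRS a') = 0}
  have h1' : (X : ℝ) ≤ C₁ * ((p : ℝ) ^ t / p) := by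
    rw [mul_div_assoc', le_div_iff₀ hp0]
    exact_mod_cast h1
  have h2' : (Y : ℝ) ≤ C₂ * ((p : ℝ) ^ t / p) := by
    rw [mul_div_assoc', le_div_iff₀ hp0]
    exact_mod_cast h2
  have hX : (0 : ℝ) ≤ X := Nat.cast_nonneg _
  have hY : (0 : ℝ) ≤ Y := Nat.cast_nonneg _
  have hsq : (p : ℝ) ^ t / p ≤ (p : ℝ) ^ t / √p := by
    refine div_le_div_of_nonneg_left (by positivity) (Real.sqrt_pos.2 hp0) ?_
    exact Real.sqrt_le_self_iff.2 (Or.inr hp1)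
  calc |((X + _ : ℕ) : ℝ) - ((Y + _ : ℕ) : ℝ)| = |(X : ℝ) - Y| := by push_cast; ring_nf
    _ ≤ X + Y := abs_le.2 ⟨by linarith, by linarith⟩
    _ ≤ (C₁ + C₂) * ((p : ℝ) ^ t / p) := by linarith
    _ ≤ ((C₁ + C₂ : ℕ) : ℝ) * ((p : ℝ) ^ t / √p) := by
      push_cast
      exact mul_le_mul_of_nonneg_left hsq (by positivity)

theorem HasHomCount.of_sub_bound {Q : ℕ → Prop} {n t : ℕ} {R S : Subring ℂ}
    (hR : HasHomCount Q n t R)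
    (h : ∃ C : ℕ, ∀ (p : ℕ) [Fact p.Prime], C < p →
      |(Nat.card (S →+* ZMod p) : ℝ) - Nat.card (R →+* ZMod p)| ≤ C * ((p : ℝ) ^ t / √p)) :
    HasHomCount Q n t S := by
  obtain ⟨C₁, hC₁⟩ := hR
  obtain ⟨C₂, hC₂⟩ := h
  refine ⟨C₁ + C₂, fun p _ hp hQ ↦ ?_⟩
  have h1 := hC₁ p (by omega) hQ
  have h2 := hC₂ p (by omega)
  have h3 := abs_sub_le (Nat.card (S →+* ZMod p) : ℝ) (Nat.card (R →+* ZMod p)) (n * (p : ℝ) ^ t)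
  push_cast
  rw [add_mul]
  linarith

theorem HasHomCount.of_adjoin_eq {Q : ℕ → Prop} {n t : ℕ} {R S : Subring ℂ}
    (h : HasHomCount Q n t R) (hR : IsFGSubring R) (hS : IsFGSubring S)
    {K : IntermediateField ℚ ℂ} (hRK : IntermediateField.adjoin ℚ (R : Set ℂ) = K)
    (hSK : IntermediateField.adjoin ℚ (S : Set ℂ) = K)
    (ht : ∀ (s : ℕ) (z : Fin s → ℂ), (∀ i, z i ∈ K) → AlgebraicIndependent ℚ z → s ≤ t) :
    HasHomCount Q n t S := by
  have hsup : HasHomCount Q n t (R ⊔ S) := by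
    refine h.of_sub_bound ?_
    simp only [abs_sub_comm (Nat.card ((R ⊔ S : Subring ℂ) →+* ZMod _) : ℝ)]
    exact exists_card_ringHom_sub_bound le_sup_left hR (hR.sup hS) hRK (adjoin_sup_eq hRK hSK) ht
  exact hsup.of_sub_bound <|
    exists_card_ringHom_sub_bound le_sup_right hS (hR.sup hS) hSK (adjoin_sup_eq hRK hSK) ht

/-- The subring `A[x, y]` of `ℂ`. -/
noncomputable def Subring.adjoinPair (A : Subring ℂ) (x y : ℂ) : Subring ℂ :=
  RingHom.range (R := A[X][X]) (S := ℂ) (eval₂RingHom (eval₂RingHom A.subtype x) y)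

section AdjoinPair

variable (A : Subring ℂ) (x y : ℂ)

theorem le_adjoinPair : A ≤ A.adjoinPair x y := fun a ha ↦ ⟨C (C ⟨a, ha⟩), by simp⟩

theorem left_mem_adjoinPair : x ∈ A.adjoinPair x y := ⟨C X, by simp⟩

theorem right_mem_adjoinPair : y ∈ A.adjoinPair x y := ⟨X, by simp⟩

variable {A x y}

theorem adjoinPair_le {T : Subring ℂ} (hA : A ≤ T) (hx : x ∈ T) (hy : y ∈ T) :
    A.adjoinPair x y ≤ T := by
  rintro _ ⟨g, rfl⟩
  rw [coe_eval₂RingHom, eval₂_eq_sum]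
  refine T.sum_mem fun i _ ↦ T.mul_mem ?_ (T.pow_mem hy _)
  rw [coe_eval₂RingHom, eval₂_eq_sum]
  exact T.sum_mem fun j _ ↦ T.mul_mem (hA (Subtype.property _)) (T.pow_mem hx _)

theorem IsFGSubring.adjoinPair (hA : IsFGSubring A) : IsFGSubring (A.adjoinPair x y) := by
  classical
  obtain ⟨S, hS⟩ := hA
  refine ⟨S ∪ {x, y}, le_antisymm (Subring.closure_le.2 ?_) (adjoinPair_le ?_ ?_ ?_)⟩
  · intro z hz
    simp only [Finset.coe_union, Finset.coe_insert, Finset.coe_singleton, Set.mem_union,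
      Set.mem_insert_iff, Set.mem_singleton_iff] at hz
    rcases hz with hz | rfl | rfl
    · exact le_adjoinPair A x y (hS ▸ Subring.subset_closure hz)
    · exact left_mem_adjoinPair A _ _
    · exact right_mem_adjoinPair A _ _
  · rw [← hS]
    exact Subring.closure_mono (by rw [Finset.coe_union]; exact Set.subset_union_left)
  · exact Subring.subset_closure (by simp)
  · exact Subring.subset_closure (by simp)

theorem exists_comp_eq_of_ker_le {R S T : Type*} [CommRing R] [CommRing S] [CommRing T]
    (π : R →+* S) (hπ : Function.Surjective π) (χ : R →+* T)
    (h : ∀ r, π r = 0 → χ r = 0) : ∃ ψ : S →+* T, ∀ r, ψ (π r) = χ r :=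
  ⟨π.liftOfRightInverse _ (Function.rightInverse_surjInv hπ) ⟨χ, h⟩, fun r ↦
    π.liftOfRightInverse_comp_apply _ (Function.rightInverse_surjInv hπ) ⟨χ, h⟩ r⟩

theorem card_ringHom_adjoinPair {f : A[X][X]} (hf : f.Monic)
    (hroot : eval₂ (eval₂RingHom A.subtype x) y f = 0)
    (hmin : ∀ g : A[X][X], g.natDegree < f.natDegree →
      eval₂ (eval₂RingHom A.subtype x) y g = 0 → g = 0) (k : Type) [CommRing k] :
    Nat.card (A.adjoinPair x y →+* k) =
      Nat.card (Σ φ : A →+* k, {P : k × k // (f.map (mapRingHom φ)).evalEval P.1 P.2 = 0}) := by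
  let π : A[X][X] →+* A.adjoinPair x y :=
    RingHom.rangeRestrict (R := A[X][X]) (S := ℂ) (eval₂RingHom (eval₂RingHom A.subtype x) y)
  have hπ : Function.Surjective π := RingHom.rangeRestrict_surjective _
  have hπval : ∀ g, (π g : ℂ) = eval₂ (eval₂RingHom A.subtype x) y g := fun g ↦ rfl
  have hker : ∀ g, π g = 0 → f ∣ g := by
    intro g hg
    by_cases hf1 : f = 1
    · exact hf1 ▸ one_dvd g
    · rw [← modByMonic_eq_zero_iff_dvd hf]
      refine hmin _ (natDegree_modByMonic_lt _ hf hf1) ?_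
      have h1 : eval₂ (eval₂RingHom A.subtype x) y g = 0 := by
        rw [← hπval, hg]
        rfl
      rwa [← modByMonic_add_div g f, eval₂_add, eval₂_mul, hroot, zero_mul, add_zero] at h1
  refine Nat.card_congr (Equiv.trans (Equiv.ofBijective (β := {q : (A →+* k) × (k × k) //
      (f.map (mapRingHom q.1)).evalEval q.2.1 q.2.2 = 0})
    (fun ψ ↦ ⟨((ψ.comp π).comp (C.comp C), ψ (π (C X)), ψ (π X)), ?_⟩) ⟨?_, ?_⟩)
    (Equiv.subtypeProdEquivSigmaSubtype fun (φ : A →+* k) (P : k × k) ↦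
      (f.map (mapRingHom φ)).evalEval P.1 P.2 = 0))
  · dsimp only
    rw [← eval₂_eval₂RingHom_apply]
    have h1 : eval₂RingHom (eval₂RingHom ((ψ.comp π).comp (C.comp C)) (ψ (π (C X)))) (ψ (π X)) =
        ψ.comp π := by
      ext <;> simp
    have h2 : π f = 0 := Subtype.ext (by rw [hπval, hroot]; rfl)
    calc _ = ψ (π f) := RingHom.congr_fun h1 f
      _ = 0 := by rw [h2, map_zero]
  · intro ψ ψ' h
    have h' := congrArg Subtype.val h
    simp only [Prod.mk.injEq] at h'
    obtain ⟨h1, h2, h3⟩ := h'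
    have h4 : ψ.comp π = ψ'.comp π := by
      refine Polynomial.ringHom_ext' (Polynomial.ringHom_ext' h1 h2) h3
    exact RingHom.cancel_right hπ |>.1 h4
  · rintro ⟨⟨φ, a, b⟩, hP⟩
    let χ : A[X][X] →+* k := eval₂RingHom (eval₂RingHom φ a) b
    have hχ : χ f = 0 := (eval₂_eval₂RingHom_apply φ a b f).trans hP
    have hle : ∀ g, π g = 0 → χ g = 0 := fun g hg ↦ by
      obtain ⟨q, rfl⟩ := hker g hg
      rw [map_mul, hχ, zero_mul]
    obtain ⟨ψ, hψ⟩ := exists_comp_eq_of_ker_le (R := A[X][X]) (S := A.adjoinPair x y) (T := k)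
      π hπ χ hle
    refine ⟨ψ, Subtype.ext (Prod.ext ?_ (Prod.ext ?_ ?_))⟩
    · refine RingHom.ext fun z ↦ ?_
      exact (hψ _).trans (by simp [χ])
    · exact (hψ _).trans (by simp [χ])
    · exact (hψ _).trans (by simp [χ])

end AdjoinPair

theorem exists_curve_bound_of_domain {A Ω : Type} [CommRing A] [IsDomain A] [Field Ω]
    [IsAlgClosed Ω] (j : A →+* Ω) (hj : Function.Injective j) {f u v : A[X][X]} {δ : A[X]}
    (hf : f.Monic) (hirr : Irreducible (f.map (mapRingHom j))) (hδ : δ ≠ 0)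
    (hbez : u * f + v * derivative f = C δ) :
    ∃ a : A, a ≠ 0 ∧ ∃ M : ℕ, ∀ (p : ℕ) [Fact p.Prime], M < p → ∀ φ : A →+* ZMod p, φ a ≠ 0 →
      |(Nat.card {P : ZMod p × ZMod p // (f.map (mapRingHom φ)).evalEval P.1 P.2 = 0} : ℤ) - p|
        ≤ M * Nat.sqrt p := by
  obtain ⟨a, ha0, ha⟩ := exists_ne_zero_irreducible_map j hj hf hirr
  obtain ⟨M, hM⟩ := curve_bound f.natDegree (f.support.sup fun i ↦ (f.coeff i).natDegree)
    δ.natDegree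
  refine ⟨a * δ.leadingCoeff, mul_ne_zero ha0 (leadingCoeff_ne_zero.2 hδ), M,
    fun p _ hp φ hφ ↦ ?_⟩
  rw [map_mul] at hφ
  refine hM p (f.map (mapRingHom φ)) (u.map (mapRingHom φ)) (v.map (mapRingHom φ)) (δ.map φ) hp
    (hf.map _) ?_ (hf.natDegree_map _) (fun i ↦ ?_) ?_ natDegree_map_le ?_
  · rw [Polynomial.map_map, mapRingHom_comp]
    refine ha _ ?_
    rw [RingHom.comp_apply, _root_.map_ne_zero]
    exact left_ne_zero_of_mul hφ
  · rw [coeff_map, coe_mapRingHom]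
    refine natDegree_map_le.trans ?_
    by_cases hi : i ∈ f.support
    · exact Finset.le_sup (f := fun i ↦ (f.coeff i).natDegree) hi
    · rw [notMem_support_iff.1 hi, natDegree_zero]
      exact Nat.zero_le _
  · intro h0
    have h1 := congrArg (fun q : (ZMod p)[X] ↦ q.coeff δ.natDegree) h0
    simp only [coeff_map, coeff_zero] at h1
    exact right_ne_zero_of_mul hφ h1
  · have h1 := congrArg (Polynomial.map (mapRingHom φ)) hbez
    rwa [Polynomial.map_add, Polynomial.map_mul, Polynomial.map_mul, ← derivative_map, map_C,
      coe_mapRingHom] at h1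

theorem HasHomCount.of_fibers {Q : ℕ → Prop} {n t : ℕ} {A B : Subring ℂ} (hA : IsFGSubring A)
    (h : HasHomCount Q n t A) (f : A[X][X])
    (hB : ∀ (p : ℕ) [Fact p.Prime], Nat.card (B →+* ZMod p) =
      Nat.card (Σ φ : A →+* ZMod p,
        {P : ZMod p × ZMod p // (f.map (mapRingHom φ)).evalEval P.1 P.2 = 0}))
    (hf : ∃ M : ℕ, ∀ (p : ℕ) [Fact p.Prime], M < p → ∀ φ : A →+* ZMod p,
      |(Nat.card {P : ZMod p × ZMod p // (f.map (mapRingHom φ)).evalEval P.1 P.2 = 0} : ℤ) - p|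
        ≤ M * Nat.sqrt p) :
    HasHomCount Q n (t + 1) B := by
  obtain ⟨C₁, hC₁⟩ := h
  obtain ⟨C₂, hC₂⟩ := hf
  refine ⟨(n + C₁) * C₂ + C₁ + C₂, fun p _ hp hQ ↦ ?_⟩
  have h1 := hC₁ p (by omega) hQ
  have h2 := hC₂ p (by omega)
  have : Finite (A →+* ZMod p) := hA.finite_ringHom
  have : Fintype (A →+* ZMod p) := Fintype.ofFinite _
  rw [hB p, Nat.card_sigma]
  set N : (A →+* ZMod p) → ℕ := fun φ ↦
    Nat.card {P : ZMod p × ZMod p // (f.map (mapRingHom φ)).evalEval P.1 P.2 = 0} with hN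
  have hp1 : (1 : ℝ) ≤ p := by exact_mod_cast (Fact.out : p.Prime).one_le
  have hp0 : (0 : ℝ) < p := by linarith
  have hs0 : (0 : ℝ) < √p := Real.sqrt_pos.2 hp0
  have hs1 : (1 : ℝ) ≤ √p := Real.one_le_sqrt.2 hp1
  have hss : √(p : ℝ) * √p = p := Real.mul_self_sqrt hp0.le
  have h3 : ∀ φ, |(N φ : ℝ) - p| ≤ C₂ * √p := by
    intro φ
    have h4 : |(N φ : ℝ) - p| ≤ C₂ * (Nat.sqrt p : ℝ) := by exact_mod_cast h2 φ
    exact h4.trans (mul_le_mul_of_nonneg_left Real.nat_sqrt_le_real_sqrt (Nat.cast_nonneg _))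
  set H := Nat.card (A →+* ZMod p) with hH
  have hsum : |((∑ φ, N φ : ℕ) : ℝ) - H * p| ≤ H * (C₂ * √p) := by
    have h4 : ((∑ φ, N φ : ℕ) : ℝ) - H * p = ∑ φ, ((N φ : ℝ) - p) := by
      rw [Finset.sum_sub_distrib, Finset.sum_const, Finset.card_univ, nsmul_eq_mul, hH,
        Nat.card_eq_fintype_card]
      push_cast
      rfl
    rw [h4]
    refine (Finset.abs_sum_le_sum_abs _ _).trans ((Finset.sum_le_sum fun φ _ ↦ h3 φ).trans ?_)
    rw [Finset.sum_const, Finset.card_univ, nsmul_eq_mul, hH, Nat.card_eq_fintype_card]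
  have hpt : (0 : ℝ) ≤ (p : ℝ) ^ t := by positivity
  have hle : (p : ℝ) ^ t / √p ≤ (p : ℝ) ^ t := div_le_self hpt hs1
  have hHle : (H : ℝ) ≤ (n + C₁) * (p : ℝ) ^ t := by
    have h4 := (abs_le.1 h1).2
    have h5 := mul_le_mul_of_nonneg_left hle (Nat.cast_nonneg (α := ℝ) C₁)
    rw [add_mul]
    linarith
  have hmain : |((∑ φ, N φ : ℕ) : ℝ) - n * (p : ℝ) ^ (t + 1)| ≤
      H * (C₂ * √p) + C₁ * ((p : ℝ) ^ t / √p) * p := by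
    have h4 : (H : ℝ) * p - n * (p : ℝ) ^ (t + 1) = (H - n * (p : ℝ) ^ t) * p := by ring
    have h5 := abs_sub_le ((∑ φ, N φ : ℕ) : ℝ) (H * p) (n * (p : ℝ) ^ (t + 1))
    rw [h4, abs_mul, abs_of_pos hp0] at h5
    have h6 := mul_le_mul_of_nonneg_right h1 hp0.le
    linarith
  refine hmain.trans ?_
  have h7 : (H : ℝ) * (C₂ * √p) ≤ (n + C₁) * (p : ℝ) ^ t * (C₂ * √p) :=
    mul_le_mul_of_nonneg_right hHle (by positivity)
  have h8 : (p : ℝ) ^ (t + 1) / √p = (p : ℝ) ^ t * √p := by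
    rw [div_eq_iff hs0.ne', mul_assoc, hss, pow_succ]
  have h9 : (p : ℝ) ^ t / √p * p = (p : ℝ) ^ t * √p := by
    rw [div_mul_eq_mul_div, ← pow_succ, h8]
  rw [h8]
  have h10 : C₁ * ((p : ℝ) ^ t / √p) * p = C₁ * ((p : ℝ) ^ t * √p) := by
    rw [mul_assoc, h9]
  rw [h10]
  have h11 : (0 : ℝ) ≤ C₂ * ((p : ℝ) ^ t * √p) := by positivity
  push_cast
  linarith [h7, h11]

/-- The inclusion of a subring of `ℂ` into an intermediate field containing it. -/
noncomputable def Subring.toIntermediateField {A : Subring ℂ} {E : IntermediateField ℚ ℂ}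
    (h : ∀ z ∈ A, z ∈ E) : A →+* E :=
  A.subtype.codRestrict E fun z ↦ h z z.2

section Models

variable {E : IntermediateField ℚ ℂ}

theorem toIntermediateField_injective {A : Subring ℂ} (h : ∀ z ∈ A, z ∈ E) :
    Function.Injective (Subring.toIntermediateField h) := fun _ _ hzw ↦
  Subtype.ext (congrArg (fun q : E ↦ (q : ℂ)) hzw)

theorem exists_finset_forall_lift (g : E[X][X]) :
    ∃ s : Finset ℂ, (∀ z ∈ s, z ∈ E) ∧ ∀ (A : Subring ℂ) (h : ∀ z ∈ A, z ∈ E),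
      (s : Set ℂ) ⊆ A →
        ∃ g' : A[X][X], g'.map (mapRingHom (Subring.toIntermediateField h)) = g := by
  classical
  refine ⟨g.support.biUnion fun i ↦ (g.coeff i).support.image fun j ↦ ((g.coeff i).coeff j : ℂ),
    fun z hz ↦ ?_, fun A h hs ↦ ?_⟩
  · simp only [Finset.mem_biUnion, Finset.mem_image] at hz
    obtain ⟨i, _, j, _, rfl⟩ := hz
    exact ((g.coeff i).coeff j).2
  · refine (mem_lifts _).1 ((lifts_iff_coeff_lifts _).2 fun i ↦ ?_)
    refine (mem_lifts (f := Subring.toIntermediateField h) _).1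
      ((lifts_iff_coeff_lifts _).2 fun j ↦ ?_)
    by_cases hij : (g.coeff i).coeff j = 0
    · exact ⟨0, by rw [hij, map_zero]⟩
    · have hi : g.coeff i ≠ 0 := fun h0 ↦ hij (by rw [h0, coeff_zero])
      refine ⟨⟨((g.coeff i).coeff j : ℂ), hs ?_⟩, rfl⟩
      rw [Finset.mem_coe]
      exact Finset.mem_biUnion.2 ⟨i, mem_support_iff.2 hi,
        Finset.mem_image.2 ⟨j, mem_support_iff.2 hij, rfl⟩⟩

theorem exists_fgSubring_adjoin_eq (hE : E.FG) (s : Finset ℂ) (hs : ∀ z ∈ s, z ∈ E) :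
    ∃ A : Subring ℂ, IsFGSubring A ∧ (s : Set ℂ) ⊆ A ∧ (∀ z ∈ A, z ∈ E) ∧
      IntermediateField.adjoin ℚ (A : Set ℂ) = E := by
  classical
  obtain ⟨S, hS⟩ := hE
  have hSE : ∀ z ∈ S, z ∈ E := fun z hz ↦ hS ▸ IntermediateField.subset_adjoin ℚ _ hz
  have hle : Subring.closure ((S ∪ s : Finset ℂ) : Set ℂ) ≤ E.toSubalgebra.toSubring :=
    Subring.closure_le.2 fun z hz ↦ by
      rcases Finset.mem_union.1 (Finset.mem_coe.1 hz) with hz | hz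
      · exact hSE z hz
      · exact hs z hz
  refine ⟨Subring.closure (S ∪ s : Finset ℂ), ⟨_, rfl⟩,
    fun z hz ↦ Subring.subset_closure ?_, hle, le_antisymm ?_ ?_⟩
  · rw [Finset.coe_union]
    exact Or.inr hz
  · exact IntermediateField.adjoin_le_iff.2 hle
  · rw [← hS]
    refine IntermediateField.adjoin.mono ℚ _ _ fun z hz ↦ Subring.subset_closure ?_
    rw [Finset.coe_union]
    exact Or.inl hz

theorem exists_fgSubring_inv_mem {A : Subring ℂ} (hA : IsFGSubring A) (hAE : ∀ z ∈ A, z ∈ E)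
    {b : ℂ} (hb : b ∈ A) :
    ∃ A' : Subring ℂ, IsFGSubring A' ∧ A ≤ A' ∧ b⁻¹ ∈ A' ∧ ∀ z ∈ A', z ∈ E := by
  classical
  obtain ⟨S, hS⟩ := hA
  have hle : Subring.closure ((insert b⁻¹ S : Finset ℂ) : Set ℂ) ≤ E.toSubalgebra.toSubring :=
    Subring.closure_le.2 fun z hz ↦ by
      rcases Finset.mem_insert.1 (Finset.mem_coe.1 hz) with rfl | hz
      · exact E.inv_mem (hAE b hb)
      · exact hAE z (hS ▸ Subring.subset_closure hz)
  refine ⟨Subring.closure (insert b⁻¹ S : Finset ℂ), ⟨_, rfl⟩, ?_, ?_, hle⟩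
  · rw [← hS]
    exact Subring.closure_mono (by rw [Finset.coe_insert]; exact Set.subset_insert _ _)
  · exact Subring.subset_closure (by simp)

theorem adjoin_eq_of_le {A A' : Subring ℂ} (h : A ≤ A')
    (hA : IntermediateField.adjoin ℚ (A : Set ℂ) = E) (hA' : ∀ z ∈ A', z ∈ E) :
    IntermediateField.adjoin ℚ (A' : Set ℂ) = E :=
  le_antisymm (IntermediateField.adjoin_le_iff.2 hA')
    (hA ▸ IntermediateField.adjoin.mono ℚ _ _ h)

theorem eval₂_map_toIntermediateField {A : Subring ℂ} (h : ∀ z ∈ A, z ∈ E) (g : A[X][X])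
    (x y : ℂ) :
    eval₂ (eval₂RingHom (algebraMap E ℂ) x) y
      (g.map (mapRingHom (Subring.toIntermediateField h))) =
      eval₂ (eval₂RingHom A.subtype x) y g := by
  rw [eval₂_eval₂RingHom_apply, eval₂_eval₂RingHom_apply, Polynomial.map_map, mapRingHom_comp]
  rfl

theorem map_toIntermediateField_injective {A : Subring ℂ} (h : ∀ z ∈ A, z ∈ E) :
    Function.Injective fun g : A[X][X] ↦ g.map (mapRingHom (Subring.toIntermediateField h)) :=
  Polynomial.map_injective _ (Polynomial.map_injective _ (toIntermediateField_injective h))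

/-- Counting homomorphisms through a fibration in geometrically irreducible curves. -/
theorem HasHomCount.of_curve_fibration {K : IntermediateField ℚ ℂ} (hE : E.FG) (hEK : E ≤ K)
    {x y : ℂ} (hK : IntermediateField.adjoin ℚ ((E : Set ℂ) ∪ {x, y}) = K)
    {f u v : E[X][X]} {δ : E[X]} (hf : f.Monic)
    (hroot : eval₂ (eval₂RingHom (algebraMap E ℂ) x) y f = 0)
    (hmin : ∀ g : E[X][X], g.natDegree < f.natDegree →
      eval₂ (eval₂RingHom (algebraMap E ℂ) x) y g = 0 → g = 0)
    (hirr : Irreducible (f.map (mapRingHom (algebraMap E (algebraicClosure E ℂ)))))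
    (hδ : δ ≠ 0) (hbez : u * f + v * derivative f = C δ) {Q : ℕ → Prop} {n t : ℕ}
    (hcount : ∀ A : Subring ℂ, IsFGSubring A → IntermediateField.adjoin ℚ (A : Set ℂ) = E →
      HasHomCount Q n t A) :
    ∃ B : Subring ℂ, IsFGSubring B ∧ IntermediateField.adjoin ℚ (B : Set ℂ) = K ∧
      HasHomCount Q n (t + 1) B := by
  classical
  obtain ⟨sf, hsf, hlf⟩ := exists_finset_forall_lift f
  obtain ⟨su, hsu, hlu⟩ := exists_finset_forall_lift u
  obtain ⟨sv, hsv, hlv⟩ := exists_finset_forall_lift v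
  obtain ⟨sd, hsd, hld⟩ := exists_finset_forall_lift (C δ)
  obtain ⟨A₁, hA₁, hs, hA₁E, hadj⟩ := exists_fgSubring_adjoin_eq hE (sf ∪ su ∪ sv ∪ sd)
    fun z hz ↦ by
      simp only [Finset.mem_union] at hz
      rcases hz with ((hz | hz) | hz) | hz
      exacts [hsf z hz, hsu z hz, hsv z hz, hsd z hz]
  simp only [Finset.coe_union, Set.union_subset_iff] at hs
  obtain ⟨f₁, hf₁⟩ := hlf A₁ hA₁E hs.1.1.1
  obtain ⟨u₁, hu₁⟩ := hlu A₁ hA₁E hs.1.1.2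
  obtain ⟨v₁, hv₁⟩ := hlv A₁ hA₁E hs.1.2
  obtain ⟨d₁, hd₁⟩ := hld A₁ hA₁E hs.2
  set ι := Subring.toIntermediateField hA₁E with hι
  have hιinj : Function.Injective ι := toIntermediateField_injective hA₁E
  have hmapinj := map_toIntermediateField_injective hA₁E
  have hδ₁ : C (d₁.coeff 0) = d₁ := by
    apply hmapinj
    change (C (d₁.coeff 0)).map (mapRingHom ι) = d₁.map (mapRingHom ι)
    rw [map_C, ← coeff_map, hd₁, coeff_C_zero]
  have hf₁m : f₁.Monic := by
    have := hf
    rw [← hf₁] at this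
    exact (Function.Injective.monic_map_iff (Polynomial.map_injective _ hιinj)).2 this
  have hirr₁ : Irreducible (f₁.map (mapRingHom
      ((algebraMap E (algebraicClosure E ℂ)).comp ι))) := by
    rwa [← mapRingHom_comp, ← Polynomial.map_map, hf₁]
  have hδ₁0 : d₁.coeff 0 ≠ 0 := by
    intro h0
    rw [h0, C_0] at hδ₁
    rw [← hδ₁, Polynomial.map_zero] at hd₁
    exact hδ (C_eq_zero.1 hd₁.symm)
  have hbez₁ : u₁ * f₁ + v₁ * derivative f₁ = C (d₁.coeff 0) := by
    rw [hδ₁]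
    apply hmapinj
    change (u₁ * f₁ + v₁ * derivative f₁).map (mapRingHom ι) = d₁.map (mapRingHom ι)
    rw [Polynomial.map_add, Polynomial.map_mul, Polynomial.map_mul, ← derivative_map, hf₁, hu₁,
      hv₁, hd₁, hbez]
  have : IsAlgClosed (algebraicClosure E ℂ) := IsAlgClosure.isAlgClosed E
  obtain ⟨a, ha0, M, hM⟩ := exists_curve_bound_of_domain
    ((algebraMap E (algebraicClosure E ℂ)).comp ι)
    ((algebraMap E (algebraicClosure E ℂ)).injective.comp hιinj) hf₁m hirr₁ hδ₁0 hbez₁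
  obtain ⟨A, hA, hA₁A, hainv, hAE⟩ := exists_fgSubring_inv_mem hA₁ hA₁E a.2
  have hAadj := adjoin_eq_of_le hA₁A hadj hAE
  set inc := Subring.inclusion hA₁A with hinc
  have hcomp : (Subring.toIntermediateField hAE).comp inc = ι := rfl
  have hfA : (f₁.map (mapRingHom inc)).map (mapRingHom (Subring.toIntermediateField hAE)) = f := by
    rw [Polynomial.map_map, mapRingHom_comp, hcomp, hf₁]
  have hunit : ∀ {k : Type} [Field k] (φ : A →+* k), φ (inc a) ≠ 0 := by
    intro k _ φ h0
    have h1 : inc a * ⟨_, hainv⟩ = 1 := by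
      apply Subtype.ext
      exact mul_inv_cancel₀ fun h ↦ ha0 (Subtype.ext h)
    have h2 := congrArg φ h1
    rw [map_mul, h0, zero_mul, map_one] at h2
    exact zero_ne_one h2
  have hBK : ∀ z ∈ A.adjoinPair x y, z ∈ K := by
    have : A.adjoinPair x y ≤ K.toSubalgebra.toSubring := by
      refine adjoinPair_le (fun z hz ↦ hEK (hAE z hz)) ?_ ?_
      · exact hK ▸ IntermediateField.subset_adjoin ℚ _ (by simp)
      · exact hK ▸ IntermediateField.subset_adjoin ℚ _ (by simp)
    exact this
  refine ⟨A.adjoinPair x y, hA.adjoinPair, le_antisymm (IntermediateField.adjoin_le_iff.2 hBK) ?_,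
    (hcount A hA hAadj).of_fibers hA (f₁.map (mapRingHom inc)) (fun p _ ↦ ?_)
      ⟨M, fun p _ hp φ ↦ ?_⟩⟩
  · rw [← hK]
    refine IntermediateField.adjoin_le_iff.2 (Set.union_subset ?_ ?_)
    · have : E ≤ IntermediateField.adjoin ℚ ((A.adjoinPair x y : Subring ℂ) : Set ℂ) := by
        rw [← hAadj]
        exact IntermediateField.adjoin.mono ℚ _ _ (le_adjoinPair A x y)
      exact this
    · rintro z (rfl | rfl)
      · exact IntermediateField.subset_adjoin ℚ _ (left_mem_adjoinPair A _ _)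
      · exact IntermediateField.subset_adjoin ℚ _ (right_mem_adjoinPair A _ _)
  · refine card_ringHom_adjoinPair (hf₁m.map _) ?_ (fun g hg hg0 ↦ ?_) (ZMod p)
    · rw [← eval₂_map_toIntermediateField hAE, hfA, hroot]
    · apply map_toIntermediateField_injective hAE
      change g.map _ = (0 : A[X][X]).map _
      rw [Polynomial.map_zero]
      refine hmin _ (natDegree_map_le.trans_lt ?_) ?_
      · rwa [← hf₁, hf₁m.natDegree_map, ← hf₁m.natDegree_map (mapRingHom inc)]
      · rw [eval₂_map_toIntermediateField hAE, hg0]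
  · rw [Polynomial.map_map, mapRingHom_comp]
    exact hM p hp (φ.comp inc) (hunit φ)

end Models

section Induction

theorem isAlgebraic_adjoin_iff_of_ringHom {L ι : Type*} [Field L] [Algebra ℚ L] (j : L →ₐ[ℚ] ℂ)
    (x : ι → L) (z : L) : IsAlgebraic (Algebra.adjoin ℚ (Set.range x)) z ↔
      IsAlgebraic (IntermediateField.adjoin ℚ (Set.range fun i ↦ j (x i))) (j z) := by
  rw [IntermediateField.isAlgebraic_adjoin_iff]
  have hrange : (Algebra.adjoin ℚ (Set.range x)).map j =
      Algebra.adjoin ℚ (Set.range fun i ↦ j (x i)) := by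
    rw [AlgHom.map_adjoin, ← Set.range_comp]
    rfl
  have hmem : ∀ w : Algebra.adjoin ℚ (Set.range x), j w ∈
      Algebra.adjoin ℚ (Set.range fun i ↦ j (x i)) := fun w ↦ hrange ▸ ⟨w, w.2, rfl⟩
  let g := ((j.comp (Algebra.adjoin ℚ (Set.range x)).val).codRestrict _ hmem).toRingHom
  have hg : (algebraMap (Algebra.adjoin ℚ (Set.range fun i ↦ j (x i))) ℂ).comp g =
      (j : L →+* ℂ).comp (algebraMap (Algebra.adjoin ℚ (Set.range x)) L) := RingHom.ext fun _ ↦ rfl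
  constructor
  · intro h
    refine IsAlgebraic.ringHom_of_comp_eq g (j : L →+* ℂ) h (fun a b hab ↦ ?_) hg
    exact Subtype.ext (j.injective (congrArg Subtype.val hab))
  · intro h
    refine IsAlgebraic.of_ringHom_of_comp_eq g (j : L →+* ℂ) h ?_ j.injective hg
    rintro ⟨v, hv⟩
    rw [← hrange] at hv
    obtain ⟨v', hv', rfl⟩ := hv
    exact ⟨⟨v', hv'⟩, rfl⟩

/-- The cardinality of a family over which `K` is algebraic bounds the number of algebraically
independent elements of `K`. -/
theorem card_le_of_algebraicIndependent {K : IntermediateField ℚ ℂ} {ι : Type} [Fintype ι]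
    {x : ι → ℂ} (hxK : ∀ j, x j ∈ K)
    (halg : ∀ z ∈ K, IsAlgebraic (IntermediateField.adjoin ℚ (Set.range x)) z)
    {s : ℕ} (z : Fin s → ℂ) (hz : ∀ i, z i ∈ K) (hind : AlgebraicIndependent ℚ z) :
    s ≤ Fintype.card ι := by
  let x' : ι → K := fun j ↦ ⟨x j, hxK j⟩
  have : Algebra.IsAlgebraic (Algebra.adjoin ℚ (Set.range x')) K :=
    ⟨fun w ↦ (isAlgebraic_adjoin_iff_of_ringHom (algebraMap K ℂ).toRatAlgHom x' w).2 (halg w w.2)⟩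
  have h1 := Algebra.IsAlgebraic.trdeg_le_cardinalMk ℚ (Set.range x')
  have h2 : AlgebraicIndependent ℚ (fun i ↦ (⟨z i, hz i⟩ : K)) :=
    AlgebraicIndependent.of_comp (algebraMap K ℂ).toRatAlgHom hind
  have h3 := h2.lift_cardinalMk_le_trdeg.trans (Cardinal.lift_le.2 (h1.trans Cardinal.mk_range_le))
  simpa using h3

/-- The ring of integers of `F` has exactly `[F : ℚ]` homomorphisms to `𝔽_p` when `p` splits
completely in `F`. -/
theorem hasHomCount_numberField {F : IntermediateField ℚ ℂ} [FiniteDimensional ℚ F] :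
    ∃ R : Subring ℂ, IsFGSubring R ∧ IntermediateField.adjoin ℚ (R : Set ℂ) = F ∧
      HasHomCount (SplitsCompletely F) (Module.finrank ℚ F) 0 R := by
  have hinj : Function.Injective (algebraMap F ℂ) := (algebraMap F ℂ).injective
  have hnoeth : IsNoetherian ℤ (integralClosure ℤ F) := IsIntegralClosure.isNoetherian ℤ ℚ F _
  have hfrac : IsFractionRing (integralClosure ℤ F) F :=
    IsIntegralClosure.isFractionRing_of_finite_extension ℤ ℚ F (integralClosure ℤ F)
  refine ⟨(integralClosure ℤ F).toSubring.map (algebraMap F ℂ), ?_, ?_, 0, fun p _ _ hp ↦ ?_⟩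
  · obtain ⟨s, hs⟩ := hnoeth.noetherian ⊤
    classical
    refine ⟨s.image fun z : integralClosure ℤ F ↦ ((z : F) : ℂ), le_antisymm ?_ ?_⟩
    · rw [Subring.closure_le]
      intro z hz
      rw [Finset.coe_image] at hz
      obtain ⟨w, -, rfl⟩ := hz
      exact ⟨_, w.2, rfl⟩
    · rintro _ ⟨w, hw, rfl⟩
      have h : (⟨w, hw⟩ : integralClosure ℤ F) ∈ Submodule.span ℤ (s : Set (integralClosure ℤ F)) :=
        hs ▸ Submodule.mem_top
      have key : ∀ v ∈ Submodule.span ℤ (s : Set (integralClosure ℤ F)), ((v : F) : ℂ) ∈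
          Subring.closure
            ((s.image fun z : integralClosure ℤ F ↦ ((z : F) : ℂ) : Finset ℂ) : Set ℂ) := by
        intro v hv
        induction hv using Submodule.span_induction with
        | mem v hv =>
          exact Subring.subset_closure (Finset.mem_coe.2 (Finset.mem_image_of_mem _ hv))
        | zero => exact zero_mem _
        | add v w _ _ hv hw => exact add_mem hv hw
        | smul n v _ hv =>
          have := zsmul_mem hv n
          simpa using this
      exact key _ h
  · refine le_antisymm (IntermediateField.adjoin_le_iff.2 ?_) fun z hz ↦ ?_
    · rintro _ ⟨w, -, rfl⟩
      exact w.2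
    · obtain ⟨a, b, -, hab⟩ :=
        IsFractionRing.div_surjective (A := integralClosure ℤ F) (⟨z, hz⟩ : F)
      exact (mem_adjoin_subring_iff _).2 ⟨_, ⟨a, a.2, rfl⟩, _, ⟨b, b.2, rfl⟩,
        congrArg Subtype.val hab⟩
  · have e : integralClosure ℤ F ≃+* (integralClosure ℤ F).toSubring.map (algebraMap F ℂ) :=
      Subring.equivMapOfInjective (integralClosure ℤ F).toSubring _ hinj
    have h : Nat.card ((integralClosure ℤ F).toSubring.map (algebraMap F ℂ) →+* ZMod p) =
        Module.finrank ℚ F := by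
      rw [← hp]
      exact Nat.card_congr
        ⟨fun φ ↦ φ.comp (e : integralClosure ℤ F →+* _), fun φ ↦ φ.comp (e.symm : _ →+* _),
          fun φ ↦ RingHom.ext fun w ↦ by simp, fun φ ↦ RingHom.ext fun w ↦ by simp⟩
    rw [h]
    simp

/-- The Lang-Weil estimate, for rings with a given finite transcendence basis of the fraction
field. -/
theorem hasHomCount_of_card_eq {F : IntermediateField ℚ ℂ} (t : ℕ) :
    ∀ {K : IntermediateField ℚ ℂ} (_ : K.FG) {ι : Type} [Fintype ι] (_ : Fintype.card ι = t)
      (x : ι → ℂ) (_ : ∀ j, x j ∈ K) (_ : AlgebraicIndependent ℚ x)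
      (_ : ∀ z ∈ K, IsAlgebraic (IntermediateField.adjoin ℚ (Set.range x)) z)
      (_ : ∀ z, z ∈ F ↔ z ∈ K ∧ IsAlgebraic ℚ z) {R : Subring ℂ} (_ : IsFGSubring R)
      (_ : IntermediateField.adjoin ℚ (R : Set ℂ) = K),
      HasHomCount (SplitsCompletely F) (Module.finrank ℚ F) t R := by
  induction t with
  | zero =>
    intro K hK ι _ hι x hxK hind halg hF R hR hRK
    have hempty : IsEmpty ι := Fintype.card_eq_zero_iff.1 hι
    have halg' : ∀ z ∈ K, IsAlgebraic ℚ z := by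
      intro z hz
      have h := IntermediateField.isAlgebraic_adjoin_iff.1 (halg z hz)
      rw [Set.range_eq_empty, Algebra.adjoin_empty] at h
      exact Subalgebra.isAlgebraic_of_isAlgebraic_bot h
    have hFK : F = K := by
      ext z
      exact (hF z).trans ⟨fun h ↦ h.1, fun h ↦ ⟨h, halg' z h⟩⟩
    subst hFK
    have : FiniteDimensional ℚ F := by
      obtain ⟨s, rfl⟩ := hK
      exact IntermediateField.finiteDimensional_adjoin fun z hz ↦
        (halg' z (IntermediateField.subset_adjoin ℚ _ hz)).isIntegral
    obtain ⟨S, hS, hSF, hcount⟩ := hasHomCount_numberField (F := F)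
    exact hcount.of_adjoin_eq hS hR hSF hRK fun s z hz hzi ↦
      (card_le_of_algebraicIndependent hxK halg z hz hzi).trans hι.le
  | succ t ih =>
    intro K hK ι _ hι x hxK hind halg hF R hR hRK
    classical
    obtain ⟨i⟩ : Nonempty ι := Fintype.card_pos_iff.1 (by omega)
    obtain ⟨E, hEK, hE, hxE, halgE, hFE, y, hyK, hadj, f, u, v, δ, hf, hroot, hmin, hirr, hδ,
      hbez⟩ :=
      exists_fibration hK x hxK hind halg i
    have hcard : Fintype.card {j // j ≠ i} = t := by
      rw [Fintype.card_subtype_compl, Fintype.card_subtype_eq, hι, Nat.add_sub_cancel]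
    have hFE' : ∀ z, z ∈ F ↔ z ∈ E ∧ IsAlgebraic ℚ z := fun z ↦
      (hF z).trans ⟨fun h ↦ ⟨hFE z h.1 h.2, h.2⟩, fun h ↦ ⟨hEK h.1, h.2⟩⟩
    obtain ⟨B, hB, hBK, hcount⟩ := HasHomCount.of_curve_fibration hE hEK hadj hf hroot hmin hirr hδ
      hbez fun A hA hAE ↦ ih hE hcard (fun j : {j // j ≠ i} ↦ x j) hxE
        (hind.comp _ Subtype.val_injective) halgE hFE' hA hAE
    exact hcount.of_adjoin_eq hB hR hBK hRK fun s z hz hzi ↦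
      (card_le_of_algebraicIndependent hxK halg z hz hzi).trans hι.le

end Induction

end LangWeil

theorem stmt14 (R : Subring ℂ) (hfg : ∃ s : Finset ℂ, Subring.closure (s : Set ℂ) = R)
    -- `K` is the fraction field of `R`, realized as the subfield of `ℂ` generated by `R`
    (K : IntermediateField ℚ ℂ) (hK : K = IntermediateField.adjoin ℚ (R : Set ℂ))
    -- `t` is the transcendence degree of `Frac(R)` over `ℚ`
    (t : ℕ) (x : Fin t → K) (hx : IsTranscendenceBasis ℚ x)
    -- `F` is the algebraic closure of `ℚ` inside `Frac(R)`
    (F : IntermediateField ℚ ℂ)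
    (hF : ∀ z : ℂ, z ∈ F ↔ (z ∈ K ∧ IsAlgebraic ℚ z)) :
    ∃ C : ℝ, ∀ p : ℕ, p.Prime → C < p → SplitsCompletely F p →
      |(Nat.card (↥R →+* ZMod p) : ℝ) - (Module.finrank ℚ F : ℝ) * (p : ℝ) ^ (t : ℕ)|
        < C * (p : ℝ) ^ ((t : ℝ) - 1 / 2) := by
  have hKfg : K.FG := by
    obtain ⟨s, rfl⟩ := hfg
    refine ⟨s, le_antisymm (hK ▸ IntermediateField.adjoin.mono ℚ _ _ Subring.subset_closure) ?_⟩
    rw [hK, IntermediateField.adjoin_le_iff]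
    have : Subring.closure (s : Set ℂ) ≤
        (IntermediateField.adjoin ℚ (s : Set ℂ)).toSubalgebra.toSubring :=
      Subring.closure_le.2 (IntermediateField.subset_adjoin ℚ _)
    exact this
  have hind : AlgebraicIndependent ℚ fun i ↦ (x i : ℂ) :=
    hx.1.map' (f := (algebraMap K ℂ).toRatAlgHom) (algebraMap K ℂ).injective
  have halg : ∀ z ∈ K,
      IsAlgebraic (IntermediateField.adjoin ℚ (Set.range fun i ↦ (x i : ℂ))) z := by
    intro z hz
    have := hx.isAlgebraic
    exact (isAlgebraic_adjoin_iff_of_ringHom (algebraMap K ℂ).toRatAlgHom x ⟨z, hz⟩).1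
      (Algebra.IsAlgebraic.isAlgebraic _)
  obtain ⟨C, hC⟩ := hasHomCount_of_card_eq t hKfg (Fintype.card_fin t) (fun i ↦ (x i : ℂ))
    (fun i ↦ (x i).2) hind halg hF hfg hK.symm
  refine ⟨C + 1, fun p hp hCp hsplit ↦ ?_⟩
  have : Fact p.Prime := ⟨hp⟩
  have hp0 : (0 : ℝ) < p := by exact_mod_cast hp.pos
  have hpow : (p : ℝ) ^ ((t : ℝ) - 1 / 2) = (p : ℝ) ^ t / √p := by
    rw [Real.rpow_sub hp0, Real.rpow_natCast, Real.sqrt_eq_rpow]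
  have hlt : C < p := by
    have : (C : ℝ) < p := by linarith
    exact_mod_cast this
  refine (hC p hlt hsplit).trans_lt ?_
  rw [hpow]
  have : 0 < (p : ℝ) ^ t / √p := by positivity
  linarith
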